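/- arXiv:2403.03470 — 2 statements merged into one kernel-verified Lean document; each statement's English description precedes it below -/
import Mathlib

section
/- Propagation identity for cross microlocal defect measures of wave equations: let (φ_n), (ψ_n) ⊂ C_c^∞(ℝ^(d+1); ℝ) be supported in a fixed compact set, with sup_n (norm of φ_n in H^1 + norm of ψ_n in H^1 + L² norm of Box_{g_0}φ_n + L² norm of Box_{g_0}ψ_n) < ∞, and φ_n → 0, ψ_n → 0 in L². Suppose ν is a finite signed Borel measure on ℝ^(d+1) × S^d such that for every f ∈ C_c^∞(ℝ^(d+1); ℝ), every positively 0-homogeneous m ∈ C^∞(ℝ^(d+1)∖{0}; ℝ), and all α,β ∈ {0,…,d}: ⟨∂_α φ_n, f·T_m(∂_β ψ_n)⟩ → ∫_{ℝ^(d+1)×S^d} f(x) m(ξ) ξ_α ξ_β dν(x,ξ) as n → ∞. Then for every positively 0-homogeneous m ∈ C^∞(ℝ^(d+1)∖{0}; ℝ) and every smooth vector field X = X^ρ ∂_ρ on ℝ^(d+1): (1/2)(⟨Box_{g_0} φ_n, X(T_m ψ_n)⟩ + ⟨X φ_n, T_m(Box_{g_0} ψ_n)⟩) converges, as n → ∞,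 to −(1/2) ∫_{ℝ^(d+1)×S^d} {g_0^μν ξ_μ ξ_ν, X^ρ(x) ξ_ρ m(ξ)}(x,ξ) dν(x,ξ), where {f,h} := ∂_{ξ_μ} f ∂_{x^μ} h − ∂_{x^μ} f ∂_{ξ_μ} h. -/
noncomputable section

open MeasureTheory Filter Topology
open scoped ENNReal NNReal

abbrev Vec (d : ℕ) := Fin (d + 1) → ℝ
abbrev SymMat (d : ℕ) := Vec d → Matrix (Fin (d + 1)) (Fin (d + 1)) ℝ
abbrev Met (d : ℕ) := SymMat d
abbrev Phase (d : ℕ) := Vec d × Vec d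

/-- Coordinate partial derivative `∂_α`. -/
def pd {d : ℕ} {E : Type*} [NormedAddCommGroup E] [NormedSpace ℝ E]
    (α : Fin (d + 1)) (f : Vec d → E) (x : Vec d) : E :=
  fderiv ℝ f x (Pi.single α 1)

/-- Entries of the pointwise inverse matrix `g^{αβ}`. -/
def ginv {d : ℕ} (g : Met d) (x : Vec d) : Matrix (Fin (d + 1)) (Fin (d + 1)) ℝ := (g x)⁻¹

/-- Minkowski matrix `diag(-1,1,…,1)`. -/
def mink (d : ℕ) : Matrix (Fin (d + 1)) (Fin (d + 1)) ℝ :=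
  Matrix.diagonal (fun α => if α = 0 then (-1 : ℝ) else 1)

/-- A metric on V : smooth entries, symmetric and invertible pointwise on V. -/
def IsMetricOn {d : ℕ} (g : Met d) (V : Set (Vec d)) : Prop :=
  (∀ α β, ContDiffOn ℝ (⊤ : ℕ∞) (fun x => g x α β) V) ∧
  (∀ x ∈ V, (g x).IsSymm) ∧ (∀ x ∈ V, IsUnit (g x).det)

/-- Christoffel symbol `Γ_{αβμ}(g)`. -/
def Christoffel {d : ℕ} (g : Met d) (α β μ : Fin (d + 1)) (x : Vec d) : ℝ :=
  (1 / 2) * (pd α (fun y => g y μ β) x + pd μ (fun y => g y α β) x - pd β (fun y => g y α μ) x)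

/-- Mixed Christoffel symbol `Γ_ρ{}^α{}_μ(g)`. -/
def GammaMix {d : ℕ} (g : Met d) (ρ α μ : Fin (d + 1)) (x : Vec d) : ℝ :=
  ∑ β, ginv g x α β * Christoffel g ρ β μ x

/-- Coordinate formula for the Ricci curvature. -/
def RicciC {d : ℕ} (g : Met d) (μ ν : Fin (d + 1)) (x : Vec d) : ℝ :=
  (∑ α, ∑ β, ginv g x α β * (pd β (Christoffel g μ α ν) x - pd ν (Christoffel g μ α β) x)) +
  ∑ α, ∑ β, ∑ σ, ∑ ρ, ginv g x α β * ginv g x σ ρ *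
    (Christoffel g ν σ α x * Christoffel g μ ρ β x -
      Christoffel g α σ β x * Christoffel g μ ρ ν x)

/-- `H^ρ(g)(∂p)`. -/
def Hgauge {d : ℕ} (g : Met d) (p : SymMat d) (ρ : Fin (d + 1)) (x : Vec d) : ℝ :=
  ∑ σ, ∑ α, ∑ β, ginv g x ρ σ * ginv g x α β *
    (pd β (fun y => p y σ α) x - (1 / 2) * pd σ (fun y => p y α β) x)

/-- Scalar wave operator `Box_g f = g^{αβ} ∂²_{αβ} f − H^α(g)(∂g) ∂_α f`. -/
def BoxOp {d : ℕ} {E : Type*} [NormedAddCommGroup E] [NormedSpace ℝ E]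
    (g : Met d) (f : Vec d → E) (x : Vec d) : E :=
  (∑ α, ∑ β, ginv g x α β • pd α (pd β f) x) - ∑ α, Hgauge g g α x • pd α f x

/-- Fourier transform on `ℝ^n` with the convention `∫ f(x) e^{-i x·ξ} dx`. -/
def ft {n : ℕ} (f : (Fin n → ℝ) → ℂ) (ξ : Fin n → ℝ) : ℂ :=
  ∫ x : Fin n → ℝ, f x * Complex.exp (-Complex.I * (∑ i, x i * ξ i))

/-- Inverse Fourier transform on `ℝ^n`. -/
def ftInv {n : ℕ} (f : (Fin n → ℝ) → ℂ) (x : Fin n → ℝ) : ℂ :=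
  ((((2 * Real.pi) ^ n)⁻¹ : ℝ) : ℂ) *
    ∫ ξ : Fin n → ℝ, f ξ * Complex.exp (Complex.I * (∑ i, x i * ξ i))

/-- Fourier multiplier operator `T_m u = F^{-1}(m · F u)`. -/
def Tm {n : ℕ} (m : (Fin n → ℝ) → ℝ) (u : (Fin n → ℝ) → ℂ) : (Fin n → ℝ) → ℂ :=
  ftInv (fun ξ => (m ξ : ℂ) * ft u ξ)

/-- Pairing `⟨u,v⟩ = ∫ conj(u) v √|det g| dx`. -/
def pairG {d : ℕ} (g : Met d) (u v : Vec d → ℂ) : ℂ :=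
  ∫ x : Vec d, (starRingEnd ℂ) (u x) * v x * ((Real.sqrt |(g x).det| : ℝ) : ℂ)

/-- `m` is smooth away from `0` and positively `0`-homogeneous. -/
def Homog0 {n : ℕ} (m : (Fin n → ℝ) → ℝ) : Prop :=
  ContDiffOn ℝ (⊤ : ℕ∞) m {(0 : Fin n → ℝ)}ᶜ ∧ ∀ s : ℝ, 0 < s → ∀ ξ, m (s • ξ) = m ξ

/-- Integral of a function against a (finite) signed measure. -/
def sInt {X : Type*} [MeasurableSpace X] (μ : MeasureTheory.SignedMeasure X) (f : X → ℝ) : ℝ :=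
  (∫ x, f x ∂μ.toJordanDecomposition.posPart) -
    ∫ x, f x ∂μ.toJordanDecomposition.negPart

/-- Unit sphere `S^d ⊂ ℝ^{d+1}`. -/
def usphere (d : ℕ) : Set (Vec d) := {ξ | ∑ α, ξ α ^ 2 = 1}

/-- Integral against `dμ := g_0^{αρ} g_0^{βσ} ((1/4) dμ_{ρβασ} − (1/8) dμ_{ραβσ})`. -/
def muInt {d : ℕ} (g0 : Met d)
    (μm : Fin (d + 1) → Fin (d + 1) → Fin (d + 1) → Fin (d + 1) →
      MeasureTheory.SignedMeasure (Phase d))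
    (c : Phase d → ℝ) : ℝ :=
  ∑ α, ∑ β, ∑ ρ, ∑ σ,
    ((1 / 4) * sInt (μm ρ β α σ) (fun p => ginv g0 p.1 α ρ * ginv g0 p.1 β σ * c p) -
     (1 / 8) * sInt (μm ρ α β σ) (fun p => ginv g0 p.1 α ρ * ginv g0 p.1 β σ * c p))

/-- `∂_{x^μ}` on phase space. -/
def pdx {d : ℕ} (μ : Fin (d + 1)) (F : Phase d → ℝ) (p : Phase d) : ℝ :=
  fderiv ℝ F p (Pi.single μ 1, 0)

/-- `∂_{ξ_μ}` on phase space. -/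
def pdxi {d : ℕ} (μ : Fin (d + 1)) (F : Phase d → ℝ) (p : Phase d) : ℝ :=
  fderiv ℝ F p (0, Pi.single μ 1)

/-- `g_0^{μν} ξ_μ ξ_ν` as a function on phase space. -/
def Gq {d : ℕ} (g0 : Met d) (p : Phase d) : ℝ := ∑ μ, ∑ ν, ginv g0 p.1 μ ν * p.2 μ * p.2 ν

/-- Poisson bracket `{F,G} = ∂_{ξ_μ}F ∂_{x^μ}G − ∂_{x^μ}F ∂_{ξ_μ}G`. -/
def pbracket {d : ℕ} (F G : Phase d → ℝ) (p : Phase d) : ℝ :=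
  ∑ μ, (pdxi μ F p * pdx μ G p - pdx μ F p * pdxi μ G p)

/-- The `X^p_λ(g)` norm. -/
def XNorm {d : ℕ} (p : ℝ≥0∞) (lam : ℝ) (g : Met d) (f : Vec d → ℂ) : ℝ :=
  lam⁻¹ * (eLpNorm f p volume).toReal +
  (∑ α, (eLpNorm (pd α f) p volume).toReal) +
  lam * (∑ α, ∑ β, (eLpNorm (pd α (pd β f)) p volume).toReal) +
  (eLpNorm (BoxOp g f) p volume).toReal

/-- Null form `𝔔_0^{(g)}` (complex-valued). -/
def Q0C {d : ℕ} (g : Met d) (φ ψ : Vec d → ℂ) (x : Vec d) : ℂ :=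
  ∑ α, ∑ β, ((ginv g x α β : ℝ) : ℂ) * pd α φ x * pd β ψ x

/-- Null form `𝔔_{μν}` (complex-valued). -/
def QmnC {d : ℕ} (μ ν : Fin (d + 1)) (φ ψ : Vec d → ℂ) (x : Vec d) : ℂ :=
  pd μ φ x * pd ν ψ x - pd ν φ x * pd μ ψ x

/-- Null form `𝔔_0^{(g)}` (real-valued). -/
def Q0R {d : ℕ} (g : Met d) (φ ψ : Vec d → ℝ) (x : Vec d) : ℝ :=
  ∑ α, ∑ β, ginv g x α β * pd α φ x * pd β ψ x

/-- Null form `𝔔_{μν}` (real-valued). -/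
def QmnR {d : ℕ} (μ ν : Fin (d + 1)) (φ ψ : Vec d → ℝ) (x : Vec d) : ℝ :=
  pd μ φ x * pd ν ψ x - pd ν φ x * pd μ ψ x

/-- The quadratic form `B_{μν}(g)(∂p, ∂q)` (symmetrizations written out). -/
def Bq {d : ℕ} (g : Met d) (p q : SymMat d) (μ ν : Fin (d + 1)) (x : Vec d) : ℝ :=
  ∑ α, ∑ β, ∑ σ, ∑ ρ, ginv g x α β * ginv g x σ ρ *
    ((pd μ (fun y => p y β ρ) x * pd σ (fun y => q y ν α) x +
      pd ν (fun y => p y β ρ) x * pd σ (fun y => q y μ α) x) -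
     (1 / 4) * (pd μ (fun y => p y β ρ) x * pd ν (fun y => q y α σ) x +
                pd ν (fun y => p y β ρ) x * pd μ (fun y => q y α σ) x) +
     pd σ (fun y => p y ν α) x * pd ρ (fun y => q y μ β) x -
     pd α (fun y => p y ν σ) x * pd ρ (fun y => q y μ β) x)

/-- `D_μ^{ασ}(g_0)`. -/
def Dcoef {d : ℕ} (g0 : Met d) (μ α σ : Fin (d + 1)) (x : Vec d) : ℝ :=
  ∑ β, ∑ ρ, ginv g0 x α β * ginv g0 x σ ρ *
    (2 * pd ρ (fun y => g0 y β μ) x - pd μ (fun y => g0 y β ρ) x)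

/-- `L_{μν}(g_0)(∂h)`. -/
def Lq {d : ℕ} (g0 : Met d) (h : SymMat d) (μ ν : Fin (d + 1)) (x : Vec d) : ℝ :=
  2 * (∑ σ, ∑ ρ, ∑ α, ginv g0 x σ ρ *
        (GammaMix g0 ρ α μ x * pd σ (fun y => h y ν α) x +
         GammaMix g0 ρ α ν x * pd σ (fun y => h y μ α) x)) +
  (1 / 2) * (∑ α, ∑ σ, (Dcoef g0 μ α σ x * pd ν (fun y => h y α σ) x +
                        Dcoef g0 ν α σ x * pd μ (fun y => h y α σ) x))

/-- `Q_{μν}(g_0)(∂h, ∂h)`. -/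
def Qq {d : ℕ} (g0 : Met d) (h : SymMat d) (μ ν : Fin (d + 1)) (x : Vec d) : ℝ :=
  (∑ α, ∑ β, ginv g0 x α β * Q0R g0 (fun y => h y ν α) (fun y => h y μ β) x) +
  ∑ α, ∑ β, ∑ σ, ∑ ρ, ginv g0 x α β * ginv g0 x σ ρ *
    ((1 / 2) * (QmnR β μ (fun y => h y σ ρ) (fun y => h y ν α) x +
                QmnR β ν (fun y => h y σ ρ) (fun y => h y μ α) x) +
     (QmnR μ σ (fun y => h y β ρ) (fun y => h y ν α) x +
      QmnR ν σ (fun y => h y β ρ) (fun y => h y μ α) x) -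
     QmnR α ρ (fun y => h y ν σ) (fun y => h y μ β) x)

/-- `P_{μν}(g_0)(∂h, ∂h)`. -/
def Pq {d : ℕ} (g0 : Met d) (h : SymMat d) (μ ν : Fin (d + 1)) (x : Vec d) : ℝ :=
  (1 / 4) * (∑ α, ∑ α', ginv g0 x α α' * pd μ (fun y => h y α α') x) *
            (∑ β, ∑ β', ginv g0 x β β' * pd ν (fun y => h y β β') x) -
  (1 / 2) * ∑ α, ∑ α', ∑ β, ∑ β', ginv g0 x α α' * pd μ (fun y => h y α β) x *
            ginv g0 x β β' * pd ν (fun y => h y α' β') x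

/-- Euclidean norm on `ℝ^n`. -/
def enormV {n : ℕ} (ξ : Fin n → ℝ) : ℝ := Real.sqrt (∑ i, ξ i ^ 2)

/-- The angle quantity `Ξ_{ι1 ι2}(θ,η)`. -/
def XiAng (ι1 ι2 : ℝ) (θ η : Fin 3 → ℝ) : ℝ :=
  Real.sqrt (2 * (enormV θ * enormV η - ι1 * ι2 * ∑ i, θ i * η i) / (enormV θ * enormV η))

/-- The phase `Φ_{ι ι1 ι2}(ξ,η)`. -/
def PhiPh (ι ι1 ι2 : ℝ) (ξ η : Fin 3 → ℝ) : ℝ :=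
  ι * enormV ξ - ι1 * enormV (ξ - η) - ι2 * enormV η

/-- Littlewood–Paley projection on `ℝ³` built from `ψLP`. -/
def LPProj (ψLP : (Fin 3 → ℝ) → ℝ) (k : ℤ) (f : (Fin 3 → ℝ) → ℂ) : (Fin 3 → ℝ) → ℂ :=
  ftInv (fun ξ => (ψLP ((2 : ℝ) ^ (-k) • ξ) : ℂ) * ft f ξ)

/-- A standard Littlewood–Paley bump. -/
def GoodLP (ψLP : (Fin 3 → ℝ) → ℝ) : Prop :=
  ContDiff ℝ (⊤ : ℕ∞) ψLP ∧ (∀ ξ, ψLP ξ ∈ Set.Icc (0 : ℝ) 1) ∧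
  (∀ ξ ζ, enormV ξ = enormV ζ → ψLP ξ = ψLP ζ) ∧
  (Function.support ψLP ⊆ {ξ | 1 / 2 ≤ enormV ξ ∧ enormV ξ ≤ 2}) ∧
  (∀ ξ : Fin 3 → ℝ, ξ ≠ 0 → ∑' k : ℤ, ψLP ((2 : ℝ) ^ (-k) • ξ) = 1)

/-- Admissible symbols of Ionescu–Pausader type. -/
def AdmSymbol (m : (Fin 3 → ℝ) → (Fin 3 → ℝ) → ℝ) : Prop :=
  (∃ i j : Fin 3, ∀ θ η, m θ η = (θ i * η j - θ j * η i) / (enormV θ * enormV η)) ∨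
  (∃ j : Fin 3, ∀ θ η, m θ η = η j / enormV η - θ j / enormV θ)

/-- Spatial part of a spacetime point. -/
def spat (x : Vec 3) : Fin 3 → ℝ := fun i => x i.succ

/-- Reassemble a spacetime point from its time and space parts. -/
def glue (t : ℝ) (y : Fin 3 → ℝ) : Vec 3 := Fin.cons t y

/-- Spatial Littlewood–Paley projection on `ℝ^{1+3}`. -/
def LPsp (ψLP : (Fin 3 → ℝ) → ℝ) (k : ℤ) (u : Vec 3 → ℂ) (x : Vec 3) : ℂ :=
  ftInv (fun ξ => (ψLP ((2 : ℝ) ^ (-k) • ξ) : ℂ) * ft (fun y => u (glue (x 0) y)) ξ) (spat x)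

/-- Minkowski wave operator on `ℝ^{1+3}`. -/
def BoxMink (u : Vec 3 → ℂ) (x : Vec 3) : ℂ :=
  - pd 0 (pd 0 u) x + ∑ i : Fin 3, pd i.succ (pd i.succ u) x

/-- Flat pairing `⟨u,v⟩ = ∫ conj(u) v`. -/
def pairF (u v : Vec 3 → ℂ) : ℂ := ∫ x : Vec 3, (starRingEnd ℂ) (u x) * v x

/-- `Σ_α ‖∂_α φ‖_{L^p}`. -/
def dNorm (p : ℝ≥0∞) (φ : Vec 3 → ℂ) : ℝ := ∑ α, (eLpNorm (pd α φ) p volume).toReal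

/-- Covector `dt − 𝔞_i dx^i`. -/
def cov1 (af : Fin 3 → Vec 3 → ℝ) (x : Vec 3) : Fin (3 + 1) → ℝ :=
  Fin.cons 1 (fun i => - af i x)

/-- Covector `dx^i + 𝔟^i dt + 𝔅^i_j dx^j`. -/
def cov2 (bf : Fin 3 → Vec 3 → ℝ) (Bf : Fin 3 → Fin 3 → Vec 3 → ℝ) (i : Fin 3) (x : Vec 3) :
    Fin (3 + 1) → ℝ :=
  Fin.cons (bf i x) (fun j => (if j = i then (1 : ℝ) else 0) + Bf i j x)

/-- Matrix of the quadratic form `−𝔑 (dt − 𝔞_i dx^i)² + Σ_i 𝔠_i (dx^i + 𝔟^i dt + 𝔅^i_j dx^j)²`. -/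
def met4 (Nf : Vec 3 → ℝ) (af bf cf : Fin 3 → Vec 3 → ℝ) (Bf : Fin 3 → Fin 3 → Vec 3 → ℝ) :
    Met 3 :=
  fun x => Matrix.of fun α β =>
    - Nf x * cov1 af x α * cov1 af x β + ∑ i, cf i x * cov2 bf Bf i x α * cov2 bf Bf i x β

section PropagationIdentity

open scoped FourierTransform SchwartzMap ContDiff

/-- The bilinear form `(2π)⁻¹ x · ξ`. -/
def dotL (n : ℕ) : (Fin n → ℝ) →L[ℝ] (Fin n → ℝ) →L[ℝ] ℝ :=
  (2 * Real.pi)⁻¹ • ∑ i, (ContinuousLinearMap.proj (R := ℝ) (φ := fun _ : Fin n => ℝ) i).smulRight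
    (ContinuousLinearMap.proj (R := ℝ) (φ := fun _ : Fin n => ℝ) i)

lemma dotL_apply {n : ℕ} (x ξ : Fin n → ℝ) :
    dotL n x ξ = (2 * Real.pi)⁻¹ * ∑ i, x i * ξ i := by
  simp [dotL]

lemma two_pi_mul_dotL {n : ℕ} (x ξ : Fin n → ℝ) :
    2 * Real.pi * dotL n x ξ = ∑ i, x i * ξ i := by
  rw [dotL_apply, ← mul_assoc, mul_inv_cancel₀ (by positivity), one_mul]

lemma ft_eq_fourierIntegral {n : ℕ} (f : (Fin n → ℝ) → ℂ) :
    ft f = VectorFourier.fourierIntegral 𝐞 volume (dotL n).toLinearMap₁₂ f := by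
  ext ξ
  unfold ft VectorFourier.fourierIntegral
  congr 1; ext x
  rw [Circle.smul_def, Real.fourierChar_apply, smul_eq_mul, mul_comm]
  congr 2
  rw [← two_pi_mul_dotL]
  change _ = ((2 * Real.pi * -(dotL n x ξ) : ℝ) : ℂ) * Complex.I
  push_cast; ring

lemma ftInv_eq_fourierIntegral {n : ℕ} (f : (Fin n → ℝ) → ℂ) (x : Fin n → ℝ) :
    ftInv f x = ((((2 * Real.pi) ^ n)⁻¹ : ℝ) : ℂ) *
      VectorFourier.fourierIntegral 𝐞 volume (-dotL n).toLinearMap₁₂ f x := by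
  unfold ftInv VectorFourier.fourierIntegral
  congr 2; ext ξ
  rw [Circle.smul_def, Real.fourierChar_apply, smul_eq_mul, mul_comm]
  congr 2
  rw [show ∑ i, x i * ξ i = ∑ i, ξ i * x i from
    Finset.sum_congr rfl fun i _ => mul_comm _ _, ← two_pi_mul_dotL]
  change _ = ((2 * Real.pi * -(-(dotL n ξ x)) : ℝ) : ℂ) * Complex.I
  push_cast; ring

/-- The Fourier transform of a smooth compactly supported function is a Schwartz function, and
the Fourier inversion formula holds. -/
lemma exists_schwartz_ft {n : ℕ} {u : (Fin n → ℝ) → ℂ} (hu : ContDiff ℝ ∞ u)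
    (hc : HasCompactSupport u) :
    (∃ S : 𝓢(Fin n → ℝ, ℂ), ∀ ξ, S ξ = ft u ξ) ∧ ∀ x, u x = ftInv (ft u) x := by
  let e : EuclideanSpace ℝ (Fin n) ≃L[ℝ] (Fin n → ℝ) := EuclideanSpace.equiv (Fin n) ℝ
  have hmp : MeasurePreserving (fun x : EuclideanSpace ℝ (Fin n) => e x) :=
    PiLp.volume_preserving_ofLp (Fin n)
  have hme : MeasurableEmbedding (fun x : EuclideanSpace ℝ (Fin n) => e x) :=
    e.toHomeomorph.measurableEmbedding
  have hpi : (2 * Real.pi) ≠ 0 := by positivity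
  let u' : 𝓢(EuclideanSpace ℝ (Fin n), ℂ) :=
    (hc.comp_homeomorph e.toHomeomorph).toSchwartzMap (f := u ∘ e) (hu.comp e.contDiff)
  have hin : ∀ x y : EuclideanSpace ℝ (Fin n), inner ℝ x y = ∑ i, e x i * e y i := by
    intro x y
    rw [PiLp.inner_apply]
    exact Finset.sum_congr rfl fun i _ => by simp [e, mul_comm]
  have key : ∀ ξ : EuclideanSpace ℝ (Fin n), (𝓕 u') ξ = ft u ((2 * Real.pi) • e ξ) := by
    intro ξ
    rw [SchwartzMap.fourier_coe, Real.fourier_eq', ft, ← hmp.integral_comp hme]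
    congr 1; ext x
    rw [hin, smul_eq_mul, mul_comm]
    congr 2
    simp only [Pi.smul_apply, smul_eq_mul]
    push_cast
    rw [Finset.mul_sum, Finset.mul_sum, Finset.sum_mul]
    exact Finset.sum_congr rfl fun i _ => by ring
  let e2 : (Fin n → ℝ) ≃L[ℝ] EuclideanSpace ℝ (Fin n) :=
    (ContinuousLinearEquiv.smulLeft (R₁ := ℝ) (Units.mk0 _ (inv_ne_zero hpi))).trans e.symm
  refine ⟨⟨SchwartzMap.compCLMOfContinuousLinearEquiv ℝ e2 (𝓕 u'), fun ξ => ?_⟩, fun x => ?_⟩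
  · rw [SchwartzMap.compCLMOfContinuousLinearEquiv_apply, Function.comp_apply, key]
    have : e (e2 ξ) = (2 * Real.pi)⁻¹ • ξ := e.apply_symm_apply _
    rw [this, smul_inv_smul₀ hpi]
  · have h1 : u x = (𝓕⁻ (𝓕 u')) (e.symm x) := by
      rw [FourierTransform.fourierInv_fourier_eq]
      exact congrArg u (e.apply_symm_apply x).symm
    rw [h1, SchwartzMap.fourierInv_coe, Real.fourierInv_eq', ftInv]
    have h2 := hmp.integral_comp hme (fun ξ : Fin n → ℝ =>
      Complex.exp (Complex.I * (∑ i, x i * ((2 * Real.pi) • ξ) i : ℝ)) * ft u ((2 * Real.pi) • ξ))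
    have h3 := Measure.integral_comp_smul (volume : Measure (Fin n → ℝ)) (fun ξ : Fin n → ℝ =>
      Complex.exp (Complex.I * (∑ i, x i * ξ i : ℝ)) * ft u ξ) (2 * Real.pi)
    have h4 : ∀ v : EuclideanSpace ℝ (Fin n),
        Complex.exp ((2 * Real.pi * inner ℝ v (e.symm x) : ℝ) * Complex.I) • (𝓕 u') v =
        Complex.exp (Complex.I * (∑ i, x i * ((2 * Real.pi) • e v) i : ℝ)) *
          ft u ((2 * Real.pi) • e v) := by
      intro v
      rw [key, smul_eq_mul, hin, mul_comm Complex.I]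
      congr 4
      rw [Finset.mul_sum]
      exact Finset.sum_congr rfl fun i _ => by simp; ring
    rw [integral_congr_ae (Eventually.of_forall h4), h2, h3]
    simp only [Module.finrank_fintype_fun_eq_card, Fintype.card_fin]
    rw [abs_of_pos (by positivity), Complex.real_smul]
    congr 2; ext ξ
    push_cast; ring

/-- Smooth compactly supported real functions. -/
def IsTest {d : ℕ} (u : Vec d → ℝ) : Prop := ContDiff ℝ ∞ u ∧ HasCompactSupport u

/-- Fourier transform of a real function. -/
def ftR {d : ℕ} (u : Vec d → ℝ) : Vec d → ℂ := ft (fun x => (u x : ℂ))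

section TestFunctions

variable {d : ℕ} {u v h : Vec d → ℝ}

lemma IsTest.continuous (hu : IsTest u) : Continuous u := hu.1.continuous

lemma contDiff_pd {f : Vec d → ℝ} (hf : ContDiff ℝ ∞ f) (α : Fin (d + 1)) :
    ContDiff ℝ ∞ (pd α f) :=
  (hf.fderiv_right (m := ∞) (by simp)).clm_apply contDiff_const

lemma IsTest.pd (hu : IsTest u) (α : Fin (d + 1)) : IsTest (pd α u) :=
  ⟨contDiff_pd hu.1 α, (hu.2.fderiv (𝕜 := ℝ)).comp_left
    (g := fun L : Vec d →L[ℝ] ℝ => L (Pi.single α 1)) (by simp)⟩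

lemma IsTest.mul_left (hu : IsTest u) {f : Vec d → ℝ} (hf : ContDiff ℝ ∞ f) :
    IsTest (fun x => f x * u x) := ⟨hf.mul hu.1, hu.2.mul_left⟩

lemma IsTest.add (hu : IsTest u) (hv : IsTest v) : IsTest (fun x => u x + v x) :=
  ⟨hu.1.add hv.1, hu.2.add hv.2⟩

lemma IsTest.neg (hu : IsTest u) : IsTest (fun x => - u x) :=
  ⟨hu.1.neg, hu.2.comp_left (g := fun t : ℝ => -t) (by simp)⟩

lemma IsTest.sub (hu : IsTest u) (hv : IsTest v) : IsTest (fun x => u x - v x) := by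
  simpa [sub_eq_add_neg] using hu.add hv.neg

lemma isTest_zero : IsTest (fun _ : Vec d => (0 : ℝ)) :=
  ⟨contDiff_const, HasCompactSupport.zero⟩

lemma isTest_sum {ι : Type*} (s : Finset ι) {f : ι → Vec d → ℝ} (hf : ∀ i ∈ s, IsTest (f i)) :
    IsTest (fun x => ∑ i ∈ s, f i x) := by
  classical
  induction s using Finset.induction_on with
  | empty => simpa using isTest_zero
  | insert a s ha ih =>
    simp only [Finset.sum_insert ha]
    exact (hf a (by simp)).add (ih fun i hi => hf i (by simp [hi]))

lemma IsTest.contDiff_complex (hu : IsTest u) : ContDiff ℝ ∞ (fun x => (u x : ℂ)) :=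
  Complex.ofRealCLM.contDiff.comp hu.1

lemma IsTest.hasCompactSupport_complex (hu : IsTest u) :
    HasCompactSupport (fun x => (u x : ℂ)) := hu.2.comp_left (g := fun t : ℝ => (t : ℂ)) (by simp)

lemma IsTest.integrable (hu : IsTest u) : Integrable u :=
  hu.continuous.integrable_of_hasCompactSupport hu.2

lemma IsTest.integrable_complex (hu : IsTest u) : Integrable (fun x => (u x : ℂ)) :=
  hu.integrable.ofReal

lemma IsTest.exists_schwartz (hu : IsTest u) : ∃ S : 𝓢(Vec d, ℂ), (S : Vec d → ℂ) = ftR u :=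
  let ⟨S, hS⟩ := (exists_schwartz_ft hu.contDiff_complex hu.hasCompactSupport_complex).1
  ⟨S, funext hS⟩

lemma IsTest.inversion (hu : IsTest u) (x : Vec d) : (u x : ℂ) = ftInv (ftR u) x :=
  (exists_schwartz_ft hu.contDiff_complex hu.hasCompactSupport_complex).2 x

lemma IsTest.continuous_ftR (hu : IsTest u) : Continuous (ftR u) := by
  obtain ⟨S, hS⟩ := hu.exists_schwartz
  exact hS ▸ S.continuous

lemma IsTest.integrable_ftR (hu : IsTest u) : Integrable (ftR u) := by
  obtain ⟨S, hS⟩ := hu.exists_schwartz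
  exact hS ▸ S.integrable

lemma IsTest.integrable_pow_mul_ftR (hu : IsTest u) (k : ℕ) :
    Integrable (fun ξ => ‖ξ‖ ^ k * ‖ftR u ξ‖) := by
  obtain ⟨S, hS⟩ := hu.exists_schwartz
  exact hS ▸ S.integrable_pow_mul volume k

lemma IsTest.integrable_sq_ftR (hu : IsTest u) : Integrable (fun ξ => ‖ftR u ξ‖ ^ 2) := by
  obtain ⟨S, hS⟩ := hu.exists_schwartz
  have := (S.memLp 2 volume).integrable_norm_pow (by norm_num)
  rw [hS] at this
  exact this

/-- The unimodular exponential `exp (-i x·ξ)`. -/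
def expW (x ξ : Vec d) : ℂ := Complex.exp (-Complex.I * ((∑ i, x i * ξ i : ℝ) : ℂ))

lemma norm_expW (x ξ : Vec d) : ‖expW x ξ‖ = 1 := by
  rw [expW, show -Complex.I * ((∑ i, x i * ξ i : ℝ) : ℂ) =
    ((-(∑ i, x i * ξ i) : ℝ) : ℂ) * Complex.I by push_cast; ring, Complex.norm_exp_ofReal_mul_I]

lemma continuous_expW : Continuous (fun p : Vec d × Vec d => expW p.1 p.2) := by
  unfold expW; fun_prop

lemma conj_expW (x ξ : Vec d) :
    (starRingEnd ℂ) (expW x ξ) = Complex.exp (Complex.I * ((∑ i, x i * ξ i : ℝ) : ℂ)) := by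
  rw [expW, ← Complex.exp_conj]; simp only [map_mul, map_neg, Complex.conj_I, Complex.conj_ofReal]
  congr 1; ring

lemma expW_add (x ξ η : Vec d) : expW x (ξ + η) = expW x ξ * expW x η := by
  rw [expW, expW, expW, ← Complex.exp_add]; congr 1
  simp only [Pi.add_apply, mul_add, Finset.sum_add_distrib]; push_cast; ring

lemma expW_neg (x ξ : Vec d) : expW x (-ξ) = (starRingEnd ℂ) (expW x ξ) := by
  rw [conj_expW, expW]; congr 1
  simp only [Pi.neg_apply, mul_neg, Finset.sum_neg_distrib]; push_cast; ring

lemma ftR_eq (u : Vec d → ℝ) (ξ : Vec d) : ftR u ξ = ∫ x, (u x : ℂ) * expW x ξ := rfl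

lemma norm_ftR_le (u : Vec d → ℝ) (ξ : Vec d) : ‖ftR u ξ‖ ≤ ∫ x, ‖u x‖ := by
  rw [ftR_eq]
  refine (norm_integral_le_integral_norm _).trans (le_of_eq ?_)
  congr 1; ext x
  simp [norm_expW]

lemma conj_ftR (u : Vec d → ℝ) (ξ : Vec d) :
    (starRingEnd ℂ) (ftR u ξ) = ∫ x, (u x : ℂ) * (starRingEnd ℂ) (expW x ξ) := by
  rw [ftR_eq, ← integral_conj]; simp

/-- The Fourier inversion constant. -/
def cF (d : ℕ) : ℂ := ((((2 * Real.pi) ^ (d + 1))⁻¹ : ℝ) : ℂ)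

lemma ftInv_eq (f : Vec d → ℂ) (x : Vec d) :
    ftInv f x = cF d * ∫ ξ, f ξ * (starRingEnd ℂ) (expW x ξ) := by
  simp only [conj_expW]; rfl

lemma integrable_mul_expW {f : Vec d → ℂ} (hf : Integrable f) (ξ : Vec d) :
    Integrable (fun x => f x * expW x ξ) :=
  hf.mul_bdd (c := 1) ((continuous_expW.comp (by fun_prop :
    Continuous fun x : Vec d => (x, ξ))).aestronglyMeasurable)
    (Eventually.of_forall fun x => (norm_expW x ξ).le)

lemma ftR_pd (hu : IsTest u) (α : Fin (d + 1)) (ξ : Vec d) :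
    ftR (pd α u) ξ = Complex.I * ξ α * ftR u ξ := by
  have hd : ∀ x, pd α (fun x => (u x : ℂ)) x = ((pd α u x : ℝ) : ℂ) := by
    intro x
    have := ((Complex.ofRealCLM.hasFDerivAt (x := u x)).comp x
      (hu.1.differentiable (by simp) x).hasFDerivAt).fderiv
    simp only [pd]
    erw [this]
    simp
  have hi : Integrable (fderiv ℝ (fun x => (u x : ℂ))) :=
    (hu.contDiff_complex.continuous_fderiv (by simp)).integrable_of_hasCompactSupport
      (hu.hasCompactSupport_complex.fderiv (𝕜 := ℝ))
  have h := VectorFourier.fourierIntegral_fderiv (L := dotL (d + 1)) (μ := volume)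
    hu.integrable_complex (hu.contDiff_complex.differentiable (by simp)) hi
  have h2 := congrFun h ξ
  have h3 := congrArg (fun L : Vec d →L[ℝ] ℂ => L (Pi.single α 1)) h2
  simp only [VectorFourier.fourierSMulRight_apply] at h3
  rw [← ft_eq_fourierIntegral] at h3
  have h4 : VectorFourier.fourierIntegral 𝐞 volume (dotL (d + 1)).toLinearMap₁₂
      (fderiv ℝ (fun x => (u x : ℂ))) ξ (Pi.single α 1) = ft (fun x => ((pd α u x : ℝ) : ℂ)) ξ := by
    rw [ft_eq_fourierIntegral, VectorFourier.fourierIntegral, VectorFourier.fourierIntegral,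
      ContinuousLinearMap.integral_apply]
    · congr 1; ext x
      rw [← hd]; rfl
    · exact (VectorFourier.fourierIntegral_convergent_iff (L := (dotL (d + 1)).toLinearMap₁₂)
        Real.continuous_fourierChar (by
          change Continuous fun p : Vec d × Vec d => dotL (d + 1) p.1 p.2
          fun_prop) ξ).2 hi
  rw [h4] at h3
  rw [ftR, h3, ftR]
  have h5 : ((-(dotL (d + 1)).flip) ξ) (Pi.single α 1) = -((2 * Real.pi)⁻¹ * ξ α) := by
    simp [dotL_apply, Pi.single_apply]
  rw [h5]
  simp only [smul_eq_mul, Complex.real_smul]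
  push_cast
  have : (Real.pi : ℂ) ≠ 0 := by exact_mod_cast Real.pi_ne_zero
  field_simp

end TestFunctions

/-- Bounded measurable Fourier symbols. -/
def IsSym {d : ℕ} (m : Vec d → ℝ) : Prop := Measurable m ∧ ∃ C, ∀ ξ, |m ξ| ≤ C

/-- The sesquilinear form `∫ u T_m v`, expressed on the Fourier side. -/
def mulForm {d : ℕ} (u : Vec d → ℝ) (m : Vec d → ℝ) (v : Vec d → ℝ) : ℂ :=
  cF d * ∫ ξ, (starRingEnd ℂ) (ftR u ξ) * (m ξ * ftR v ξ)

section MulForm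

variable {d : ℕ} {u v h : Vec d → ℝ} {m : Vec d → ℝ}

lemma integrable_sym_mul (hm : IsSym m) {f : Vec d → ℂ} (hf : Integrable f) :
    Integrable (fun ξ => (m ξ : ℂ) * f ξ) := by
  obtain ⟨hm1, C, hC⟩ := hm
  exact hf.bdd_mul (c := C) (Complex.measurable_ofReal.comp hm1).aestronglyMeasurable
    (Eventually.of_forall fun x => by simpa using hC x)

lemma integrable_mulForm (hu : IsTest u) (hm : IsSym m) (hv : IsTest v) :
    Integrable (fun ξ => (starRingEnd ℂ) (ftR u ξ) * (m ξ * ftR v ξ)) :=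
  (integrable_sym_mul hm hv.integrable_ftR).bdd_mul (c := ∫ x, ‖u x‖)
    (Complex.continuous_conj.comp hu.continuous_ftR).aestronglyMeasurable
    (Eventually.of_forall fun x => by simpa using norm_ftR_le u x)

lemma integral_mul_Tm (hu : IsTest u) (hm : IsSym m) (hv : IsTest v) :
    ∫ x, (u x : ℂ) * Tm m (fun y => (v y : ℂ)) x = mulForm u m v := by
  have hi : Integrable (fun z : Vec d × Vec d => ((u z.1 : ℂ) * ((m z.2 : ℂ) * ftR v z.2)) *
      (starRingEnd ℂ) (expW z.1 z.2)) (volume.prod volume) :=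
    (hu.integrable_complex.mul_prod (integrable_sym_mul hm hv.integrable_ftR)).mul_bdd (c := 1)
      (Complex.continuous_conj.comp continuous_expW).aestronglyMeasurable
      (Eventually.of_forall fun z => by simp [norm_expW])
  have h1 : ∀ x, (u x : ℂ) * Tm m (fun y => (v y : ℂ)) x = cF d * ∫ ξ,
      ((u x : ℂ) * ((m ξ : ℂ) * ftR v ξ)) * (starRingEnd ℂ) (expW x ξ) := by
    intro x
    rw [Tm, ftInv_eq, mul_left_comm, ← integral_const_mul]
    congr 2; ext ξ
    simp only [ftR]; ring
  rw [integral_congr_ae (Eventually.of_forall h1), integral_const_mul, mulForm,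
    integral_integral_swap hi]
  congr 2; ext ξ
  rw [conj_ftR, ← integral_mul_const]
  congr 1; ext x; ring

lemma ftR_mul (hh : IsTest h) (hv : IsTest v) (ξ : Vec d) :
    ftR (fun x => h x * v x) ξ = cF d * ∫ ζ, ftR h ζ * ftR v (ξ - ζ) := by
  have hi : Integrable (fun z : Vec d × Vec d => ((v z.1 : ℂ) * ftR h z.2) *
      expW z.1 (ξ - z.2)) (volume.prod volume) :=
    (hv.integrable_complex.mul_prod hh.integrable_ftR).mul_bdd (c := 1)
      (continuous_expW.comp (by fun_prop :
        Continuous fun z : Vec d × Vec d => (z.1, ξ - z.2))).aestronglyMeasurable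
      (Eventually.of_forall fun z => by simp [norm_expW])
  have h1 : ∀ x, ((h x * v x : ℝ) : ℂ) * expW x ξ = cF d * ∫ ζ,
      ((v x : ℂ) * ftR h ζ) * expW x (ξ - ζ) := by
    intro x
    rw [Complex.ofReal_mul, hh.inversion x, ftInv_eq, mul_assoc, mul_assoc, ← integral_mul_const]
    congr 2; ext ζ
    rw [sub_eq_add_neg, expW_add, expW_neg]; ring
  rw [ftR_eq, integral_congr_ae (Eventually.of_forall h1), integral_const_mul,
    integral_integral_swap hi]
  congr 2; ext ζ
  rw [ftR_eq v, ← integral_const_mul]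
  congr 1; ext x; ring

lemma conj_ftR_mul (hh : IsTest h) (hu : IsTest u) (η : Vec d) :
    (starRingEnd ℂ) (ftR (fun x => u x * h x) η) =
      cF d * ∫ ζ, ftR h ζ * (starRingEnd ℂ) (ftR u (ζ + η)) := by
  have hi : Integrable (fun z : Vec d × Vec d => ((u z.1 : ℂ) * ftR h z.2) *
      (starRingEnd ℂ) (expW z.1 (z.2 + η))) (volume.prod volume) :=
    (hu.integrable_complex.mul_prod hh.integrable_ftR).mul_bdd (c := 1)
      (Complex.continuous_conj.comp (continuous_expW.comp (by fun_prop :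
        Continuous fun z : Vec d × Vec d => (z.1, z.2 + η)))).aestronglyMeasurable
      (Eventually.of_forall fun z => by simp [norm_expW])
  have h1 : ∀ x, ((u x * h x : ℝ) : ℂ) * (starRingEnd ℂ) (expW x η) = cF d * ∫ ζ,
      ((u x : ℂ) * ftR h ζ) * (starRingEnd ℂ) (expW x (ζ + η)) := by
    intro x
    rw [mul_comm (u x), Complex.ofReal_mul, hh.inversion x, ftInv_eq, mul_assoc, mul_assoc,
      ← integral_mul_const]
    congr 2; ext ζ
    rw [expW_add, map_mul]; ring
  rw [conj_ftR, integral_congr_ae (Eventually.of_forall h1), integral_const_mul,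
    integral_integral_swap hi]
  congr 2; ext ζ
  rw [conj_ftR, ← integral_const_mul]
  congr 1; ext x; ring

lemma measurePreserving_shear :
    MeasurePreserving (MeasurableEquiv.shearAddRight (Vec d))
      ((volume : Measure (Vec d)).prod volume) (volume.prod volume) :=
  measurePreserving_prod_add volume volume

lemma integrable_kernel (hh : IsTest h) (hu : IsTest u) (hv : IsTest v)
    {k : Vec d × Vec d → ℂ} (hk : Measurable k) {C : ℝ} (hC : ∀ z, ‖k z‖ ≤ C) :
    Integrable (fun z : Vec d × Vec d => ftR h z.1 * (k z *
      ((starRingEnd ℂ) (ftR u (z.1 + z.2)) * ftR v z.2))) (volume.prod volume) := by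
  have h1 : Integrable (fun z : Vec d × Vec d => ftR h z.1 * ftR v z.2) (volume.prod volume) :=
    hh.integrable_ftR.mul_prod hv.integrable_ftR
  have h2 := h1.bdd_mul (c := ∫ x, ‖u x‖)
    (f := fun z : Vec d × Vec d => (starRingEnd ℂ) (ftR u (z.1 + z.2)))
    (Complex.continuous_conj.comp (hu.continuous_ftR.comp (by fun_prop))).aestronglyMeasurable
    (Eventually.of_forall fun z => by simpa using norm_ftR_le u (z.1 + z.2))
  refine (h2.bdd_mul (c := C) hk.aestronglyMeasurable (Eventually.of_forall hC)).congr
    (Eventually.of_forall fun z => ?_)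
  simp only; ring

lemma mulForm_mul_right (hh : IsTest h) (hu : IsTest u) (hm : IsSym m) (hv : IsTest v) :
    mulForm u m (fun x => h x * v x) = cF d ^ 2 * ∫ z : Vec d × Vec d,
      ftR h z.1 * ((m (z.1 + z.2) : ℂ) * ((starRingEnd ℂ) (ftR u (z.1 + z.2)) * ftR v z.2))
        ∂(volume.prod volume) := by
  obtain ⟨hm1, C, hC⟩ := hm
  have hi := integrable_kernel hh hu hv (k := fun z => (m (z.1 + z.2) : ℂ))
    (Complex.measurable_ofReal.comp (hm1.comp (measurable_fst.add measurable_snd))) (C := C)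
    (fun z => by simpa using hC _)
  let H : Vec d × Vec d → ℂ := fun z => ftR h z.1 *
    ((m z.2 : ℂ) * ((starRingEnd ℂ) (ftR u z.2) * ftR v (z.2 - z.1)))
  have hH : ∀ z : Vec d × Vec d, H (MeasurableEquiv.shearAddRight (Vec d) z) =
      ftR h z.1 * ((m (z.1 + z.2) : ℂ) *
        ((starRingEnd ℂ) (ftR u (z.1 + z.2)) * ftR v z.2)) := by
    intro z
    simp [H, MeasurableEquiv.shearAddRight]
  have hiH : Integrable H (volume.prod volume) := by
    rw [← measurePreserving_shear.integrable_comp_emb (MeasurableEquiv.measurableEmbedding _)]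
    exact hi.congr (Eventually.of_forall fun z => (hH z).symm)
  rw [integral_congr_ae (Eventually.of_forall fun z => (hH z).symm),
    measurePreserving_shear.integral_comp (MeasurableEquiv.measurableEmbedding _),
    integral_prod_symm _ hiH, mulForm, pow_two, mul_assoc]
  congr 1
  rw [← integral_const_mul]
  refine integral_congr_ae (Eventually.of_forall fun ξ => ?_)
  beta_reduce
  rw [ftR_mul hh hv]
  rw [mul_left_comm, mul_left_comm _ (cF d), mul_left_comm _ (cF d), ← integral_const_mul,
    ← integral_const_mul]
  congr 2; ext ζ
  simp only [H]; ring

lemma mulForm_mul_left (hh : IsTest h) (hu : IsTest u) (hm : IsSym m) (hv : IsTest v) :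
    mulForm (fun x => u x * h x) m v = cF d ^ 2 * ∫ z : Vec d × Vec d,
      ftR h z.1 * ((m z.2 : ℂ) * ((starRingEnd ℂ) (ftR u (z.1 + z.2)) * ftR v z.2))
        ∂(volume.prod volume) := by
  obtain ⟨hm1, C, hC⟩ := hm
  have hi := integrable_kernel hh hu hv (k := fun z => (m z.2 : ℂ))
    (Complex.measurable_ofReal.comp (hm1.comp measurable_snd)) (C := C)
    (fun z => by simpa using hC _)
  rw [integral_prod_symm _ hi, mulForm, pow_two, mul_assoc]
  congr 1
  rw [← integral_const_mul]
  refine integral_congr_ae (Eventually.of_forall fun ξ => ?_)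
  beta_reduce
  rw [conj_ftR_mul hh hu, mul_assoc, ← integral_mul_const]
  congr 2; ext ζ
  ring

lemma norm_kernel_le (hh : IsTest h) (hu : IsTest u) (hv : IsTest v)
    {k : Vec d × Vec d → ℂ} {C : ℝ} (j : ℕ)
    (hk : ∀ᵐ z ∂((volume : Measure (Vec d)).prod volume), ‖k z‖ ≤ C * ‖z.1‖ ^ j)
    (hC : 0 ≤ C) {t : ℝ} (ht : 0 < t) :
    ‖∫ z : Vec d × Vec d, ftR h z.1 * (k z *
      ((starRingEnd ℂ) (ftR u (z.1 + z.2)) * ftR v z.2)) ∂(volume.prod volume)‖ ≤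
      C * (∫ ζ, ‖ζ‖ ^ j * ‖ftR h ζ‖) *
        (t * (∫ ξ, ‖ftR u ξ‖ ^ 2) + t⁻¹ * ∫ ξ, ‖ftR v ξ‖ ^ 2) := by
  have hA := hh.integrable_pow_mul_ftR j
  have i2 : Integrable (fun z : Vec d × Vec d => (‖z.1‖ ^ j * ‖ftR h z.1‖) * ‖ftR v z.2‖ ^ 2)
      (volume.prod volume) := hA.mul_prod hv.integrable_sq_ftR
  have i1' : Integrable (fun z : Vec d × Vec d => (‖z.1‖ ^ j * ‖ftR h z.1‖) * ‖ftR u z.2‖ ^ 2)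
      (volume.prod volume) := hA.mul_prod hu.integrable_sq_ftR
  have i1 : Integrable (fun z : Vec d × Vec d => (‖z.1‖ ^ j * ‖ftR h z.1‖) *
      ‖ftR u (z.1 + z.2)‖ ^ 2) (volume.prod volume) :=
    (measurePreserving_shear.integrable_comp_emb (MeasurableEquiv.measurableEmbedding _)).2 i1'
  have e1 : ∫ z : Vec d × Vec d, (‖z.1‖ ^ j * ‖ftR h z.1‖) * ‖ftR u (z.1 + z.2)‖ ^ 2
      ∂(volume.prod volume) = (∫ ζ, ‖ζ‖ ^ j * ‖ftR h ζ‖) * ∫ ξ, ‖ftR u ξ‖ ^ 2 :=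
    (measurePreserving_shear.integral_comp (MeasurableEquiv.measurableEmbedding _)
      (fun z : Vec d × Vec d => (‖z.1‖ ^ j * ‖ftR h z.1‖) * ‖ftR u z.2‖ ^ 2)).trans
      (integral_prod_mul (fun ζ : Vec d => ‖ζ‖ ^ j * ‖ftR h ζ‖) fun ξ => ‖ftR u ξ‖ ^ 2)
  have e2 : ∫ z : Vec d × Vec d, (‖z.1‖ ^ j * ‖ftR h z.1‖) * ‖ftR v z.2‖ ^ 2
      ∂(volume.prod volume) = (∫ ζ, ‖ζ‖ ^ j * ‖ftR h ζ‖) * ∫ ξ, ‖ftR v ξ‖ ^ 2 :=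
    integral_prod_mul (fun ζ : Vec d => ‖ζ‖ ^ j * ‖ftR h ζ‖) fun ξ => ‖ftR v ξ‖ ^ 2
  have hg := ((i1.const_mul t).add (i2.const_mul t⁻¹)).const_mul C
  refine (norm_integral_le_of_norm_le hg ?_).trans (le_of_eq ?_)
  · filter_upwards [hk] with z hz
    simp only [norm_mul, RCLike.norm_conj, Pi.add_apply]
    set a := ‖ftR u (z.1 + z.2)‖
    set b := ‖ftR v z.2‖
    have hab : a * b ≤ t * a ^ 2 + t⁻¹ * b ^ 2 := by
      have h0 : 0 ≤ a * b := by positivity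
      have h1 : 0 ≤ t⁻¹ * (t * a - b) ^ 2 := by positivity
      have h2 : t⁻¹ * (t * a - b) ^ 2 = t * a ^ 2 + t⁻¹ * b ^ 2 - 2 * (a * b) := by
        field_simp; ring
      linarith
    calc ‖ftR h z.1‖ * (‖k z‖ * (a * b))
        ≤ ‖ftR h z.1‖ * ((C * ‖z.1‖ ^ j) * (t * a ^ 2 + t⁻¹ * b ^ 2)) := by gcongr
      _ = _ := by ring
  · simp only [Pi.add_apply]
    rw [integral_const_mul, integral_add (i1.const_mul t) (i2.const_mul t⁻¹), integral_const_mul,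
      integral_const_mul, e1, e2]
    ring

lemma plancherel (hu : IsTest u) :
    ∫ ξ, ‖ftR u ξ‖ ^ 2 = (2 * Real.pi) ^ (d + 1) * ∫ x, u x ^ 2 := by
  have h1 := integral_mul_Tm hu (m := fun _ => 1) ⟨measurable_const, 1, by simp⟩ hu
  have h2 : ∀ x, Tm (fun _ => 1) (fun y => (u y : ℂ)) x = u x := by
    intro x
    rw [hu.inversion x, Tm]
    simp [ftR]
  simp only [h2, mulForm, Complex.ofReal_one, one_mul] at h1
  have h3 : ∀ ξ, (starRingEnd ℂ) (ftR u ξ) * ftR u ξ = ((‖ftR u ξ‖ ^ 2 : ℝ) : ℂ) := by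
    intro ξ
    rw [mul_comm, Complex.mul_conj, Complex.normSq_eq_norm_sq]
  have h4 : ∀ x, (u x : ℂ) * u x = ((u x ^ 2 : ℝ) : ℂ) := by intro x; push_cast; ring
  simp only [h3, h4] at h1
  rw [integral_complex_ofReal, integral_complex_ofReal, cF, ← Complex.ofReal_mul] at h1
  have h5 := Complex.ofReal_injective h1
  rw [h5, ← mul_assoc, mul_inv_cancel₀ (by positivity), one_mul]

lemma norm_mulForm_le (hu : IsTest u) (hv : IsTest v) {C : ℝ} (hC : ∀ ξ, |m ξ| ≤ C)
    {t : ℝ} (ht : 0 < t) :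
    ‖mulForm u m v‖ ≤ C * (t * (∫ x, u x ^ 2) + t⁻¹ * ∫ x, v x ^ 2) := by
  have hg := ((hu.integrable_sq_ftR.const_mul t).add
    (hv.integrable_sq_ftR.const_mul t⁻¹)).const_mul C
  have hC0 : 0 ≤ C := (abs_nonneg _).trans (hC 0)
  rw [mulForm, norm_mul]
  have hb : ‖∫ ξ, (starRingEnd ℂ) (ftR u ξ) * (m ξ * ftR v ξ)‖ ≤ _ :=
    norm_integral_le_of_norm_le hg (Eventually.of_forall fun ξ => ?_)
  · simp only [Pi.add_apply] at hb
    rw [integral_const_mul, integral_add (hu.integrable_sq_ftR.const_mul t)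
      (hv.integrable_sq_ftR.const_mul t⁻¹), integral_const_mul, integral_const_mul,
      plancherel hu, plancherel hv] at hb
    refine (mul_le_mul_of_nonneg_left hb (norm_nonneg _)).trans (le_of_eq ?_)
    rw [cF, Complex.norm_real, Real.norm_of_nonneg (by positivity)]
    have : (2 * Real.pi) ^ (d + 1) ≠ 0 := by positivity
    field_simp
  · simp only [norm_mul, RCLike.norm_conj, Pi.add_apply, Complex.norm_real, Real.norm_eq_abs]
    set a := ‖ftR u ξ‖
    set b := ‖ftR v ξ‖
    have hab : a * b ≤ t * a ^ 2 + t⁻¹ * b ^ 2 := by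
      have h0 : 0 ≤ a * b := by positivity
      have h1 : 0 ≤ t⁻¹ * (t * a - b) ^ 2 := by positivity
      have h2 : t⁻¹ * (t * a - b) ^ 2 = t * a ^ 2 + t⁻¹ * b ^ 2 - 2 * (a * b) := by
        field_simp; ring
      linarith
    calc a * (|m ξ| * b) = |m ξ| * (a * b) := by ring
      _ ≤ C * (t * a ^ 2 + t⁻¹ * b ^ 2) := by gcongr; exact hC ξ

end MulForm

section Symbols

variable {d : ℕ} {m : Vec d → ℝ}

lemma Homog0.contDiffAt (hm : Homog0 m) {ξ : Vec d} (hξ : ξ ≠ 0) : ContDiffAt ℝ ∞ m ξ :=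
  hm.1.contDiffAt (isOpen_compl_singleton.mem_nhds hξ)

lemma Homog0.differentiableAt (hm : Homog0 m) {ξ : Vec d} (hξ : ξ ≠ 0) :
    DifferentiableAt ℝ m ξ := (hm.contDiffAt hξ).differentiableAt (by simp)

lemma Homog0.contDiffAt_fderiv (hm : Homog0 m) {ξ : Vec d} (hξ : ξ ≠ 0) :
    ContDiffAt ℝ ∞ (fderiv ℝ m) ξ := (hm.contDiffAt hξ).fderiv_right (by simp)

lemma Homog0.fderiv_smul (hm : Homog0 m) {s : ℝ} (hs : 0 < s) (ξ : Vec d) :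
    s • fderiv ℝ m (s • ξ) = fderiv ℝ m ξ := by
  rw [← fderiv_comp_smul]
  congr 1; ext ξ
  exact hm.2 s hs ξ

lemma Homog0.mul_pd (hm : Homog0 m) (α k : Fin (d + 1)) :
    Homog0 (fun ξ => ξ α * pd k m ξ) := by
  refine ⟨fun ξ hξ => ?_, fun s hs ξ => ?_⟩
  · exact ((contDiff_apply ℝ ℝ α).contDiffAt.mul
      ((hm.contDiffAt_fderiv hξ).clm_apply contDiffAt_const)).contDiffWithinAt
  · have := congrArg (fun L : Vec d →L[ℝ] ℝ => L (Pi.single k 1)) (hm.fderiv_smul hs ξ)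
    simp only [smul_apply, smul_eq_mul] at this
    simp only [Pi.smul_apply, smul_eq_mul, pd, ← this]
    ring

/-- The closed annulus around the unit sphere. -/
def annulus (d : ℕ) : Set (Vec d) := {ξ | 1 / 2 ≤ ‖ξ‖ ∧ ‖ξ‖ ≤ 3 / 2}

lemma isCompact_annulus : IsCompact (annulus d) := by
  refine (isCompact_closedBall (0 : Vec d) (3 / 2)).of_isClosed_subset ?_ fun ξ hξ => ?_
  · exact (isClosed_le continuous_const continuous_norm).inter
      (isClosed_le continuous_norm continuous_const)
  · simpa using hξ.2

lemma ne_zero_of_mem_annulus {ξ : Vec d} (hξ : ξ ∈ annulus d) : ξ ≠ 0 := by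
  rintro rfl
  have := hξ.1
  norm_num at this

lemma closedBall_subset_annulus {η : Vec d} (hη : ‖η‖ = 1) :
    Metric.closedBall η (1 / 2) ⊆ annulus d := by
  intro ξ hξ
  rw [mem_closedBall_iff_norm] at hξ
  have h1 := norm_sub_norm_le η ξ
  have h2 := norm_sub_norm_le ξ η
  rw [norm_sub_rev] at h1
  constructor <;> linarith

lemma exists_bound_annulus {E : Type*} [NormedAddCommGroup E] {f : Vec d → E}
    (hf : ∀ ξ ≠ 0, ContinuousAt f ξ) : ∃ C, 0 ≤ C ∧ ∀ ξ ∈ annulus d, ‖f ξ‖ ≤ C := by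
  obtain ⟨C, hC⟩ := isCompact_annulus.exists_bound_of_continuousOn
    (fun ξ hξ => (hf ξ (ne_zero_of_mem_annulus hξ)).continuousWithinAt)
  exact ⟨max C 0, le_max_right _ _, fun ξ hξ => (hC ξ hξ).trans (le_max_left _ _)⟩

lemma norm_inv_smul_self {ξ : Vec d} (hξ : ξ ≠ 0) : ‖‖ξ‖⁻¹ • ξ‖ = 1 :=
  norm_smul_inv_norm (𝕜 := ℝ) hξ

lemma Homog0.exists_bound (hm : Homog0 m) : ∃ C, 0 ≤ C ∧ ∀ ξ, |m ξ| ≤ C := by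
  obtain ⟨C, h0, hC⟩ := exists_bound_annulus fun ξ hξ => (hm.contDiffAt hξ).continuousAt
  refine ⟨max C |m 0|, h0.trans (le_max_left _ _), fun ξ => ?_⟩
  by_cases hξ : ξ = 0
  · rw [hξ]; exact le_max_right _ _
  · rw [← hm.2 _ (inv_pos.2 (norm_pos_iff.2 hξ)) ξ]
    refine (hC _ ?_).trans (le_max_left _ _)
    constructor <;> rw [norm_inv_smul_self hξ] <;> norm_num

lemma Homog0.isSym (hm : Homog0 m) : IsSym m :=
  ⟨measurable_of_continuousOn_compl_singleton 0 hm.1.continuousOn,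
    let ⟨C, _, hC⟩ := hm.exists_bound; ⟨C, hC⟩⟩

lemma Homog0.exists_lipschitz (hm : Homog0 m) :
    ∃ C, 0 ≤ C ∧ ∀ ζ η : Vec d, ‖η‖ * |m (ζ + η) - m η| ≤ C * ‖ζ‖ := by
  obtain ⟨M, hM0, hM⟩ := hm.exists_bound
  obtain ⟨C, hC0, hC⟩ := exists_bound_annulus fun ξ hξ => (hm.contDiffAt_fderiv hξ).continuousAt
  have key : ∀ ζ η : Vec d, ‖η‖ = 1 → |m (ζ + η) - m η| ≤ (C + 4 * M) * ‖ζ‖ := by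
    intro ζ η hη
    rcases le_or_gt ‖ζ‖ (1 / 2) with hζ | hζ
    · have hsub := closedBall_subset_annulus hη
      have := (convex_closedBall η (1 / 2)).norm_image_sub_le_of_norm_fderiv_le (𝕜 := ℝ) (f := m)
        (x := η) (y := ζ + η) (C := C)
        (fun ξ hξ => hm.differentiableAt (ne_zero_of_mem_annulus (hsub hξ)))
        (fun ξ hξ => hC ξ (hsub hξ)) (by simp) (by simpa using hζ)
      rw [add_sub_cancel_right, Real.norm_eq_abs] at this
      nlinarith [norm_nonneg ζ]
    · have h1 := abs_sub (m (ζ + η)) (m η)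
      have h2 := hM (ζ + η)
      have h3 := hM η
      nlinarith [norm_nonneg ζ]
  refine ⟨C + 4 * M, by positivity, fun ζ η => ?_⟩
  by_cases hη : η = 0
  · simp only [hη, norm_zero, zero_mul]; positivity
  · have hp := norm_pos_iff.2 hη
    have := key (‖η‖⁻¹ • ζ) (‖η‖⁻¹ • η) (norm_inv_smul_self hη)
    rw [← smul_add, hm.2 _ (inv_pos.2 hp), hm.2 _ (inv_pos.2 hp), norm_smul, norm_inv,
      norm_norm] at this
    calc ‖η‖ * |m (ζ + η) - m η| ≤ ‖η‖ * ((C + 4 * M) * (‖η‖⁻¹ * ‖ζ‖)) := by gcongr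
      _ = _ := by field_simp

lemma Homog0.exists_taylor (hm : Homog0 m) :
    ∃ C, 0 ≤ C ∧ ∀ ζ η : Vec d,
      ‖η‖ ^ 2 * |m (ζ + η) - m η - fderiv ℝ m η ζ| ≤ C * ‖ζ‖ ^ 2 := by
  obtain ⟨M, hM0, hM⟩ := hm.exists_bound
  obtain ⟨C, hC0, hC⟩ := exists_bound_annulus fun ξ hξ => (hm.contDiffAt_fderiv hξ).continuousAt
  obtain ⟨C', hC0', hC'⟩ := exists_bound_annulus fun ξ hξ =>
    ((hm.contDiffAt_fderiv hξ).fderiv_right (m := ∞) (by simp)).continuousAt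
  have key : ∀ ζ η : Vec d, ‖η‖ = 1 →
      |m (ζ + η) - m η - fderiv ℝ m η ζ| ≤ (C' + 8 * M + 2 * C) * ‖ζ‖ ^ 2 := by
    intro ζ η hη
    have hsub := closedBall_subset_annulus hη
    rcases le_or_gt ‖ζ‖ (1 / 2) with hζ | hζ
    · have hsub' : Metric.closedBall η ‖ζ‖ ⊆ Metric.closedBall η (1 / 2) :=
        Metric.closedBall_subset_closedBall hζ
      have h1 : ∀ ξ ∈ Metric.closedBall η ‖ζ‖, ‖fderiv ℝ m ξ - fderiv ℝ m η‖ ≤ C' * ‖ζ‖ := by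
        intro ξ hξ
        refine ((convex_closedBall η (1 / 2)).norm_image_sub_le_of_norm_fderiv_le (𝕜 := ℝ)
          (f := fderiv ℝ m) (C := C') (fun ξ hξ => (hm.contDiffAt_fderiv
            (ne_zero_of_mem_annulus (hsub hξ))).differentiableAt (by simp))
          (fun ξ hξ => hC' ξ (hsub hξ)) (by simp) (hsub' hξ)).trans ?_
        rw [mem_closedBall_iff_norm] at hξ
        gcongr
      have := (convex_closedBall η ‖ζ‖).norm_image_sub_le_of_norm_hasFDerivWithin_le' (𝕜 := ℝ)
        (f := m) (f' := fderiv ℝ m) (φ := fderiv ℝ m η)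
        (x := η) (y := ζ + η) (C := C' * ‖ζ‖)
        (fun ξ hξ => (hm.differentiableAt (ne_zero_of_mem_annulus
          (hsub (hsub' hξ)))).hasFDerivAt.hasFDerivWithinAt) h1 (by simp) (by simp)
      rw [add_sub_cancel_right, Real.norm_eq_abs] at this
      nlinarith [norm_nonneg ζ, sq_nonneg ‖ζ‖, mul_nonneg hM0 (sq_nonneg ‖ζ‖),
        mul_nonneg hC0 (sq_nonneg ‖ζ‖)]
    · have h1 := abs_sub (m (ζ + η) - m η) (fderiv ℝ m η ζ)
      have h2 := abs_sub (m (ζ + η)) (m η)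
      have h3 := hM (ζ + η)
      have h4 := hM η
      have h5 : |fderiv ℝ m η ζ| ≤ C * ‖ζ‖ :=
        ((fderiv ℝ m η).le_opNorm ζ).trans (by
          gcongr; exact hC η (hsub (by simp)))
      have h6 : 1 ≤ 4 * ‖ζ‖ ^ 2 := by nlinarith
      have h7 : ‖ζ‖ ≤ 2 * ‖ζ‖ ^ 2 := by nlinarith
      nlinarith [mul_le_mul_of_nonneg_left h6 hM0, mul_le_mul_of_nonneg_left h7 hC0,
        mul_nonneg hC0' (sq_nonneg ‖ζ‖)]
  refine ⟨C' + 8 * M + 2 * C, by positivity, fun ζ η => ?_⟩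
  by_cases hη : η = 0
  · simp only [hη, norm_zero, ne_eq, OfNat.ofNat_ne_zero, not_false_eq_true, zero_pow, zero_mul]
    positivity
  · have hp := norm_pos_iff.2 hη
    have h1 := key (‖η‖⁻¹ • ζ) (‖η‖⁻¹ • η) (norm_inv_smul_self hη)
    rw [← smul_add, hm.2 _ (inv_pos.2 hp), hm.2 _ (inv_pos.2 hp), norm_smul, norm_inv,
      norm_norm, map_smul, ← smul_apply, hm.fderiv_smul (inv_pos.2 hp)] at h1
    calc _ ≤ ‖η‖ ^ 2 * ((C' + 8 * M + 2 * C) * (‖η‖⁻¹ * ‖ζ‖) ^ 2) := by gcongr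
      _ = _ := by field_simp

lemma fderiv_eq_sum (f : Vec d → ℝ) (η ζ : Vec d) :
    fderiv ℝ f η ζ = ∑ k, ζ k * pd k f η := by
  conv_lhs => rw [← Finset.univ_sum_single ζ, map_sum]
  refine Finset.sum_congr rfl fun k _ => ?_
  rw [show Pi.single k (ζ k) = ζ k • (Pi.single k 1 : Vec d) by
    rw [← Pi.single_smul, smul_eq_mul, mul_one], map_smul, smul_eq_mul, pd]

end Symbols

section Commutators

variable {d : ℕ} {u v h : Vec d → ℝ} {m : Vec d → ℝ}

/-- Kernel estimate for first order commutators. -/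
lemma exists_commutator_bound (hh : IsTest h) (hm : Homog0 m) (α : Fin (d + 1)) :
    ∃ C, 0 ≤ C ∧ ∀ u v, IsTest u → IsTest v → ∀ t > 0,
      ‖mulForm u m (fun x => h x * pd α v x) - mulForm (fun x => u x * h x) m (pd α v)‖ ≤
        C * (t * (∫ x, u x ^ 2) + t⁻¹ * ∫ x, v x ^ 2) := by
  obtain ⟨C, hC0, hC⟩ := hm.exists_lipschitz
  obtain ⟨M, hM0, hM⟩ := hm.exists_bound
  have hms := hm.isSym.1
  refine ⟨‖cF d ^ 2‖ * (C * (∫ ζ, ‖ζ‖ ^ 1 * ‖ftR h ζ‖) * (2 * Real.pi) ^ (d + 1)),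
    by positivity, fun u v hu hv t ht => ?_⟩
  rw [mulForm_mul_right hh hu hm.isSym (hv.pd α), mulForm_mul_left hh hu hm.isSym (hv.pd α),
    ← mul_sub, ← integral_sub]
  rotate_left
  · exact integrable_kernel hh hu (hv.pd α) (k := fun z => (m (z.1 + z.2) : ℂ))
      (Complex.measurable_ofReal.comp (hms.comp (measurable_fst.add measurable_snd))) (C := M)
      (fun z => by simpa using hM _)
  · exact integrable_kernel hh hu (hv.pd α) (k := fun z => (m z.2 : ℂ))
      (Complex.measurable_ofReal.comp (hms.comp measurable_snd)) (C := M)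
      (fun z => by simpa using hM _)
  have hb := norm_kernel_le hh hu hv (k := fun z => ((m (z.1 + z.2) - m z.2 : ℝ) : ℂ) *
    (Complex.I * z.2 α)) (C := C) 1 (Eventually.of_forall fun z => ?_) hC0 ht
  · rw [plancherel hu, plancherel hv] at hb
    rw [norm_mul]
    refine (mul_le_mul_of_nonneg_left (le_trans (le_of_eq ?_) hb) (norm_nonneg _)).trans
      (le_of_eq (by ring))
    congr 2; ext z
    rw [ftR_pd hv]; push_cast; ring
  · rw [norm_mul, norm_mul, Complex.norm_I, Complex.norm_real, Complex.norm_real, one_mul, pow_one,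
      mul_comm]
    exact (mul_le_mul_of_nonneg_right (norm_le_pi_norm z.2 α) (norm_nonneg _)).trans (hC z.1 z.2)

/-- Second order commutator, with its principal part. -/
lemma exists_commutator_bound_two (hh : IsTest h) (hm : Homog0 m) (α β : Fin (d + 1)) :
    ∃ C, 0 ≤ C ∧ ∀ u v, IsTest u → IsTest v → ∀ t > 0,
      ‖mulForm u m (fun x => h x * pd α (pd β v) x) -
        mulForm (fun x => u x * h x) m (pd α (pd β v)) -
        ∑ k, mulForm (fun x => u x * pd k h x) (fun ξ => ξ α * pd k m ξ) (pd β v)‖ ≤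
        C * (t * (∫ x, u x ^ 2) + t⁻¹ * ∫ x, v x ^ 2) := by
  obtain ⟨C, hC0, hC⟩ := hm.exists_taylor
  obtain ⟨M, hM0, hM⟩ := hm.exists_bound
  have hms := hm.isSym.1
  have hmk := fun k => (hm.mul_pd α k).isSym
  refine ⟨‖cF d ^ 2‖ * (C * (∫ ζ, ‖ζ‖ ^ 2 * ‖ftR h ζ‖) * (2 * Real.pi) ^ (d + 1)),
    by positivity, fun u v hu hv t ht => ?_⟩
  have i1 := integrable_kernel hh hu ((hv.pd β).pd α) (k := fun z => (m (z.1 + z.2) : ℂ))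
      (Complex.measurable_ofReal.comp (hms.comp (measurable_fst.add measurable_snd))) (C := M)
      (fun z => by simpa using hM _)
  have i2 := integrable_kernel hh hu ((hv.pd β).pd α) (k := fun z => (m z.2 : ℂ))
      (Complex.measurable_ofReal.comp (hms.comp measurable_snd)) (C := M)
      (fun z => by simpa using hM _)
  have i3 : ∀ k ∈ Finset.univ, Integrable (fun z : Vec d × Vec d => ftR (pd k h) z.1 *
      (((z.2 α * pd k m z.2 : ℝ) : ℂ) *
        ((starRingEnd ℂ) (ftR u (z.1 + z.2)) * ftR (pd β v) z.2))) (volume.prod volume) := by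
    intro k _
    obtain ⟨Mk, hMk⟩ := (hmk k).2
    exact integrable_kernel (hh.pd k) hu (hv.pd β)
      (k := fun z => ((z.2 α * pd k m z.2 : ℝ) : ℂ))
      (Complex.measurable_ofReal.comp ((hmk k).1.comp measurable_snd)) (C := Mk)
      (fun z => by simpa using hMk z.2)
  have i12 := integral_sub (i1.sub i2) (integrable_finsetSum _ i3)
  simp only [Pi.sub_apply] at i12
  rw [mulForm_mul_right hh hu hm.isSym ((hv.pd β).pd α),
    mulForm_mul_left hh hu hm.isSym ((hv.pd β).pd α),
    Finset.sum_congr rfl fun k _ => mulForm_mul_left (hh.pd k) hu (hmk k) (hv.pd β),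
    ← Finset.mul_sum, ← mul_sub, ← mul_sub, ← integral_finsetSum _ i3, ← integral_sub i1 i2, ← i12]
  have hb := norm_kernel_le hh hu hv (k := fun z =>
    ((m (z.1 + z.2) - m z.2 - fderiv ℝ m z.2 z.1 : ℝ) : ℂ) *
    ((Complex.I * z.2 α) * (Complex.I * z.2 β))) (C := C) 2
    (Eventually.of_forall fun z => ?_) hC0 ht
  · rw [plancherel hu, plancherel hv] at hb
    rw [norm_mul]
    refine (mul_le_mul_of_nonneg_left (le_trans (le_of_eq ?_) hb) (norm_nonneg _)).trans
      (le_of_eq (by ring))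
    congr 2; ext z
    simp only [ftR_pd hh, ftR_pd hv, ftR_pd (hv.pd β), fderiv_eq_sum]
    push_cast
    simp only [mul_sub, sub_mul, Finset.mul_sum, Finset.sum_mul]
    congr 1
    · ring
    · exact Finset.sum_congr rfl fun k _ => by ring
  · simp only [norm_mul, Complex.norm_I, Complex.norm_real, one_mul]
    rw [mul_comm]
    refine le_trans ?_ (hC z.1 z.2)
    rw [pow_two]
    gcongr
    · exact norm_le_pi_norm z.2 α
    · exact norm_le_pi_norm z.2 β
    · exact le_rfl

end Commutators

section Linearity

variable {d : ℕ} {u u' v v' : Vec d → ℝ} {m : Vec d → ℝ}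

lemma ftR_add (hu : IsTest u) (hv : IsTest v) (ξ : Vec d) :
    ftR (fun x => u x + v x) ξ = ftR u ξ + ftR v ξ := by
  rw [ftR_eq, ftR_eq, ftR_eq, ← integral_add (integrable_mul_expW hu.integrable_complex ξ)
    (integrable_mul_expW hv.integrable_complex ξ)]
  congr 1; ext x; push_cast; ring

lemma ftR_neg (u : Vec d → ℝ) (ξ : Vec d) : ftR (fun x => - u x) ξ = - ftR u ξ := by
  rw [ftR_eq, ftR_eq, ← integral_neg]
  congr 1; ext x; push_cast; ring

lemma mulForm_add_left (hu : IsTest u) (hu' : IsTest u') (hm : IsSym m) (hv : IsTest v) :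
    mulForm (fun x => u x + u' x) m v = mulForm u m v + mulForm u' m v := by
  rw [mulForm, mulForm, mulForm, ← mul_add,
    ← integral_add (integrable_mulForm hu hm hv) (integrable_mulForm hu' hm hv)]
  congr 2; ext ξ; rw [ftR_add hu hu', map_add]; ring

lemma mulForm_add_right (hu : IsTest u) (hm : IsSym m) (hv : IsTest v) (hv' : IsTest v') :
    mulForm u m (fun x => v x + v' x) = mulForm u m v + mulForm u m v' := by
  rw [mulForm, mulForm, mulForm, ← mul_add,
    ← integral_add (integrable_mulForm hu hm hv) (integrable_mulForm hu hm hv')]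
  congr 2; ext ξ; rw [ftR_add hv hv']; ring

lemma mulForm_neg_left (u : Vec d → ℝ) (m : Vec d → ℝ) (v : Vec d → ℝ) :
    mulForm (fun x => - u x) m v = - mulForm u m v := by
  simp only [mulForm, ftR_neg, map_neg, neg_mul, integral_neg, mul_neg]

lemma mulForm_neg_right (u : Vec d → ℝ) (m : Vec d → ℝ) (v : Vec d → ℝ) :
    mulForm u m (fun x => - v x) = - mulForm u m v := by
  simp only [mulForm, ftR_neg, integral_neg, mul_neg]

lemma mulForm_sub_right (hu : IsTest u) (hm : IsSym m) (hv : IsTest v) (hv' : IsTest v') :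
    mulForm u m (fun x => v x - v' x) = mulForm u m v - mulForm u m v' := by
  simp only [sub_eq_add_neg]
  rw [mulForm_add_right hu hm hv hv'.neg, mulForm_neg_right]

lemma mulForm_zero_left (m v : Vec d → ℝ) : mulForm (fun _ => 0) m v = 0 := by
  simp [mulForm, ftR_eq]

lemma mulForm_zero_right (u m : Vec d → ℝ) : mulForm u m (fun _ => 0) = 0 := by
  simp [mulForm, ftR_eq]

lemma mulForm_sum_left {ι : Type*} (s : Finset ι) {f : ι → Vec d → ℝ} (hf : ∀ i, IsTest (f i))
    (hm : IsSym m) (hv : IsTest v) :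
    mulForm (fun x => ∑ i ∈ s, f i x) m v = ∑ i ∈ s, mulForm (f i) m v := by
  classical
  induction s using Finset.induction_on with
  | empty => simpa using mulForm_zero_left m v
  | insert a s ha ih =>
    simp only [Finset.sum_insert ha]
    rw [mulForm_add_left (hf a) (isTest_sum s fun i _ => hf i) hm hv, ih]

lemma mulForm_sum_right {ι : Type*} (s : Finset ι) {f : ι → Vec d → ℝ} (hf : ∀ i, IsTest (f i))
    (hu : IsTest u) (hm : IsSym m) :
    mulForm u m (fun x => ∑ i ∈ s, f i x) = ∑ i ∈ s, mulForm u m (f i) := by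
  classical
  induction s using Finset.induction_on with
  | empty => simpa using mulForm_zero_right u m
  | insert a s ha ih =>
    simp only [Finset.sum_insert ha]
    rw [mulForm_add_right hu hm (hf a) (isTest_sum s fun i _ => hf i), ih]

lemma mulForm_pd_left (hu : IsTest u) (m : Vec d → ℝ) (hv : IsTest v) (α : Fin (d + 1)) :
    mulForm (pd α u) m v = - mulForm u m (pd α v) := by
  rw [mulForm, mulForm, ← mul_neg, ← integral_neg]
  congr 2; ext ξ
  rw [ftR_pd hu, ftR_pd hv]
  simp only [map_mul, Complex.conj_I, Complex.conj_ofReal]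
  ring

end Linearity

section Determinant

variable {d : ℕ}

/-- The determinant as a continuous multilinear function of the rows. -/
def detCM (d : ℕ) : ContinuousMultilinearMap ℝ (fun _ : Fin (d + 1) => Vec d) ℝ where
  toMultilinearMap :=
    (Matrix.detRowAlternating (R := ℝ) (n := Fin (d + 1))).toMultilinearMap
  cont := by
    change Continuous fun A : Fin (d + 1) → Vec d => Matrix.det (Matrix.of A)
    exact Continuous.matrix_det (by fun_prop)

lemma detCM_linearDeriv (A B : Matrix (Fin (d + 1)) (Fin (d + 1)) ℝ) (hA : IsUnit A.det) :
    (detCM d).linearDeriv (fun i j => A i j) (fun i j => B i j) =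
      A.det * ∑ i, ∑ j, A⁻¹ j i * B i j := by
  rw [ContinuousMultilinearMap.linearDeriv_apply, Finset.mul_sum]
  refine Finset.sum_congr rfl fun i _ => ?_
  have h1 : detCM d (Function.update (fun i j => A i j) i (fun j => B i j)) =
      (A.updateRow i (B i)).det := rfl
  rw [h1, ← Matrix.cramer_transpose_apply, Matrix.cramer_eq_adjugate_mulVec,
    ← Matrix.adjugate_transpose, Matrix.mulVec, dotProduct, Finset.mul_sum]
  refine Finset.sum_congr rfl fun j _ => ?_
  rw [Matrix.transpose_apply, Matrix.inv_def, Matrix.smul_apply, smul_eq_mul, ← mul_assoc,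
    ← mul_assoc, Ring.mul_inverse_cancel _ hA, one_mul]

end Determinant

section Geometry

variable {d : ℕ} {g : Met d}

lemma IsMetricOn.contDiff (hg : IsMetricOn g Set.univ) (α β : Fin (d + 1)) :
    ContDiff ℝ ∞ (fun x => g x α β) := contDiffOn_univ.1 (hg.1 α β)

lemma contDiff_det {A : SymMat d} (hA : ∀ α β, ContDiff ℝ ∞ (fun x => A x α β)) :
    ContDiff ℝ ∞ (fun x => (A x).det) :=
  (detCM d).contDiff.comp (f := fun x i j => A x i j)
    (contDiff_pi.2 fun i => contDiff_pi.2 fun j => hA i j)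

lemma contDiff_ginv (hg : IsMetricOn g Set.univ) (α β : Fin (d + 1)) :
    ContDiff ℝ ∞ (fun x => ginv g x α β) := by
  have h1 : (fun x => ginv g x α β) =
      fun x => ((g x).det)⁻¹ * ((g x).updateRow β (Pi.single α 1)).det := by
    ext x
    rw [ginv, Matrix.inv_def, Matrix.smul_apply, smul_eq_mul, Ring.inverse_eq_inv',
      Matrix.adjugate_apply]
  rw [h1]
  refine ((contDiff_det hg.contDiff).inv fun x => (hg.2.2 x trivial).ne_zero).mul
    (contDiff_det fun i j => ?_)
  by_cases hi : i = β
  · subst hi; simp only [Matrix.updateRow_self]; exact contDiff_const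
  · simp only [Matrix.updateRow_ne hi]; exact hg.contDiff i j

lemma ginv_symm (hg : IsMetricOn g Set.univ) (x : Vec d) (α β : Fin (d + 1)) :
    ginv g x α β = ginv g x β α := by
  have h : ((g x)⁻¹).transpose = (g x)⁻¹ := by
    rw [Matrix.transpose_nonsing_inv, (hg.2.1 x trivial).eq]
  exact congrFun (congrFun h.symm α) β

/-- The volume density `√|det g|`. -/
def volDen (g : Met d) (x : Vec d) : ℝ := Real.sqrt |(g x).det|

lemma volDen_pos (hg : IsMetricOn g Set.univ) (x : Vec d) : 0 < volDen g x :=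
  Real.sqrt_pos.2 (abs_pos.2 (hg.2.2 x trivial).ne_zero)

lemma contDiff_volDen (hg : IsMetricOn g Set.univ) : ContDiff ℝ ∞ (volDen g) :=
  ((contDiff_det hg.contDiff).abs fun x => (hg.2.2 x trivial).ne_zero).sqrt
    fun x => (abs_pos.2 (hg.2.2 x trivial).ne_zero).ne'

lemma pd_mul {f h : Vec d → ℝ} {x : Vec d} (hf : DifferentiableAt ℝ f x)
    (hh : DifferentiableAt ℝ h x) (α : Fin (d + 1)) :
    pd α (fun y => f y * h y) x = pd α f x * h x + f x * pd α h x := by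
  simp only [pd, fderiv_fun_mul hf hh, add_apply, smul_apply, smul_eq_mul]
  ring

lemma pd_sum {ι : Type*} (s : Finset ι) {f : ι → Vec d → ℝ} {x : Vec d}
    (hf : ∀ i ∈ s, DifferentiableAt ℝ (f i) x) (α : Fin (d + 1)) :
    pd α (fun y => ∑ i ∈ s, f i y) x = ∑ i ∈ s, pd α (f i) x := by
  simp only [pd, fderiv_fun_sum hf, sum_apply]

lemma pd_det (hg : IsMetricOn g Set.univ) (β : Fin (d + 1)) (x : Vec d) :
    pd β (fun y => (g y).det) x =
      (g x).det * ∑ i, ∑ j, ginv g x j i * pd β (fun y => g y i j) x := by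
  have h1 : HasFDerivAt (fun y i j => g y i j)
      (ContinuousLinearMap.pi fun i => ContinuousLinearMap.pi fun j =>
        fderiv ℝ (fun y => g y i j) x) x :=
    hasFDerivAt_pi.2 fun i => hasFDerivAt_pi.2 fun j =>
      ((hg.contDiff i j).differentiable (by simp) x).hasFDerivAt
  have h2 := ((detCM d).hasFDerivAt (x := fun i j => g x i j)).comp x h1
  have h3 : pd β (fun y => (g y).det) x = _ :=
    congrArg (fun L : Vec d →L[ℝ] ℝ => L (Pi.single β 1)) h2.fderiv
  rw [h3]
  exact detCM_linearDeriv (g x) (Matrix.of fun i j => pd β (fun y => g y i j) x) (hg.2.2 x trivial)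

lemma pd_volDen (hg : IsMetricOn g Set.univ) (β : Fin (d + 1)) (x : Vec d) :
    pd β (volDen g) x =
      (1 / 2) * volDen g x * ∑ i, ∑ j, ginv g x j i * pd β (fun y => g y i j) x := by
  have hw := volDen_pos hg x
  have hdw : DifferentiableAt ℝ (volDen g) x := (contDiff_volDen hg).differentiable (by simp) x
  have hdd : DifferentiableAt ℝ (fun y => (g y).det) x :=
    (contDiff_det hg.contDiff).differentiable (by simp) x
  have hd0 := (hg.2.2 x trivial).ne_zero
  have h1 : (fun y => (volDen g y * volDen g y) * (volDen g y * volDen g y)) =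
      fun y => (g y).det * (g y).det := by
    ext y
    rw [volDen, Real.mul_self_sqrt (abs_nonneg _), abs_mul_abs_self]
  have h2 := congrArg (fun f => pd β f x) h1
  beta_reduce at h2
  rw [pd_mul (hdw.fun_mul hdw) (hdw.fun_mul hdw), pd_mul hdw hdw, pd_mul hdd hdd, pd_det hg] at h2
  have h3 := congrFun h1 x
  beta_reduce at h3
  set S := ∑ i, ∑ j, ginv g x j i * pd β (fun y => g y i j) x
  set w := volDen g x
  have h4 : 4 * w ^ 3 * pd β (volDen g) x = 4 * w ^ 3 * ((1 / 2) * w * S) := by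
    linear_combination h2 - 2 * S * h3
  exact mul_left_cancel₀ (by positivity) h4

lemma pd_ginv (hg : IsMetricOn g Set.univ) (γ α β : Fin (d + 1)) (x : Vec d) :
    pd γ (fun y => ginv g y α β) x =
      -∑ i, ∑ j, ginv g x α i * pd γ (fun y => g y i j) x * ginv g x j β := by
  have hdi : ∀ a b, DifferentiableAt ℝ (fun y => ginv g y a b) x := fun a b =>
    (contDiff_ginv hg a b).differentiable (by simp) x
  have hdg : ∀ a b, DifferentiableAt ℝ (fun y => g y a b) x := fun a b =>
    (hg.contDiff a b).differentiable (by simp) x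
  have h1 : ∀ j, (∑ i, pd γ (fun y => ginv g y α i) x * g x i j) =
      -∑ i, ginv g x α i * pd γ (fun y => g y i j) x := by
    intro j
    have e : (fun y => ∑ i, ginv g y α i * g y i j) =
        fun _ => (1 : Matrix (Fin (d + 1)) (Fin (d + 1)) ℝ) α j := by
      ext y
      exact congrFun (congrFun (Matrix.nonsing_inv_mul (g y) (hg.2.2 y trivial)) α) j
    have e2 := congrArg (fun f => pd γ f x) e
    beta_reduce at e2
    rw [pd_sum _ fun i _ => (hdi α i).fun_mul (hdg i j),
      Finset.sum_congr rfl fun i _ => pd_mul (hdi α i) (hdg i j) γ,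
      Finset.sum_add_distrib, show pd γ (fun _ : Vec d =>
        (1 : Matrix (Fin (d + 1)) (Fin (d + 1)) ℝ) α j) x = 0 by simp [pd]] at e2
    linarith
  have h2 : ∀ i, ∑ j, g x i j * ginv g x j β =
      (1 : Matrix (Fin (d + 1)) (Fin (d + 1)) ℝ) i β := fun i =>
    congrFun (congrFun (Matrix.mul_nonsing_inv (g x) (hg.2.2 x trivial)) i) β
  calc pd γ (fun y => ginv g y α β) x
      = ∑ i, pd γ (fun y => ginv g y α i) x * ∑ j, g x i j * ginv g x j β := by
        simp only [h2, Matrix.one_apply, mul_ite, mul_one, mul_zero, Finset.sum_ite_eq',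
          Finset.mem_univ, if_true]
    _ = ∑ j, (∑ i, pd γ (fun y => ginv g y α i) x * g x i j) * ginv g x j β := by
        simp only [Finset.mul_sum, Finset.sum_mul]
        rw [Finset.sum_comm]
        exact Finset.sum_congr rfl fun j _ => Finset.sum_congr rfl fun i _ => by ring
    _ = _ := by
        simp only [h1, neg_mul, Finset.sum_mul, Finset.sum_neg_distrib]
        rw [Finset.sum_comm]

lemma contDiff_Hgauge (hg : IsMetricOn g Set.univ) (α : Fin (d + 1)) :
    ContDiff ℝ ∞ (Hgauge g g α) := by
  unfold Hgauge
  exact ContDiff.sum fun σ _ => ContDiff.sum fun a _ => ContDiff.sum fun b _ =>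
    ((contDiff_ginv hg _ _).mul (contDiff_ginv hg _ _)).mul
      ((contDiff_pd (hg.contDiff _ _) _).sub (contDiff_const.mul (contDiff_pd (hg.contDiff _ _) _)))

/-- The divergence of `√|det g| g^{αβ}` in harmonic gauge form. -/
lemma sum_pd_volDen_mul_ginv (hg : IsMetricOn g Set.univ) (α : Fin (d + 1)) (x : Vec d) :
    ∑ β, pd β (fun y => volDen g y * ginv g y α β) x = -(volDen g x * Hgauge g g α x) := by
  have hdw : DifferentiableAt ℝ (volDen g) x := (contDiff_volDen hg).differentiable (by simp) x
  have hdi : ∀ a b, DifferentiableAt ℝ (fun y => ginv g y a b) x := fun a b =>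
    (contDiff_ginv hg a b).differentiable (by simp) x
  have e1 : ∑ σ, ∑ a, ∑ b, ginv g x α σ * ginv g x a b * pd b (fun y => g y σ a) x =
      ∑ β, ∑ i, ∑ j, ginv g x α i * pd β (fun y => g y i j) x * ginv g x j β := by
    refine Eq.trans (Finset.sum_congr rfl fun i _ => ?_) Finset.sum_comm
    rw [Finset.sum_comm]
    exact Finset.sum_congr rfl fun b _ => Finset.sum_congr rfl fun j _ => by ring
  have e2 : ∑ σ, ∑ a, ∑ b, ginv g x α σ * ginv g x a b * pd σ (fun y => g y a b) x =
      ∑ β, ginv g x α β * ∑ i, ∑ j, ginv g x j i * pd β (fun y => g y i j) x := by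
    simp only [Finset.mul_sum]
    exact Finset.sum_congr rfl fun σ _ => Finset.sum_congr rfl fun a _ =>
      Finset.sum_congr rfl fun b _ => by rw [ginv_symm hg x b a]; ring
  have e3 : Hgauge g g α x =
      (∑ σ, ∑ a, ∑ b, ginv g x α σ * ginv g x a b * pd b (fun y => g y σ a) x) -
      (1 / 2) * ∑ σ, ∑ a, ∑ b, ginv g x α σ * ginv g x a b * pd σ (fun y => g y a b) x := by
    simp only [Hgauge, Finset.mul_sum, ← Finset.sum_sub_distrib]
    exact Finset.sum_congr rfl fun σ _ => Finset.sum_congr rfl fun a _ =>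
      Finset.sum_congr rfl fun b _ => by ring
  have e4 : ∀ β, pd β (fun y => volDen g y * ginv g y α β) x =
      volDen g x * ((1 / 2) * (ginv g x α β * ∑ i, ∑ j, ginv g x j i * pd β (fun y => g y i j) x) -
      ∑ i, ∑ j, ginv g x α i * pd β (fun y => g y i j) x * ginv g x j β) := by
    intro β
    rw [pd_mul hdw (hdi _ _), pd_volDen hg, pd_ginv hg]; ring
  rw [Finset.sum_congr rfl fun β _ => e4 β, ← Finset.mul_sum, Finset.sum_sub_distrib,
    ← Finset.mul_sum, ← e1, ← e2, e3]
  ring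

end Geometry

section SignedMeasures

variable {X : Type*} [MeasurableSpace X]

/-- Both parts of the Jordan decomposition of `ν` are concentrated on `S`. -/
def ConcentratedOn (ν : SignedMeasure X) (S : Set X) : Prop :=
  (∀ᵐ p ∂ν.toJordanDecomposition.posPart, p ∈ S) ∧ ∀ᵐ p ∂ν.toJordanDecomposition.negPart, p ∈ S

lemma concentratedOn_of_null {ν : SignedMeasure X} {S : Set X} (hS : MeasurableSet S)
    (h : ∀ s, MeasurableSet s → s ∩ S = ∅ → ν s = 0) : ConcentratedOn ν S := by
  obtain ⟨i, hi, hi0, hi1, hP, hN⟩ := ν.toJordanDecomposition_spec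
  have h0 : ∀ A : Set X, MeasurableSet A → ν (A ∩ Sᶜ) = 0 := fun A hA =>
    h _ (hA.inter hS.compl) (by rw [Set.inter_assoc, Set.compl_inter_self, Set.inter_empty])
  constructor
  · change ν.toJordanDecomposition.posPart Sᶜ = 0
    rw [hP]
    rw [SignedMeasure.toMeasureOfZeroLE_apply _ _ _ hS.compl]
    simp [h0 i hi]
  · change ν.toJordanDecomposition.negPart Sᶜ = 0
    rw [hN]
    rw [SignedMeasure.toMeasureOfLEZero_apply _ _ _ hS.compl]
    simp [h0 iᶜ hi.compl]

lemma ConcentratedOn.of_restrict_eq {ν : SignedMeasure X} {S : Set X}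
    (h : ν.toJordanDecomposition.posPart.restrict Sᶜ =
      ν.toJordanDecomposition.negPart.restrict Sᶜ) : ConcentratedOn ν S := by
  obtain ⟨A, hA, hP, hN⟩ := ν.toJordanDecomposition.mutuallySingular
  have key : ∀ B, MeasurableSet B → ν.toJordanDecomposition.posPart (B ∩ Sᶜ) =
      ν.toJordanDecomposition.negPart (B ∩ Sᶜ) := fun B hB => by
    rw [← Measure.restrict_apply hB, h, Measure.restrict_apply hB]
  have hP0 : ν.toJordanDecomposition.posPart Sᶜ = 0 := by
    rw [← measure_inter_add_sdiff Sᶜ hA, Set.sdiff_eq, Set.inter_comm _ Aᶜ, key _ hA.compl]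
    rw [measure_mono_null Set.inter_subset_right hP, measure_mono_null Set.inter_subset_left hN,
      add_zero]
  refine ⟨hP0, ?_⟩
  have := key Set.univ MeasurableSet.univ
  rw [Set.univ_inter, hP0] at this
  exact this.symm

variable {ν : SignedMeasure X} {S : Set X} {F G : X → ℝ}

lemma ConcentratedOn.inter {T : Set X} (hS : ConcentratedOn ν S) (hT : ConcentratedOn ν T) :
    ConcentratedOn ν (S ∩ T) :=
  ⟨by filter_upwards [hS.1, hT.1] with p h1 h2 using ⟨h1, h2⟩,
    by filter_upwards [hS.2, hT.2] with p h1 h2 using ⟨h1, h2⟩⟩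

lemma ConcentratedOn.sInt_congr (hS : ConcentratedOn ν S) (h : ∀ p ∈ S, F p = G p) :
    sInt ν F = sInt ν G := by
  rw [sInt, sInt, integral_congr_ae (hS.1.mono h), integral_congr_ae (hS.2.mono h)]

/-- Integrability with respect to both parts of the Jordan decomposition. -/
def SIntegrable (ν : SignedMeasure X) (F : X → ℝ) : Prop :=
  Integrable F ν.toJordanDecomposition.posPart ∧ Integrable F ν.toJordanDecomposition.negPart

lemma ConcentratedOn.sIntegrable (hS : ConcentratedOn ν S) (hF : Measurable F) {C : ℝ}
    (hC : ∀ p ∈ S, |F p| ≤ C) : SIntegrable ν F :=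
  ⟨.of_bound hF.aestronglyMeasurable C (hS.1.mono hC),
    .of_bound hF.aestronglyMeasurable C (hS.2.mono hC)⟩

lemma SIntegrable.add (hF : SIntegrable ν F) (hG : SIntegrable ν G) :
    SIntegrable ν (fun p => F p + G p) := ⟨hF.1.add hG.1, hF.2.add hG.2⟩

lemma SIntegrable.sub (hF : SIntegrable ν F) (hG : SIntegrable ν G) :
    SIntegrable ν (fun p => F p - G p) := ⟨hF.1.sub hG.1, hF.2.sub hG.2⟩

lemma SIntegrable.neg (hF : SIntegrable ν F) : SIntegrable ν (fun p => - F p) :=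
  ⟨hF.1.neg, hF.2.neg⟩

lemma SIntegrable.sum {ι : Type*} (s : Finset ι) {F : ι → X → ℝ} (hF : ∀ i, SIntegrable ν (F i)) :
    SIntegrable ν (fun p => ∑ i ∈ s, F i p) :=
  ⟨integrable_finsetSum _ fun i _ => (hF i).1, integrable_finsetSum _ fun i _ => (hF i).2⟩

lemma sInt_add (hF : SIntegrable ν F) (hG : SIntegrable ν G) :
    sInt ν (fun p => F p + G p) = sInt ν F + sInt ν G := by
  rw [sInt, integral_add hF.1 hG.1, integral_add hF.2 hG.2, sInt, sInt]; ring

lemma sInt_neg (ν : SignedMeasure X) (F : X → ℝ) : sInt ν (fun p => - F p) = - sInt ν F := by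
  rw [sInt, integral_neg, integral_neg, sInt]; ring

lemma sInt_sub (hF : SIntegrable ν F) (hG : SIntegrable ν G) :
    sInt ν (fun p => F p - G p) = sInt ν F - sInt ν G := by
  simp only [sub_eq_add_neg, sInt_add hF hG.neg, sInt_neg]

lemma sInt_sum {ι : Type*} (s : Finset ι) {F : ι → X → ℝ} (hF : ∀ i, SIntegrable ν (F i)) :
    sInt ν (fun p => ∑ i ∈ s, F i p) = ∑ i ∈ s, sInt ν (F i) := by
  simp only [sInt, integral_finsetSum _ fun i _ => (hF i).1,
    integral_finsetSum _ fun i _ => (hF i).2, Finset.sum_sub_distrib]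

end SignedMeasures

section Concentration

variable {d : ℕ}

/-- `t ↦ n t / (1 + n t)`, an increasing approximation of the indicator of `(0, ∞)`. -/
def ramp (n : ℕ) (t : ℝ) : ℝ := n * t / (1 + n * t)

lemma ramp_mem {t : ℝ} (n : ℕ) (ht : 0 ≤ t) : |ramp n t| ≤ 1 := by
  rw [ramp, abs_of_nonneg (by positivity), div_le_one (by positivity)]
  linarith

lemma tendsto_ramp {t : ℝ} (ht : 0 ≤ t) :
    Tendsto (fun n => ramp n t) atTop (𝓝 ({s : ℝ | s ≠ 0}.indicator 1 t)) := by
  rcases ht.eq_or_lt with rfl | ht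
  · simp [ramp]
  · rw [Set.indicator_of_mem (by exact ht.ne')]
    have h1 : Tendsto (fun n : ℕ => 1 - (1 + n * t)⁻¹) atTop (𝓝 (1 - 0)) := by
      refine tendsto_const_nhds.sub (tendsto_inv_atTop_zero.comp ?_)
      exact tendsto_atTop_add_const_left _ _ (tendsto_natCast_atTop_atTop.atTop_mul_const ht)
    rw [sub_zero] at h1
    refine h1.congr fun n => ?_
    rw [ramp]
    have : (1 + n * t) ≠ 0 := by positivity
    field_simp
    ring

lemma contDiffAt_ramp (n : ℕ) {t : ℝ} (ht : 0 ≤ t) : ContDiffAt ℝ ∞ (ramp n) t := by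
  unfold ramp
  exact ContDiffAt.div (by fun_prop) (by fun_prop) (by positivity)

/-- Radial projection onto the unit sphere. -/
def radial (ξ : Vec d) : Vec d := (√(∑ α, ξ α ^ 2))⁻¹ • ξ

lemma sum_sq_pos {ξ : Vec d} (hξ : ξ ≠ 0) : 0 < ∑ α, ξ α ^ 2 := by
  obtain ⟨α, hα⟩ := Function.ne_iff.mp hξ
  exact Finset.sum_pos' (fun i _ => sq_nonneg _) ⟨α, Finset.mem_univ _, pow_pos_of_ne hα⟩
where pow_pos_of_ne {t : ℝ} (h : t ≠ 0) : 0 < t ^ 2 := by positivity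

lemma contDiffAt_radial {ξ : Vec d} (hξ : ξ ≠ 0) : ContDiffAt ℝ ∞ (radial (d := d)) ξ := by
  unfold radial
  have h := sum_sq_pos hξ
  have h1 : ContDiffAt ℝ ∞ (fun ζ : Vec d => ∑ α, ζ α ^ 2) ξ :=
    (ContDiff.sum fun α _ => (contDiff_apply ℝ ℝ α).pow 2).contDiffAt
  exact ((h1.sqrt h.ne').inv (Real.sqrt_pos.mpr h).ne').smul contDiffAt_id

lemma radial_smul {s : ℝ} (hs : 0 < s) (ξ : Vec d) : radial (s • ξ) = radial ξ := by
  have : ∑ α, (s • ξ) α ^ 2 = s ^ 2 * ∑ α, ξ α ^ 2 := by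
    simp [mul_pow, Finset.mul_sum]
  rw [radial, radial, this, Real.sqrt_mul (sq_nonneg s), Real.sqrt_sq hs.le, smul_smul, mul_inv]
  congr 1
  field_simp

lemma radial_eq_self {ξ : Vec d} (hξ : ξ ∈ usphere d) : radial ξ = ξ := by
  rw [radial, show ∑ α, ξ α ^ 2 = 1 from hξ]; simp

lemma homog0_comp_radial {h : Vec d → ℝ} (hh : ContDiff ℝ ∞ h) (h0 : ∀ ξ, 0 ≤ h ξ) (n : ℕ) :
    Homog0 (fun ξ : Vec d => ramp n (h (radial ξ))) := by
  refine ⟨fun ξ hξ => ?_, fun s hs ξ => by simp only [radial_smul hs]⟩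
  have h1 : ContDiffAt ℝ ∞ (fun ζ => h (radial ζ)) ξ :=
    ContDiffAt.comp ξ hh.contDiffAt (contDiffAt_radial hξ)
  exact (ContDiffAt.comp ξ (contDiffAt_ramp n (h0 (radial ξ))) h1).contDiffWithinAt

/-- A smooth function equal to one on the ball of radius `n` about the origin. -/
def ballCutoff (d n : ℕ) : ContDiffBump (0 : Vec d) :=
  ⟨n + 1, n + 2, by positivity, by linarith⟩

lemma tendsto_ballCutoff (x : Vec d) : Tendsto (fun n => ballCutoff d n x) atTop (𝓝 1) := by
  refine tendsto_const_nhds.congr' ?_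
  obtain ⟨N, hN⟩ := exists_nat_ge ‖x‖
  filter_upwards [eventually_ge_atTop N] with n hn
  refine ((ballCutoff d n).one_of_mem_closedBall ?_).symm
  have : (N : ℝ) ≤ n := by exact_mod_cast hn
  simp only [ballCutoff, mem_closedBall_iff_norm, sub_zero]
  linarith

lemma measurableSet_usphere : MeasurableSet {p : Phase d | p.2 ∈ usphere d} := by
  have : IsClosed {p : Phase d | ∑ α, p.2 α ^ 2 = 1} := isClosed_eq (by fun_prop) (by fun_prop)
  exact this.measurableSet

lemma tendsto_integral_prod {μ : Measure (Phase d)} [IsFiniteMeasure μ]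
    (hμ : ∀ᵐ p ∂μ, p.2 ∈ usphere d) {f h : Vec d → ℝ} (hf : Continuous f) (hh : Continuous h)
    (hf0 : ∀ x, 0 ≤ f x) (hh0 : ∀ x, 0 ≤ h x) :
    Tendsto (fun n => ∫ p, ramp n (f p.1) * ballCutoff d n p.1 * ramp n (h (radial p.2)) ∂μ) atTop
      (𝓝 (μ.real (f.support ×ˢ h.support))) := by
  have hmeas : ∀ n, Measurable (ramp n) := fun n => by unfold ramp; fun_prop
  have hrad : Measurable (radial (d := d)) := by unfold radial; fun_prop
  have hset : MeasurableSet (f.support ×ˢ h.support) :=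
    (hf.isOpen_support.prod hh.isOpen_support).measurableSet
  rw [← integral_indicator_one hset]
  refine tendsto_integral_of_dominated_convergence (fun _ => 1) (fun n => ?_)
    (integrable_const _) (fun n => ?_) ?_
  · exact ((((hmeas n).comp (hf.measurable.comp measurable_fst)).mul
      ((ballCutoff d n).continuous.measurable.comp measurable_fst)).mul
      ((hmeas n).comp (hh.measurable.comp (hrad.comp measurable_snd)))).aestronglyMeasurable
  · refine ae_of_all _ fun p => ?_
    rw [norm_mul, norm_mul]
    have h1 : ‖ballCutoff d n p.1‖ ≤ 1 := by
      rw [Real.norm_of_nonneg (ballCutoff d n).nonneg]; exact (ballCutoff d n).le_one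
    exact mul_le_one₀ (mul_le_one₀ (ramp_mem n (hf0 _)) (norm_nonneg _) h1) (norm_nonneg _)
      (ramp_mem n (hh0 _))
  · filter_upwards [hμ] with p hp
    rw [radial_eq_self hp]
    have := ((tendsto_ramp (hf0 p.1)).mul (tendsto_ballCutoff p.1)).mul (tendsto_ramp (hh0 p.2))
    convert this using 2
    simp only [Set.indicator_apply, Set.mem_ofPred_eq, Pi.one_apply]
    by_cases h1 : f p.1 = 0 <;> by_cases h2 : h p.2 = 0 <;> simp [h1, h2]

lemma concentratedOn_of_forall_sInt_eq_zero {ν : SignedMeasure (Phase d)}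
    (hν : ConcentratedOn ν {p : Phase d | p.2 ∈ usphere d}) {K : Set (Vec d)} (hK : IsClosed K)
    (h : ∀ f : Vec d → ℝ, IsTest f → (∀ x ∈ K, f x = 0) → ∀ m : Vec d → ℝ, Homog0 m →
      sInt ν (fun p => f p.1 * m p.2) = 0) :
    ConcentratedOn ν {p : Phase d | p.1 ∈ K} := by
  refine .of_restrict_eq ?_
  have key : ∀ U V : Set (Vec d), IsOpen U → IsOpen V →
      ν.toJordanDecomposition.posPart.restrict {p : Phase d | p.1 ∈ K}ᶜ (U ×ˢ V) =
      ν.toJordanDecomposition.negPart.restrict {p : Phase d | p.1 ∈ K}ᶜ (U ×ˢ V) := by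
    intro U V hU hV
    obtain ⟨f, hfs, hf, hfr⟩ := (hU.inter hK.isOpen_compl).exists_contDiff_support_eq (n := ⊤)
    obtain ⟨k, hks, hk, hkr⟩ := hV.exists_contDiff_support_eq (n := ⊤)
    have hf0 : ∀ x, 0 ≤ f x := fun x => (hfr ⟨x, rfl⟩).1
    have hk0 : ∀ x, 0 ≤ k x := fun x => (hkr ⟨x, rfl⟩).1
    have hset : (U ×ˢ V) ∩ {p : Phase d | p.1 ∈ K}ᶜ = f.support ×ˢ k.support := by
      rw [hfs, hks]; ext p; simp [and_assoc, and_comm]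
    have hm := (hU.prod hV).measurableSet
    rw [Measure.restrict_apply hm, Measure.restrict_apply hm, hset,
      ← measureReal_eq_measureReal_iff]
    have h1 := tendsto_integral_prod hν.1 hf.continuous hk.continuous hf0 hk0
    have h2 := tendsto_integral_prod hν.2 hf.continuous hk.continuous hf0 hk0
    refine tendsto_nhds_unique (h1.congr fun n => ?_) h2
    rw [← sub_eq_zero]
    refine h (fun x => ramp n (f x) * ballCutoff d n x) ⟨?_, ?_⟩ ?_ _ (homog0_comp_radial hk hk0 n)
    · refine ContDiff.mul (contDiff_iff_contDiffAt.mpr fun x => ?_) (ballCutoff d n).contDiff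
      exact (contDiffAt_ramp n (hf0 x)).comp x hf.contDiffAt
    · exact (ballCutoff d n).hasCompactSupport.mul_left
    · intro x hx
      have : f x = 0 := by
        by_contra hne
        have : x ∈ f.support := hne
        rw [hfs] at this
        exact this.2 hx
      simp [this, ramp]
  have hgen : (inferInstance : MeasurableSpace (Phase d)) = MeasurableSpace.generateFrom
      (Set.image2 (· ×ˢ ·) {U : Set (Vec d) | IsOpen U} {V : Set (Vec d) | IsOpen V}) := by
    have hcs : IsCountablySpanning {U : Set (Vec d) | IsOpen U} :=
      ⟨fun _ => Set.univ, fun _ => isOpen_univ (X := Vec d), Set.iUnion_const _⟩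
    have hb : MeasurableSpace.generateFrom {U : Set (Vec d) | IsOpen U} =
        (inferInstance : MeasurableSpace (Vec d)) :=
      (BorelSpace.measurable_eq (α := Vec d)).symm
    rw [← generateFrom_prod_eq hcs hcs, hb]
  refine ext_of_generate_finite _ hgen (isPiSystem_isOpen.prod isPiSystem_isOpen) ?_ ?_
  · rintro _ ⟨U, hU, V, hV, rfl⟩
    exact key U V hU hV
  · simpa using key Set.univ Set.univ isOpen_univ isOpen_univ

end Concentration

section Pairings

variable {d : ℕ} {u v a b X φ ψ : Vec d → ℝ} {m : Vec d → ℝ}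

lemma pd_Tm (hm : IsSym m) (hv : IsTest v) (ρ : Fin (d + 1)) (x : Vec d) :
    pd ρ (Tm m (fun y => (v y : ℂ))) x = Tm m (fun y => ((pd ρ v y : ℝ) : ℂ)) x := by
  have hf : Integrable (fun ξ => (m ξ : ℂ) * ftR v ξ) := integrable_sym_mul hm hv.integrable_ftR
  have hf' : Integrable (fun ξ => ‖ξ‖ * ‖(m ξ : ℂ) * ftR v ξ‖) := by
    obtain ⟨hm1, C, hC⟩ := hm
    have h1 := (hv.integrable_pow_mul_ftR 1).bdd_mul (c := C) (f := fun ξ => |m ξ|)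
      (by fun_prop) (Eventually.of_forall fun ξ => by simpa using hC ξ)
    refine h1.congr (ae_of_all _ fun ξ => ?_)
    simp only [pow_one, norm_mul, Complex.norm_real, Real.norm_eq_abs]
    ring
  have hS : Integrable
      (VectorFourier.fourierSMulRight (-dotL (d + 1)) (fun ξ => (m ξ : ℂ) * ftR v ξ)) := by
    refine (hf'.const_mul (2 * Real.pi * ‖-dotL (d + 1)‖)).mono' ?_ (ae_of_all _ fun ξ => ?_)
    · exact hf.aestronglyMeasurable.fourierSMulRight
    · rw [← mul_assoc]
      exact VectorFourier.norm_fourierSMulRight_le _ _ _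
  have hD := (VectorFourier.hasFDerivAt_fourierIntegral (-dotL (d + 1)) hf hf' x).const_mul
    ((((2 * Real.pi) ^ (d + 1))⁻¹ : ℝ) : ℂ)
  have hT : Tm m (fun y => (v y : ℂ)) = fun x => ((((2 * Real.pi) ^ (d + 1))⁻¹ : ℝ) : ℂ) *
      VectorFourier.fourierIntegral 𝐞 volume (-dotL (d + 1)).toLinearMap₁₂
        (fun ξ => (m ξ : ℂ) * ftR v ξ) x := by
    ext x
    exact ftInv_eq_fourierIntegral _ x
  rw [hT, pd, hD.fderiv, Tm, ftInv_eq_fourierIntegral, _root_.smul_apply,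
    Real.fourierIntegral_continuousLinearMap_apply' hS, smul_eq_mul]
  congr 2; ext ξ
  change _ = (m ξ : ℂ) * ftR (pd ρ v) ξ
  rw [ftR_pd hv, VectorFourier.fourierSMulRight_apply]
  have : (-dotL (d + 1)) ξ (Pi.single ρ 1) = -((2 * Real.pi)⁻¹ * ξ ρ) := by
    change -(dotL (d + 1) ξ (Pi.single ρ 1)) = _
    rw [dotL_apply]
    simp [Pi.single_apply]
  rw [this]
  have hpi : (Real.pi : ℂ) ≠ 0 := by exact_mod_cast Real.pi_ne_zero
  simp only [smul_eq_mul, Complex.real_smul]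
  push_cast
  field_simp

lemma pairG_eq_mulForm {g : Met d} (hg : IsMetricOn g Set.univ) (hu : IsTest u) (hm : IsSym m)
    (hv : IsTest v) :
    pairG g (fun x => (u x : ℂ)) (Tm m (fun y => (v y : ℂ))) =
      mulForm (fun x => volDen g x * u x) m v := by
  rw [← integral_mul_Tm (hu.mul_left (contDiff_volDen hg)) hm hv, pairG]
  congr 1; ext x
  simp only [Complex.conj_ofReal, volDen]
  push_cast; ring

lemma continuous_Tm (hm : IsSym m) (hv : IsTest v) :
    Continuous (Tm m (fun y => (v y : ℂ))) := by
  have : Tm m (fun y => (v y : ℂ)) = fun x => ((((2 * Real.pi) ^ (d + 1))⁻¹ : ℝ) : ℂ) *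
      VectorFourier.fourierIntegral 𝐞 volume (-dotL (d + 1)).toLinearMap₁₂
        (fun ξ => (m ξ : ℂ) * ftR v ξ) x := by
    ext x
    exact ftInv_eq_fourierIntegral _ x
  rw [this]
  exact continuous_const.mul (VectorFourier.fourierIntegral_continuous Real.continuous_fourierChar
    (-dotL (d + 1)).continuous₂ (integrable_sym_mul hm hv.integrable_ftR))

lemma pd_comm {f : Vec d → ℝ} (hf : ContDiff ℝ ∞ f) (α β : Fin (d + 1)) :
    pd α (pd β f) = pd β (pd α f) := by
  ext x
  have hd : DifferentiableAt ℝ (fderiv ℝ f) x :=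
    (hf.fderiv_right (m := ∞) (by simp)).differentiable (by simp) x
  have h1 : ∀ γ δ : Fin (d + 1), pd γ (pd δ f) x =
      fderiv ℝ (fderiv ℝ f) x (Pi.single γ 1) (Pi.single δ 1) := fun γ δ => by
    change fderiv ℝ (fun y => fderiv ℝ f y (Pi.single δ 1)) x (Pi.single γ 1) = _
    rw [fderiv_clm_apply hd (differentiableAt_const _)]
    simp
  rw [h1, h1]
  exact (hf.contDiffAt.isSymmSndFDerivAt (by simpa using ENat.LEInfty.out)).eq _ _

lemma ContDiff.differentiableAt_top {f : Vec d → ℝ} (hf : ContDiff ℝ ∞ f) (x : Vec d) :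
    DifferentiableAt ℝ f x := hf.differentiable (by simp) x

lemma pd_mul_isTest {f : Vec d → ℝ} (hf : ContDiff ℝ ∞ f) (hu : IsTest u) (α : Fin (d + 1)) :
    pd α (fun x => f x * u x) = fun x => pd α f x * u x + f x * pd α u x := by
  ext x
  rw [pd_mul (hf.differentiableAt_top x) (hu.1.differentiableAt_top x)]

lemma mulForm_pd_mul_left {f : Vec d → ℝ} (hf : ContDiff ℝ ∞ f) (hu : IsTest u)
    (hm : IsSym m) (hv : IsTest v) (α : Fin (d + 1)) :
    mulForm (fun x => f x * pd α u x) m v =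
      - mulForm (fun x => f x * u x) m (pd α v) - mulForm (fun x => pd α f x * u x) m v := by
  rw [← mulForm_pd_left (hu.mul_left hf) m hv, pd_mul_isTest hf hu,
    mulForm_add_left (hu.mul_left (contDiff_pd hf α)) ((hu.pd α).mul_left hf) hm hv]
  ring

/-- The exchange of derivatives behind the commutation of `X` with a divergence form operator. -/
lemma mulForm_divergence (hX : ContDiff ℝ ∞ X) (hb : ContDiff ℝ ∞ b) (hφ : IsTest φ)
    (hm : IsSym m) (hψ : IsTest ψ) (α β ρ : Fin (d + 1)) :
    mulForm (fun x => X x * pd α (fun y => b y * pd β φ y) x) m (pd ρ ψ) =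
      mulForm (fun x => pd ρ (fun y => X y * b y) x * pd β φ x) m (pd α ψ)
      - mulForm (fun x => pd α X x * b x * pd β φ x) m (pd ρ ψ)
      - mulForm (fun x => pd β (fun y => X y * b y) x * pd ρ φ x) m (pd α ψ)
      - mulForm (fun x => X x * b x * pd ρ φ x) m (pd α (pd β ψ)) := by
  have hXb : ContDiff ℝ ∞ (fun y => X y * b y) := hX.mul hb
  have h1 := mulForm_pd_mul_left hX ((hφ.pd β).mul_left hb) hm (hψ.pd ρ) α
  have h2 := mulForm_pd_mul_left hXb (hφ.pd β) hm (hψ.pd α) ρ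
  have h3 := mulForm_pd_mul_left hXb (hφ.pd ρ) hm (hψ.pd α) β
  rw [pd_comm hφ.1 ρ β, pd_comm hψ.1 ρ α] at h2
  rw [pd_comm hψ.1 β α] at h3
  simp only [mul_assoc] at h1 h2 h3 ⊢
  linear_combination h1 - h2 + h3

end Pairings

section Sequences

variable {d : ℕ} {K : Set (Vec d)} {m : Vec d → ℝ}

lemma pd_eq_of_eqOn {f g : Vec d → ℝ} {U : Set (Vec d)} (hU : IsOpen U) (h : Set.EqOn f g U)
    {x : Vec d} (hx : x ∈ U) (k : Fin (d + 1)) : pd k f x = pd k g x := by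
  rw [pd, pd, (h.eventuallyEq_of_mem (hU.mem_nhds hx)).fderiv_eq]

lemma pd_eq_zero_of_notMem {u : Vec d → ℝ} (hK : IsClosed K) (hu : ∀ x ∉ K, u x = 0)
    {x : Vec d} (hx : x ∉ K) (k : Fin (d + 1)) : pd k u x = 0 := by
  rw [pd_eq_of_eqOn (g := fun _ => 0) hK.isOpen_compl (fun y hy => hu y hy) hx]
  simp [pd]

/-- A smooth function agrees to first order on a compact set with a compactly supported one. -/
lemma exists_isTest_eq_on (hK : IsCompact K) {G : Vec d → ℝ} (hG : ContDiff ℝ ∞ G) :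
    ∃ h, IsTest h ∧ ∀ x ∈ K, h x = G x ∧ ∀ k, pd k h x = pd k G x := by
  obtain ⟨R, hR⟩ := hK.isBounded.subset_ball (0 : Vec d)
  obtain ⟨n, hn⟩ := exists_nat_ge R
  refine ⟨fun x => ballCutoff d n x * G x,
    ⟨(ballCutoff d n).contDiff.mul hG, (ballCutoff d n).hasCompactSupport.mul_right⟩, ?_⟩
  have h1 : Set.EqOn (fun x => ballCutoff d n x * G x) G (Metric.ball 0 R) := by
    intro x hx
    have : ballCutoff d n x = 1 := by
      refine (ballCutoff d n).one_of_mem_closedBall ?_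
      rw [mem_ball_iff_norm, sub_zero] at hx
      simp only [ballCutoff, mem_closedBall_iff_norm, sub_zero]
      linarith
    simp [this]
  exact fun x hx => ⟨h1 (hR hx), fun k => pd_eq_of_eqOn Metric.isOpen_ball h1 (hR hx) k⟩

lemma IsTest.integrable_sq {u : Vec d → ℝ} (hu : IsTest u) : Integrable (fun x => u x ^ 2) := by
  simpa [sq] using (hu.mul_left hu.1).integrable

lemma IsTest.integral_sq_eq {u : Vec d → ℝ} (hu : IsTest u) :
    ∫ x, u x ^ 2 = (eLpNorm u 2 volume).toReal ^ 2 := by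
  have hL : MemLp u 2 volume := hu.continuous.memLp_of_hasCompactSupport hu.2
  rw [hL.eLpNorm_eq_integral_rpow_norm two_ne_zero ENNReal.ofNat_ne_top]
  simp only [ENNReal.toReal_ofNat, Real.rpow_ofNat, Real.norm_eq_abs, sq_abs]
  have h0 : 0 ≤ ∫ x, u x ^ 2 := integral_nonneg fun x => sq_nonneg _
  rw [ENNReal.toReal_ofReal (by positivity), ← Real.rpow_natCast, ← Real.rpow_mul h0]
  simp

/-- A sequence of test functions vanishing off `K` and bounded in `L²`. -/
structure L2Bounded (K : Set (Vec d)) (u : ℕ → Vec d → ℝ) : Prop where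
  isTest : ∀ n, IsTest (u n)
  eq_zero : ∀ n, ∀ x ∉ K, u n x = 0
  bound : ∃ M, ∀ n, ∫ x, u n x ^ 2 ≤ M

/-- A sequence of test functions vanishing off `K` and tending to zero in `L²`. -/
structure L2Null (K : Set (Vec d)) (v : ℕ → Vec d → ℝ) : Prop where
  isTest : ∀ n, IsTest (v n)
  eq_zero : ∀ n, ∀ x ∉ K, v n x = 0
  tendsto : Tendsto (fun n => ∫ x, v n x ^ 2) atTop (𝓝 0)

lemma L2Bounded.mul_left {u : ℕ → Vec d → ℝ} (hu : L2Bounded K u) (hK : IsCompact K)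
    {F : Vec d → ℝ} (hF : ContDiff ℝ ∞ F) : L2Bounded K (fun n x => F x * u n x) := by
  obtain ⟨M, hM⟩ := hu.bound
  obtain ⟨B, hB⟩ := hK.exists_bound_of_continuousOn hF.continuous.continuousOn
  refine ⟨fun n => (hu.isTest n).mul_left hF, fun n x hx => by simp [hu.eq_zero n x hx],
    B ^ 2 * M, fun n => ?_⟩
  calc ∫ x, (F x * u n x) ^ 2 ≤ ∫ x, B ^ 2 * u n x ^ 2 := by
        refine integral_mono ((hu.isTest n).mul_left hF).integrable_sq
          ((hu.isTest n).integrable_sq.const_mul _) fun x => ?_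
        by_cases hx : x ∈ K
        · have := sq_le_sq' (by linarith [neg_abs_le (F x), hB x hx, Real.norm_eq_abs (F x)])
            ((le_abs_self _).trans (hB x hx))
          simp only [mul_pow]
          gcongr
        · simp [hu.eq_zero n x hx]
    _ = B ^ 2 * ∫ x, u n x ^ 2 := integral_const_mul _ _
    _ ≤ B ^ 2 * M := by gcongr; exact hM n

lemma tendsto_zero_of_forall_le {Q : ℕ → ℂ} {a b : ℕ → ℝ} {C M : ℝ} (hC : 0 ≤ C)
    (ha : ∀ n, a n ≤ M) (hb0 : ∀ n, 0 ≤ b n) (hb : Tendsto b atTop (𝓝 0))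
    (h : ∀ n, ∀ t > 0, ‖Q n‖ ≤ C * (t * a n + t⁻¹ * b n)) : Tendsto Q atTop (𝓝 0) := by
  have hs : Tendsto (fun n : ℕ => √(b n + 1 / ((n : ℝ) + 1))) atTop (𝓝 0) := by
    have := (hb.add tendsto_one_div_add_atTop_nhds_zero_nat).sqrt
    simpa using this
  have hlim : Tendsto (fun n : ℕ => C * (√(b n + 1 / ((n : ℝ) + 1)) * M +
      √(b n + 1 / ((n : ℝ) + 1)))) atTop (𝓝 0) := by
    simpa using ((hs.mul_const M).add hs).const_mul C
  refine squeeze_zero_norm (fun n => ?_) hlim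
  have hp : 0 < b n + 1 / ((n : ℝ) + 1) := add_pos_of_nonneg_of_pos (hb0 n) (by positivity)
  have hr := Real.sqrt_pos.mpr hp
  refine (h n _ hr).trans ?_
  gcongr
  · exact ha n
  · rw [inv_mul_le_iff₀ hr, Real.mul_self_sqrt hp.le]
    linarith [show 0 < 1 / ((n : ℝ) + 1) by positivity]

variable {u v : ℕ → Vec d → ℝ}

lemma L2Null.integral_nonneg (n : ℕ) : 0 ≤ ∫ x, v n x ^ 2 :=
  MeasureTheory.integral_nonneg fun _ => sq_nonneg _

lemma L2Bounded.tendsto_mulForm (hu : L2Bounded K u) (hm : IsSym m) (hv : L2Null K v) :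
    Tendsto (fun n => mulForm (u n) m (v n)) atTop (𝓝 0) := by
  obtain ⟨M, hM⟩ := hu.bound
  obtain ⟨C, hC⟩ := hm.2
  exact tendsto_zero_of_forall_le ((abs_nonneg _).trans (hC 0)) hM L2Null.integral_nonneg
    hv.tendsto fun n t ht => norm_mulForm_le (hu.isTest n) (hv.isTest n) hC ht

lemma L2Bounded.tendsto_commutator (hK : IsCompact K) (hu : L2Bounded K u) (hm : Homog0 m)
    (hv : L2Null K v) {G : Vec d → ℝ} (hG : ContDiff ℝ ∞ G) (α : Fin (d + 1)) :
    Tendsto (fun n => mulForm (u n) m (fun x => G x * pd α (v n) x) -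
      mulForm (fun x => u n x * G x) m (pd α (v n))) atTop (𝓝 0) := by
  obtain ⟨M, hM⟩ := hu.bound
  obtain ⟨h, hh, hhG⟩ := exists_isTest_eq_on hK hG
  obtain ⟨C, hC0, hC⟩ := exists_commutator_bound hh hm α
  refine tendsto_zero_of_forall_le hC0 hM L2Null.integral_nonneg hv.tendsto fun n t ht => ?_
  have e1 : (fun x => G x * pd α (v n) x) = fun x => h x * pd α (v n) x := by
    ext x
    by_cases hx : x ∈ K
    · rw [(hhG x hx).1]
    · rw [pd_eq_zero_of_notMem hK.isClosed (hv.eq_zero n) hx, mul_zero, mul_zero]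
  have e2 : (fun x => u n x * G x) = fun x => u n x * h x := by
    ext x
    by_cases hx : x ∈ K
    · rw [(hhG x hx).1]
    · rw [hu.eq_zero n x hx, zero_mul, zero_mul]
  simp only [e1, e2]
  exact hC (u n) (v n) (hu.isTest n) (hv.isTest n) t ht

lemma L2Bounded.tendsto_commutator_two (hK : IsCompact K) (hu : L2Bounded K u) (hm : Homog0 m)
    (hv : L2Null K v) {G : Vec d → ℝ} (hG : ContDiff ℝ ∞ G) (α β : Fin (d + 1)) :
    Tendsto (fun n => mulForm (u n) m (fun x => G x * pd α (pd β (v n)) x) -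
      mulForm (fun x => u n x * G x) m (pd α (pd β (v n))) -
      ∑ k, mulForm (fun x => u n x * pd k G x) (fun ξ => ξ α * pd k m ξ) (pd β (v n)))
      atTop (𝓝 0) := by
  obtain ⟨M, hM⟩ := hu.bound
  obtain ⟨h, hh, hhG⟩ := exists_isTest_eq_on hK hG
  obtain ⟨C, hC0, hC⟩ := exists_commutator_bound_two hh hm α β
  refine tendsto_zero_of_forall_le hC0 hM L2Null.integral_nonneg hv.tendsto fun n t ht => ?_
  have hv1 : ∀ x ∉ K, pd β (v n) x = 0 := fun x hx =>
    pd_eq_zero_of_notMem hK.isClosed (hv.eq_zero n) hx β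
  have e1 : (fun x => G x * pd α (pd β (v n)) x) = fun x => h x * pd α (pd β (v n)) x := by
    ext x
    by_cases hx : x ∈ K
    · rw [(hhG x hx).1]
    · rw [pd_eq_zero_of_notMem hK.isClosed hv1 hx, mul_zero, mul_zero]
  have e2 : (fun x => u n x * G x) = fun x => u n x * h x := by
    ext x
    by_cases hx : x ∈ K
    · rw [(hhG x hx).1]
    · rw [hu.eq_zero n x hx, zero_mul, zero_mul]
  have e3 : ∀ k, (fun x => u n x * pd k G x) = fun x => u n x * pd k h x := by
    intro k; ext x
    by_cases hx : x ∈ K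
    · rw [(hhG x hx).2]
    · rw [hu.eq_zero n x hx, zero_mul, zero_mul]
  simp only [e1, e2, e3]
  exact hC (u n) (v n) (hu.isTest n) (hv.isTest n) t ht

end Sequences

section Identity

variable {d : ℕ} {g : Met d} {X φ ψ : Vec d → ℝ} {m : Vec d → ℝ}

lemma IsTest.boxOp (hg : IsMetricOn g Set.univ) (hφ : IsTest φ) : IsTest (BoxOp g φ) := by
  refine IsTest.sub (isTest_sum _ fun α _ => isTest_sum _ fun β _ => ?_)
    (isTest_sum _ fun α _ => ?_)
  · exact ((hφ.pd β).pd α).mul_left (contDiff_ginv hg α β)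
  · exact (hφ.pd α).mul_left (contDiff_Hgauge hg α)

lemma boxOp_eq_zero_of_notMem {K : Set (Vec d)} (hK : IsClosed K) (hφ : ∀ x ∉ K, φ x = 0)
    {x : Vec d} (hx : x ∉ K) : BoxOp g φ x = 0 := by
  have h1 : ∀ α, ∀ y ∉ K, pd α φ y = 0 := fun α y hy => pd_eq_zero_of_notMem hK hφ hy α
  simp [BoxOp, h1 _ x hx, fun α β => pd_eq_zero_of_notMem hK (h1 β) hx α]

/-- The wave operator in divergence form. -/
lemma volDen_mul_boxOp (hg : IsMetricOn g Set.univ) (hφ : ContDiff ℝ ∞ φ) (x : Vec d) :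
    volDen g x * BoxOp g φ x =
      ∑ α, ∑ β, pd α (fun y => (volDen g y * ginv g y α β) * pd β φ y) x := by
  have hb : ∀ α β, ContDiff ℝ ∞ (fun y => volDen g y * ginv g y α β) := fun α β =>
    (contDiff_volDen hg).mul (contDiff_ginv hg α β)
  have h1 : ∀ α β, pd α (fun y => (volDen g y * ginv g y α β) * pd β φ y) x =
      pd α (fun y => volDen g y * ginv g y α β) x * pd β φ x +
        volDen g x * ginv g x α β * pd α (pd β φ) x := fun α β =>
    pd_mul ((hb α β).differentiableAt_top x) ((contDiff_pd hφ β).differentiableAt_top x) α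
  have h2 : ∀ β, ∑ α, pd α (fun y => volDen g y * ginv g y α β) x =
      -(volDen g x * Hgauge g g β x) := fun β => by
    rw [← sum_pd_volDen_mul_ginv hg β x]
    simp only [fun y α => ginv_symm hg y α β]
  simp only [h1, Finset.sum_add_distrib]
  rw [Finset.sum_comm]
  simp only [← Finset.sum_mul, h2]
  simp only [BoxOp, smul_eq_mul, mul_sub, Finset.mul_sum, neg_mul, Finset.sum_neg_distrib,
    mul_assoc]
  ring

/-- The bilinear form with density `√|det g| F` in two derivatives of `φ` and `ψ`. -/
def derivForm (g : Met d) (F m : Vec d → ℝ) (α β : Fin (d + 1)) (φ ψ : Vec d → ℝ) : ℂ :=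
  mulForm (fun x => volDen g x * F x * pd α φ x) m (pd β ψ)

lemma mulForm_boxOp_left (hg : IsMetricOn g Set.univ) (hX : ContDiff ℝ ∞ X) (hφ : IsTest φ)
    (hm : IsSym m) (hψ : IsTest ψ) (ρ : Fin (d + 1)) :
    mulForm (fun x => volDen g x * X x * BoxOp g φ x) m (pd ρ ψ) =
      (∑ α, ∑ β, (- derivForm g (fun x => pd α X x * ginv g x α β) m β ρ φ ψ +
        derivForm g (fun x => X x * pd ρ (fun y => ginv g y α β) x) m β α φ ψ -
        derivForm g (fun x => ginv g x α β * pd β X x) m ρ α φ ψ)) +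
      (∑ α, ∑ β, mulForm (fun x => pd ρ (fun y => volDen g y * X y) x * ginv g x α β *
        pd β φ x) m (pd α ψ)) -
      (∑ α, ∑ β, mulForm (fun x => volDen g x * X x * pd ρ φ x * ginv g x α β) m
        (pd α (pd β ψ))) +
      ∑ α, mulForm (fun x => volDen g x * X x * pd ρ φ x * Hgauge g g α x) m (pd α ψ) := by
  have hw := contDiff_volDen hg
  have hG := contDiff_ginv hg
  have hb : ∀ α β, ContDiff ℝ ∞ (fun y => volDen g y * ginv g y α β) := fun α β =>
    hw.mul (hG α β)
  have hwX : ContDiff ℝ ∞ (fun y => volDen g y * X y) := hw.mul hX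
  have e0 : (fun x => volDen g x * X x * BoxOp g φ x) = fun x => ∑ α, ∑ β,
      X x * pd α (fun y => (volDen g y * ginv g y α β) * pd β φ y) x := by
    ext x
    rw [mul_comm (volDen g x), mul_assoc, volDen_mul_boxOp hg hφ.1]
    simp only [Finset.mul_sum]
  have hT : ∀ α β, IsTest (fun x =>
      X x * pd α (fun y => (volDen g y * ginv g y α β) * pd β φ y) x) := fun α β =>
    (((hφ.pd β).mul_left (hb α β)).pd α).mul_left hX
  rw [e0, mulForm_sum_left _ (fun α => isTest_sum _ fun β _ => hT α β) hm (hψ.pd ρ)]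
  simp only [fun α => mulForm_sum_left Finset.univ (hT α) hm (hψ.pd ρ),
    fun α β => mulForm_divergence hX (hb α β) hφ hm hψ α β ρ]
  have e1 : ∀ α β, mulForm (fun x => pd ρ (fun y => X y * (volDen g y * ginv g y α β)) x *
      pd β φ x) m (pd α ψ) =
      mulForm (fun x => pd ρ (fun y => volDen g y * X y) x * ginv g x α β * pd β φ x) m (pd α ψ) +
      derivForm g (fun x => X x * pd ρ (fun y => ginv g y α β) x) m β α φ ψ := by
    intro α β
    rw [derivForm, ← mulForm_add_left ((hφ.pd β).mul_left ((contDiff_pd hwX ρ).mul (hG α β)))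
      ((hφ.pd β).mul_left (hw.mul (hX.mul (contDiff_pd (hG α β) ρ)))) hm (hψ.pd α)]
    congr 1; ext x
    have : (fun y => X y * (volDen g y * ginv g y α β)) =
        fun y => (volDen g y * X y) * ginv g y α β := by ext y; ring
    rw [this, pd_mul (hwX.differentiableAt_top x) ((hG α β).differentiableAt_top x)]
    ring
  have e2 : ∀ α β, mulForm (fun x => pd α X x * (volDen g x * ginv g x α β) * pd β φ x) m
      (pd ρ ψ) = derivForm g (fun x => pd α X x * ginv g x α β) m β ρ φ ψ := by
    intro α β
    rw [derivForm]; congr 1; ext x; ring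
  have e3 : ∀ α β, mulForm (fun x => pd β (fun y => X y * (volDen g y * ginv g y α β)) x *
      pd ρ φ x) m (pd α ψ) = derivForm g (fun x => ginv g x α β * pd β X x) m ρ α φ ψ +
      mulForm (fun x => X x * pd β (fun y => volDen g y * ginv g y α β) x * pd ρ φ x) m
        (pd α ψ) := by
    intro α β
    rw [derivForm, ← mulForm_add_left ((hφ.pd ρ).mul_left (hw.mul ((hG α β).mul
      (contDiff_pd hX β)))) ((hφ.pd ρ).mul_left (hX.mul (contDiff_pd (hb α β) β))) hm (hψ.pd α)]
    congr 1; ext x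
    rw [pd_mul (hX.differentiableAt_top x) ((hb α β).differentiableAt_top x)]
    ring
  have e4 : ∀ α, ∑ β, mulForm (fun x => X x * pd β (fun y => volDen g y * ginv g y α β) x *
      pd ρ φ x) m (pd α ψ) =
      - mulForm (fun x => volDen g x * X x * pd ρ φ x * Hgauge g g α x) m (pd α ψ) := by
    intro α
    rw [← mulForm_sum_left _ (fun β => (hφ.pd ρ).mul_left (hX.mul (contDiff_pd (hb α β) β))) hm
      (hψ.pd α), ← mulForm_neg_left]
    congr 1; ext x
    rw [← Finset.sum_mul, ← Finset.mul_sum, sum_pd_volDen_mul_ginv hg]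
    ring
  have e5 : ∀ α β, mulForm (fun x => X x * (volDen g x * ginv g x α β) * pd ρ φ x) m
      (pd α (pd β ψ)) = mulForm (fun x => volDen g x * X x * pd ρ φ x * ginv g x α β) m
      (pd α (pd β ψ)) := by
    intro α β
    congr 1; ext x; ring
  simp only [e1, e2, e3, e5, Finset.sum_add_distrib, Finset.sum_sub_distrib,
    Finset.sum_neg_distrib, e4]
  ring

end Identity

section Propagation

variable {d : ℕ} {g : Met d} {X F φ ψ : Vec d → ℝ} {m : Vec d → ℝ} {K : Set (Vec d)}

/-- Moving the outer derivative in the divergence form of the wave operator. -/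
lemma sum_mulForm_ginv (hg : IsMetricOn g Set.univ) (hF : ContDiff ℝ ∞ F) (hφ : IsTest φ)
    (hm : IsSym m) (hψ : IsTest ψ) :
    ∑ α, ∑ β, mulForm (fun x => F x * ginv g x α β * pd β φ x) m (pd α ψ) =
      - mulForm (fun x => F x * BoxOp g φ x) m ψ -
      ∑ α, ∑ β, mulForm (fun x => pd α (fun y => F y / volDen g y) x *
        (volDen g x * ginv g x α β) * pd β φ x) m ψ := by
  have hw := contDiff_volDen hg
  have hw0 : ∀ x, volDen g x ≠ 0 := fun x => (volDen_pos hg x).ne'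
  have hE : ContDiff ℝ ∞ (fun y => F y / volDen g y) := hF.div hw hw0
  have hb : ∀ α β, ContDiff ℝ ∞ (fun y => volDen g y * ginv g y α β) := fun α β =>
    hw.mul (contDiff_ginv hg α β)
  have hq : ∀ α β, IsTest (fun y => (volDen g y * ginv g y α β) * pd β φ y) := fun α β =>
    (hφ.pd β).mul_left (hb α β)
  have e0 : (fun x => F x * BoxOp g φ x) = fun x => ∑ α, ∑ β, (F x / volDen g x) *
      pd α (fun y => (volDen g y * ginv g y α β) * pd β φ y) x := by
    ext x
    simp only [← Finset.mul_sum]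
    rw [← volDen_mul_boxOp hg hφ.1, ← mul_assoc, div_mul_cancel₀ _ (hw0 x)]
  have hT : ∀ α β, IsTest (fun x => (F x / volDen g x) *
      pd α (fun y => (volDen g y * ginv g y α β) * pd β φ y) x) := fun α β =>
    ((hq α β).pd α).mul_left hE
  rw [e0, mulForm_sum_left _ (fun α => isTest_sum _ fun β _ => hT α β) hm hψ]
  simp only [fun α => mulForm_sum_left Finset.univ (hT α) hm hψ]
  simp only [fun α β => mulForm_pd_mul_left hE (hq α β) hm hψ α, Finset.sum_sub_distrib,
    Finset.sum_neg_distrib]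
  have e1 : ∀ α β, mulForm (fun x => F x / volDen g x * (volDen g x * ginv g x α β * pd β φ x)) m
      (pd α ψ) = mulForm (fun x => F x * ginv g x α β * pd β φ x) m (pd α ψ) := by
    intro α β
    congr 1; ext x
    have := hw0 x
    field_simp
  simp only [e1]
  simp only [mul_assoc]
  ring

lemma mulForm_boxOp_right (hg : IsMetricOn g Set.univ) {u : Vec d → ℝ} (hu : IsTest u)
    (hm : IsSym m) (hψ : IsTest ψ) :
    mulForm u m (BoxOp g ψ) =
      (∑ α, ∑ β, mulForm u m (fun x => ginv g x α β * pd α (pd β ψ) x)) -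
        ∑ α, mulForm u m (fun x => Hgauge g g α x * pd α ψ x) := by
  have h1 : ∀ α β, IsTest (fun x => ginv g x α β * pd α (pd β ψ) x) := fun α β =>
    ((hψ.pd β).pd α).mul_left (contDiff_ginv hg α β)
  have h2 : ∀ α, IsTest (fun x => Hgauge g g α x * pd α ψ x) := fun α =>
    (hψ.pd α).mul_left (contDiff_Hgauge hg α)
  have e : BoxOp g ψ = fun x => (∑ α, ∑ β, ginv g x α β * pd α (pd β ψ) x) -
      ∑ α, Hgauge g g α x * pd α ψ x := by
    ext x; simp [BoxOp]
  rw [e, mulForm_sub_right hu hm (isTest_sum _ fun α _ => isTest_sum _ fun β _ => h1 α β)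
    (isTest_sum _ fun α _ => h2 α), mulForm_sum_right _ h2 hu hm,
    mulForm_sum_right _ (fun α => isTest_sum _ fun β _ => h1 α β) hu hm]
  simp only [fun α => mulForm_sum_right Finset.univ (h1 α) hu hm]

/-- The limit of the commutator form of a field `X ∂_ρ` with the wave operator, expressed through
the limits of the forms in the first derivatives. -/
lemma tendsto_mulForm_boxOp (hg : IsMetricOn g Set.univ) (hK : IsCompact K)
    (hX : ContDiff ℝ ∞ X) (hm : Homog0 m) {φ ψ : ℕ → Vec d → ℝ} (hφ : ∀ n, IsTest (φ n))
    (hdφ : ∀ α, L2Bounded K (fun n => pd α (φ n))) (hPφ : L2Bounded K (fun n => BoxOp g (φ n)))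
    (hψ : L2Null K ψ)
    {l : (Vec d → ℝ) → (Vec d → ℝ) → Fin (d + 1) → Fin (d + 1) → ℂ}
    (hl : ∀ F, ContDiff ℝ ∞ F → ∀ m, Homog0 m → ∀ α β,
      Tendsto (fun n => derivForm g F m α β (φ n) (ψ n)) atTop (𝓝 (l F m α β)))
    (ρ : Fin (d + 1)) :
    Tendsto (fun n => mulForm (fun x => volDen g x * X x * BoxOp g (φ n) x) m (pd ρ (ψ n)) +
      mulForm (fun x => volDen g x * X x * pd ρ (φ n) x) m (BoxOp g (ψ n))) atTop
      (𝓝 (∑ α, ∑ β, (- l (fun x => pd α X x * ginv g x α β) m β ρ +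
        l (fun x => X x * pd ρ (fun y => ginv g y α β) x) m β α -
        l (fun x => ginv g x α β * pd β X x) m ρ α +
        ∑ k, l (fun x => X x * pd k (fun y => ginv g y α β) x) (fun ξ => ξ α * pd k m ξ) ρ β))) := by
  have hw := contDiff_volDen hg
  have hG := contDiff_ginv hg
  have hwX : ContDiff ℝ ∞ (fun y => volDen g y * X y) := hw.mul hX
  have hF : ContDiff ℝ ∞ (pd ρ (fun y => volDen g y * X y)) := contDiff_pd hwX ρ
  have hu : L2Bounded K (fun n x => volDen g x * X x * pd ρ (φ n) x) := (hdφ ρ).mul_left hK hwX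
  have hD : Tendsto (fun n => ∑ α, ∑ β, mulForm (fun x =>
      pd ρ (fun y => volDen g y * X y) x * ginv g x α β * pd β (φ n) x) m (pd α (ψ n)))
      atTop (𝓝 0) := by
    simp only [fun n => sum_mulForm_ginv hg hF (hφ n) hm.isSym (hψ.isTest n)]
    have hE : ContDiff ℝ ∞ (fun x => pd ρ (fun y => volDen g y * X y) x / volDen g x) :=
      hF.div hw fun x => (volDen_pos hg x).ne'
    have h1 := (hPφ.mul_left hK hF).tendsto_mulForm hm.isSym hψ
    have h2 := fun α β => ((hdφ β).mul_left hK
      ((contDiff_pd hE α).mul (hw.mul (hG α β)))).tendsto_mulForm hm.isSym hψ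
    simpa using h1.neg.sub (tendsto_finsetSum _ fun α _ => tendsto_finsetSum _ fun β _ => h2 α β)
  have hC2 := fun α β => hu.tendsto_commutator_two hK hm hψ (hG α β) α β
  have hC1 := fun α => hu.tendsto_commutator hK hm hψ (contDiff_Hgauge hg α) α
  have hS := tendsto_finsetSum Finset.univ fun α _ => tendsto_finsetSum Finset.univ fun β _ =>
    hC2 α β
  have hH := tendsto_finsetSum Finset.univ fun α _ => hC1 α
  have hL : Tendsto (fun n => ∑ α, ∑ β,
      (- derivForm g (fun x => pd α X x * ginv g x α β) m β ρ (φ n) (ψ n) +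
        derivForm g (fun x => X x * pd ρ (fun y => ginv g y α β) x) m β α (φ n) (ψ n) -
        derivForm g (fun x => ginv g x α β * pd β X x) m ρ α (φ n) (ψ n) +
        ∑ k, derivForm g (fun x => X x * pd k (fun y => ginv g y α β) x)
          (fun ξ => ξ α * pd k m ξ) ρ β (φ n) (ψ n))) atTop _ :=
    tendsto_finsetSum _ fun α _ => tendsto_finsetSum _ fun β _ =>
      (((hl _ ((contDiff_pd hX α).mul (hG α β)) m hm β ρ).neg.add
        (hl _ (hX.mul (contDiff_pd (hG α β) ρ)) m hm β α)).sub
        (hl _ ((hG α β).mul (contDiff_pd hX β)) m hm ρ α)).add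
        (tendsto_finsetSum _ fun k _ =>
          hl _ (hX.mul (contDiff_pd (hG α β) k)) _ (hm.mul_pd α k) ρ β)
  have hsum := ((hL.add hD).add hS).sub hH
  simp only [Finset.sum_const_zero, add_zero, sub_zero] at hsum
  refine hsum.congr fun n => ?_
  have ek : ∀ α β k, mulForm (fun x => volDen g x * X x * pd ρ (φ n) x *
      pd k (fun y => ginv g y α β) x) (fun ξ => ξ α * pd k m ξ) (pd β (ψ n)) =
      derivForm g (fun x => X x * pd k (fun y => ginv g y α β) x)
          (fun ξ => ξ α * pd k m ξ) ρ β (φ n) (ψ n) := by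
    intro α β k
    rw [derivForm]; congr 1; ext x; ring
  rw [mulForm_boxOp_left hg hX (hφ n) hm.isSym (hψ.isTest n) ρ,
    mulForm_boxOp_right hg (hu.isTest n) hm.isSym (hψ.isTest n)]
  simp only [ek, Finset.sum_add_distrib, Finset.sum_sub_distrib, Finset.sum_neg_distrib]
  ring

end Propagation

section PhaseSpace

variable {d : ℕ} {c a : Vec d → ℝ} {p : Phase d}

lemma hasFDerivAt_mul_phase (hc : DifferentiableAt ℝ c p.1) (ha : DifferentiableAt ℝ a p.2) :
    HasFDerivAt (fun q : Phase d => c q.1 * a q.2)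
      (c p.1 • (fderiv ℝ a p.2).comp (ContinuousLinearMap.snd ℝ (Vec d) (Vec d)) +
        a p.2 • (fderiv ℝ c p.1).comp (ContinuousLinearMap.fst ℝ (Vec d) (Vec d))) p := by
  have h1 : HasFDerivAt (fun q : Phase d => c q.1) _ p := hc.hasFDerivAt.comp p hasFDerivAt_fst
  have h2 : HasFDerivAt (fun q : Phase d => a q.2) _ p := ha.hasFDerivAt.comp p hasFDerivAt_snd
  exact h1.mul h2

lemma pdx_sum_mul {ι : Type*} (s : Finset ι) {c a : ι → Vec d → ℝ}
    (hc : ∀ i, DifferentiableAt ℝ (c i) p.1) (ha : ∀ i, DifferentiableAt ℝ (a i) p.2)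
    (μ : Fin (d + 1)) :
    pdx μ (fun q => ∑ i ∈ s, c i q.1 * a i q.2) p = ∑ i ∈ s, pd μ (c i) p.1 * a i p.2 := by
  rw [pdx, (HasFDerivAt.fun_sum fun i _ => hasFDerivAt_mul_phase (hc i) (ha i)).fderiv]
  simp [pd, mul_comm]

lemma pdxi_sum_mul {ι : Type*} (s : Finset ι) {c a : ι → Vec d → ℝ}
    (hc : ∀ i, DifferentiableAt ℝ (c i) p.1) (ha : ∀ i, DifferentiableAt ℝ (a i) p.2)
    (μ : Fin (d + 1)) :
    pdxi μ (fun q => ∑ i ∈ s, c i q.1 * a i q.2) p = ∑ i ∈ s, c i p.1 * pd μ (a i) p.2 := by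
  rw [pdxi, (HasFDerivAt.fun_sum fun i _ => hasFDerivAt_mul_phase (hc i) (ha i)).fderiv]
  simp [pd]

lemma differentiableAt_coord (α : Fin (d + 1)) (ξ : Vec d) :
    DifferentiableAt ℝ (fun ζ : Vec d => ζ α) ξ := by fun_prop

lemma pd_coord (μ α : Fin (d + 1)) (ξ : Vec d) :
    pd μ (fun ζ : Vec d => ζ α) ξ = if α = μ then 1 else 0 := by
  have : fderiv ℝ (fun ζ : Vec d => ζ α) ξ = ContinuousLinearMap.proj α :=
    (ContinuousLinearMap.proj (R := ℝ) (φ := fun _ : Fin (d + 1) => ℝ) α).fderiv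
  rw [pd, this, ContinuousLinearMap.proj_apply, Pi.single_apply]

variable {g : Met d}

lemma Gq_eq (g : Met d) : Gq g = fun q : Phase d =>
    ∑ i : Fin (d + 1) × Fin (d + 1), ginv g q.1 i.1 i.2 * (q.2 i.1 * q.2 i.2) := by
  ext q
  simp only [Gq, Fintype.sum_prod_type, mul_assoc]

lemma pdx_Gq (hg : IsMetricOn g Set.univ) (μ : Fin (d + 1)) (p : Phase d) :
    pdx μ (Gq g) p = ∑ α, ∑ β, pd μ (fun y => ginv g y α β) p.1 * (p.2 α * p.2 β) := by
  rw [Gq_eq, pdx_sum_mul (ι := Fin (d + 1) × Fin (d + 1)) (c := fun i y => ginv g y i.1 i.2)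
    (a := fun i ζ => ζ i.1 * ζ i.2) _
    (fun i => (contDiff_ginv hg i.1 i.2).differentiableAt_top _) (fun i => by fun_prop)]
  rw [Fintype.sum_prod_type]

lemma pdxi_Gq (hg : IsMetricOn g Set.univ) (μ : Fin (d + 1)) (p : Phase d) :
    pdxi μ (Gq g) p = ∑ β, ginv g p.1 μ β * p.2 β + ∑ α, ginv g p.1 α μ * p.2 α := by
  rw [Gq_eq, pdxi_sum_mul (ι := Fin (d + 1) × Fin (d + 1)) (c := fun i y => ginv g y i.1 i.2)
    (a := fun i ζ => ζ i.1 * ζ i.2) _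
    (fun i => (contDiff_ginv hg i.1 i.2).differentiableAt_top _) (fun i => by fun_prop)]
  simp only [fun i : Fin (d + 1) × Fin (d + 1) => pd_mul (differentiableAt_coord i.1 p.2)
    (differentiableAt_coord i.2 p.2) μ, pd_coord, Fintype.sum_prod_type, mul_add,
    Finset.sum_add_distrib]
  congr 1
  · rw [Finset.sum_comm]; simp
  · simp

/-- The Poisson bracket of the metric with a field times a multiplier symbol. -/
lemma pbracket_Gq (hg : IsMetricOn g Set.univ) {X : Fin (d + 1) → Vec d → ℝ}
    (hX : ∀ ρ, ContDiff ℝ ∞ (X ρ)) {m : Vec d → ℝ} (hm : Homog0 m) {x ξ : Vec d} (hξ : ξ ≠ 0) :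
    - pbracket (Gq g) (fun q => (∑ ρ, X ρ q.1 * q.2 ρ) * m q.2) (x, ξ) =
      ∑ ρ, ∑ α, ∑ β, (- (pd α (X ρ) x * ginv g x α β * m ξ * ξ β * ξ ρ) +
        X ρ x * pd ρ (fun y => ginv g y α β) x * m ξ * ξ β * ξ α -
        ginv g x α β * pd β (X ρ) x * m ξ * ξ ρ * ξ α +
        ∑ k, X ρ x * pd k (fun y => ginv g y α β) x * (ξ α * pd k m ξ) * ξ ρ * ξ β) := by
  have hmd := hm.differentiableAt hξ
  have e0 : (fun q : Phase d => (∑ ρ, X ρ q.1 * q.2 ρ) * m q.2) =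
      fun q => ∑ ρ, X ρ q.1 * (q.2 ρ * m q.2) := by
    ext q; simp only [Finset.sum_mul, mul_assoc]
  have hc := fun ρ => (hX ρ).differentiableAt_top x
  have ha : ∀ ρ, DifferentiableAt ℝ (fun ζ : Vec d => ζ ρ * m ζ) ξ := fun ρ =>
    (differentiableAt_coord ρ ξ).fun_mul hmd
  have e1 : ∀ μ, pdx μ (fun q : Phase d => ∑ ρ, X ρ q.1 * (q.2 ρ * m q.2)) (x, ξ) =
      ∑ ρ, pd μ (X ρ) x * (ξ ρ * m ξ) := fun μ =>
    pdx_sum_mul (p := (x, ξ)) (a := fun ρ ζ => ζ ρ * m ζ) _ hc ha μ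
  have e2 : ∀ μ, pdxi μ (fun q : Phase d => ∑ ρ, X ρ q.1 * (q.2 ρ * m q.2)) (x, ξ) =
      X μ x * m ξ + ∑ ρ, X ρ x * (ξ ρ * pd μ m ξ) := by
    intro μ
    rw [pdxi_sum_mul (p := (x, ξ)) (a := fun ρ ζ => ζ ρ * m ζ) _ hc ha μ]
    simp only [fun ρ => pd_mul (differentiableAt_coord ρ ξ) hmd μ, pd_coord, mul_add,
      Finset.sum_add_distrib]
    congr 1
    simp
  simp only [e0, pbracket, e1, e2, pdx_Gq hg, pdxi_Gq hg, Finset.sum_add_distrib,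
    Finset.sum_sub_distrib, Finset.sum_neg_distrib, add_mul, mul_add]
  have s1 : ∑ μ, (∑ β, ginv g x μ β * ξ β) * ∑ ρ, pd μ (X ρ) x * (ξ ρ * m ξ) =
      ∑ ρ, ∑ α, ∑ β, pd α (X ρ) x * ginv g x α β * m ξ * ξ β * ξ ρ := by
    rw [Finset.sum_comm]
    refine Finset.sum_congr rfl fun α _ => ?_
    rw [Finset.sum_mul_sum, Finset.sum_comm]
    exact Finset.sum_congr rfl fun ρ _ => Finset.sum_congr rfl fun β _ => by ring
  have s2 : ∑ μ, (∑ α, ginv g x α μ * ξ α) * ∑ ρ, pd μ (X ρ) x * (ξ ρ * m ξ) =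
      ∑ ρ, ∑ α, ∑ β, ginv g x α β * pd β (X ρ) x * m ξ * ξ ρ * ξ α := by
    simp only [fun ρ : Fin (d + 1) => Finset.sum_comm (s := Finset.univ (α := Fin (d + 1)))
      (t := Finset.univ (α := Fin (d + 1)))
      (f := fun α β => ginv g x α β * pd β (X ρ) x * m ξ * ξ ρ * ξ α)]
    rw [Finset.sum_comm]
    refine Finset.sum_congr rfl fun α _ => ?_
    rw [Finset.sum_mul_sum, Finset.sum_comm]
    exact Finset.sum_congr rfl fun ρ _ => Finset.sum_congr rfl fun β _ => by ring
  have s3 : ∑ μ, (∑ α, ∑ β, pd μ (fun y => ginv g y α β) x * (ξ α * ξ β)) * (X μ x * m ξ) =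
      ∑ ρ, ∑ α, ∑ β, X ρ x * pd ρ (fun y => ginv g y α β) x * m ξ * ξ β * ξ α := by
    simp only [Finset.sum_mul]
    exact Finset.sum_congr rfl fun ρ _ => Finset.sum_congr rfl fun α _ =>
      Finset.sum_congr rfl fun β _ => by ring
  have s4 : ∑ μ, (∑ α, ∑ β, pd μ (fun y => ginv g y α β) x * (ξ α * ξ β)) *
      ∑ ρ, X ρ x * (ξ ρ * pd μ m ξ) = ∑ ρ, ∑ α, ∑ β, ∑ k,
        X ρ x * pd k (fun y => ginv g y α β) x * (ξ α * pd k m ξ) * ξ ρ * ξ β := by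
    simp only [Finset.mul_sum, Finset.sum_mul]
    rw [Finset.sum_comm]
    refine Finset.sum_congr rfl fun ρ _ => ?_
    rw [Finset.sum_comm]
    refine Finset.sum_congr rfl fun α _ => ?_
    rw [Finset.sum_comm]
    exact Finset.sum_congr rfl fun β _ => Finset.sum_congr rfl fun k _ => by ring
  rw [s1, s2, s3, s4]
  ring

end PhaseSpace

section Assembly

variable {d : ℕ} {g : Met d} {K : Set (Vec d)} {m : Vec d → ℝ} {ν : SignedMeasure (Phase d)}

lemma pairG_mul_Tm (hg : IsMetricOn g Set.univ) {F u v : Vec d → ℝ} (hF : ContDiff ℝ ∞ F)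
    (hu : IsTest u) (hm : IsSym m) (hv : IsTest v) :
    pairG g (fun x => (u x : ℂ)) (fun x => (F x : ℂ) * Tm m (fun y => (v y : ℂ)) x) =
      mulForm (fun x => volDen g x * F x * u x) m v := by
  rw [← integral_mul_Tm (hu.mul_left ((contDiff_volDen hg).mul hF)) hm hv, pairG]
  congr 1; ext x
  simp only [Complex.conj_ofReal, volDen]
  push_cast; ring

lemma pairG_sum_mul_pd_Tm (hg : IsMetricOn g Set.univ) {X : Fin (d + 1) → Vec d → ℝ}
    (hX : ∀ ρ, ContDiff ℝ ∞ (X ρ)) {u v : Vec d → ℝ} (hu : IsTest u) (hm : IsSym m)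
    (hv : IsTest v) :
    pairG g (fun x => (u x : ℂ))
        (fun x => ∑ ρ, (X ρ x : ℂ) * pd ρ (Tm m (fun y => (v y : ℂ))) x) =
      ∑ ρ, mulForm (fun x => volDen g x * X ρ x * u x) m (pd ρ v) := by
  have hT : ∀ ρ, IsTest (fun x => volDen g x * X ρ x * u x) := fun ρ =>
    hu.mul_left ((contDiff_volDen hg).mul (hX ρ))
  simp only [fun ρ => (integral_mul_Tm (hT ρ) hm (hv.pd ρ)).symm, pd_Tm hm hv]
  rw [← integral_finsetSum, pairG]
  · congr 1; ext x
    simp only [Complex.conj_ofReal, volDen, Finset.mul_sum, Finset.sum_mul]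
    refine Finset.sum_congr rfl fun ρ _ => ?_
    push_cast; ring
  · intro ρ _
    refine Continuous.integrable_of_hasCompactSupport
      ((hT ρ).contDiff_complex.continuous.mul (continuous_Tm hm (hv.pd ρ))) ?_
    exact (hT ρ).hasCompactSupport_complex.mul_right

lemma abs_le_one_of_mem_usphere {ξ : Vec d} (hξ : ξ ∈ usphere d) (α : Fin (d + 1)) :
    |ξ α| ≤ 1 := by
  rw [← sq_le_one_iff_abs_le_one]
  exact (Finset.single_le_sum (fun β _ => sq_nonneg (ξ β)) (Finset.mem_univ α)).trans_eq hξ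

lemma ne_zero_of_mem_usphere {ξ : Vec d} (hξ : ξ ∈ usphere d) : ξ ≠ 0 := by
  rintro rfl
  simp [usphere] at hξ

lemma ConcentratedOn.sIntegrable_symbol {S : Set (Phase d)} (hS : ConcentratedOn ν S)
    (hS' : ∀ p ∈ S, p.2 ∈ usphere d) {F : Vec d → ℝ} (hF : Continuous F) {B : ℝ}
    (hB : ∀ p ∈ S, |F p.1| ≤ B) (hm : IsSym m) (α β : Fin (d + 1)) :
    SIntegrable ν (fun p => F p.1 * m p.2 * p.2 α * p.2 β) := by
  obtain ⟨hm1, C, hC⟩ := hm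
  refine hS.sIntegrable (C := B * C * 1 * 1) ?_ fun p hp => ?_
  · have := hF.measurable
    fun_prop
  · have hB0 := (abs_nonneg _).trans (hB p hp)
    have hC0 := (abs_nonneg _).trans (hC 0)
    simp only [abs_mul]
    gcongr
    exacts [hB p hp, hC _, abs_le_one_of_mem_usphere (hS' p hp) α,
      abs_le_one_of_mem_usphere (hS' p hp) β]

/-- A cross defect measure of sequences vanishing off `K` is concentrated over `K`. -/
lemma concentratedOn_of_tendsto (hν : ConcentratedOn ν {p : Phase d | p.2 ∈ usphere d})
    (hK : IsClosed K) {φ ψ : ℕ → Vec d → ℝ} (hφ : ∀ n, ∀ x ∉ K, φ n x = 0)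
    (hconv : ∀ f : Vec d → ℝ, ContDiff ℝ ∞ f → HasCompactSupport f →
      ∀ m : Vec d → ℝ, Homog0 m → ∀ α β : Fin (d + 1),
      Tendsto (fun n => pairG g (fun x => ((pd α (φ n) x : ℝ) : ℂ))
          (fun x => ((f x : ℝ) : ℂ) * Tm m (fun y => ((pd β (ψ n) y : ℝ) : ℂ)) x))
        atTop (𝓝 ((sInt ν (fun p => f p.1 * m p.2 * p.2 α * p.2 β) : ℝ) : ℂ))) :
    ConcentratedOn ν {p : Phase d | p.1 ∈ K} := by
  refine concentratedOn_of_forall_sInt_eq_zero hν hK fun f hf hfK m hm => ?_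
  have h0 : ∀ α, sInt ν (fun p => f p.1 * m p.2 * p.2 α * p.2 α) = 0 := by
    intro α
    have h1 := hconv f hf.1 hf.2 m hm α α
    have h2 : ∀ n, pairG g (fun x => ((pd α (φ n) x : ℝ) : ℂ))
        (fun x => ((f x : ℝ) : ℂ) * Tm m (fun y => ((pd α (ψ n) y : ℝ) : ℂ)) x) = 0 := by
      intro n
      rw [pairG]
      refine integral_eq_zero_of_ae (ae_of_all _ fun x => ?_)
      by_cases hx : x ∈ K
      · simp [hfK x hx]
      · simp [pd_eq_zero_of_notMem hK (hφ n) hx]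
    simp only [h2] at h1
    exact_mod_cast (tendsto_nhds_unique h1 tendsto_const_nhds)
  obtain ⟨B, hB⟩ := hf.2.exists_bound_of_continuous hf.continuous
  have hi : ∀ α, SIntegrable ν (fun p => f p.1 * m p.2 * p.2 α * p.2 α) := fun α =>
    hν.sIntegrable_symbol (fun p hp => hp) hf.continuous (fun p _ => hB p.1) hm.isSym α α
  have h3 := sInt_sum Finset.univ hi
  simp only [h0, Finset.sum_const_zero] at h3
  rw [← h3]
  refine hν.sInt_congr fun p hp => ?_
  have hp' : ∑ α, p.2 α ^ 2 = 1 := hp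
  simp only [mul_assoc, ← Finset.mul_sum, ← sq, hp', mul_one]

lemma tendsto_derivForm (hg : IsMetricOn g Set.univ) (hK : IsCompact K)
    (hν : ConcentratedOn ν {p : Phase d | p.1 ∈ K}) {φ ψ : ℕ → Vec d → ℝ}
    (hφ : ∀ n, IsTest (φ n)) (hφK : ∀ n, ∀ x ∉ K, φ n x = 0) (hψ : ∀ n, IsTest (ψ n))
    (hconv : ∀ f : Vec d → ℝ, ContDiff ℝ ∞ f → HasCompactSupport f →
      ∀ m : Vec d → ℝ, Homog0 m → ∀ α β : Fin (d + 1),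
      Tendsto (fun n => pairG g (fun x => ((pd α (φ n) x : ℝ) : ℂ))
          (fun x => ((f x : ℝ) : ℂ) * Tm m (fun y => ((pd β (ψ n) y : ℝ) : ℂ)) x))
        atTop (𝓝 ((sInt ν (fun p => f p.1 * m p.2 * p.2 α * p.2 β) : ℝ) : ℂ)))
    {F : Vec d → ℝ} (hF : ContDiff ℝ ∞ F) (hm : Homog0 m) (α β : Fin (d + 1)) :
    Tendsto (fun n => derivForm g F m α β (φ n) (ψ n)) atTop
      (𝓝 ((sInt ν (fun p => F p.1 * m p.2 * p.2 α * p.2 β) : ℝ) : ℂ)) := by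
  obtain ⟨h, hh, hhF⟩ := exists_isTest_eq_on hK hF
  have e : sInt ν (fun p => F p.1 * m p.2 * p.2 α * p.2 β) =
      sInt ν (fun p => h p.1 * m p.2 * p.2 α * p.2 β) :=
    hν.sInt_congr fun p hp => by rw [(hhF p.1 hp).1]
  rw [e]
  refine (hconv h hh.1 hh.2 m hm α β).congr fun n => ?_
  rw [pairG_mul_Tm hg hh.1 ((hφ n).pd α) hm.isSym ((hψ n).pd β), derivForm]
  congr 1; ext x
  by_cases hx : x ∈ K
  · rw [(hhF x hx).1]
  · rw [pd_eq_zero_of_notMem hK.isClosed (hφK n) hx, mul_zero, mul_zero]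

lemma neg_sInt_pbracket (hg : IsMetricOn g Set.univ) (hK : IsCompact K)
    (hν : ConcentratedOn ν ({p : Phase d | p.2 ∈ usphere d} ∩ {p : Phase d | p.1 ∈ K}))
    {X : Fin (d + 1) → Vec d → ℝ} (hX : ∀ ρ, ContDiff ℝ ∞ (X ρ)) (hm : Homog0 m) :
    - sInt ν (pbracket (Gq g) (fun p => (∑ ρ, X ρ p.1 * p.2 ρ) * m p.2)) =
      ∑ ρ, ∑ α, ∑ β,
        (- sInt ν (fun p => pd α (X ρ) p.1 * ginv g p.1 α β * m p.2 * p.2 β * p.2 ρ) +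
        sInt ν (fun p => X ρ p.1 * pd ρ (fun y => ginv g y α β) p.1 * m p.2 * p.2 β * p.2 α) -
        sInt ν (fun p => ginv g p.1 α β * pd β (X ρ) p.1 * m p.2 * p.2 ρ * p.2 α) +
        ∑ k, sInt ν (fun p => X ρ p.1 * pd k (fun y => ginv g y α β) p.1 *
          (p.2 α * pd k m p.2) * p.2 ρ * p.2 β)) := by
  have hG := contDiff_ginv hg
  have hi : ∀ {F m' : Vec d → ℝ}, ContDiff ℝ ∞ F → Homog0 m' → ∀ α β,
      SIntegrable ν (fun p => F p.1 * m' p.2 * p.2 α * p.2 β) := by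
    intro F m' hF hm' α β
    obtain ⟨B, hB⟩ := hK.exists_bound_of_continuousOn hF.continuous.continuousOn
    exact hν.sIntegrable_symbol (fun p hp => hp.1) hF.continuous (fun p hp => hB p.1 hp.2)
      hm'.isSym α β
  have i1 := fun ρ α β => hi ((contDiff_pd (hX ρ) α).mul (hG α β)) hm β ρ
  have i2 := fun ρ α β => hi ((hX ρ).mul (contDiff_pd (hG α β) ρ)) hm β α
  have i3 := fun ρ α β => hi ((hG α β).mul (contDiff_pd (hX ρ) β)) hm ρ α
  have i4 := fun ρ α β k => hi ((hX ρ).mul (contDiff_pd (hG α β) k)) (hm.mul_pd α k) ρ β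
  have i4' := fun ρ α β => SIntegrable.sum Finset.univ (i4 ρ α β)
  have i12 := fun ρ α β => (i1 ρ α β).neg.add (i2 ρ α β)
  have i123 := fun ρ α β => (i12 ρ α β).sub (i3 ρ α β)
  have it := fun ρ α β => (i123 ρ α β).add (i4' ρ α β)
  have it2 := fun ρ α => SIntegrable.sum Finset.univ (it ρ α)
  rw [← sInt_neg, hν.sInt_congr (fun p hp =>
    pbracket_Gq hg hX hm (x := p.1) (ξ := p.2) (ne_zero_of_mem_usphere hp.1)),
    sInt_sum _ fun ρ => SIntegrable.sum Finset.univ (it2 ρ)]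
  refine Finset.sum_congr rfl fun ρ _ => ?_
  rw [sInt_sum _ (it2 ρ)]
  refine Finset.sum_congr rfl fun α _ => ?_
  rw [sInt_sum _ (it ρ α)]
  refine Finset.sum_congr rfl fun β _ => ?_
  rw [sInt_add (i123 ρ α β) (i4' ρ α β), sInt_sub (i12 ρ α β) (i3 ρ α β),
    sInt_add (i1 ρ α β).neg (i2 ρ α β), sInt_neg, sInt_sum _ (i4 ρ α β)]

end Assembly

end PropagationIdentity

/-- Propagation identity for cross microlocal defect measures of wave equations. -/
theorem stmt5
    (d : ℕ) (hd : 3 ≤ d)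
    (g0 : Met d) (hg0 : IsMetricOn g0 Set.univ)
    (hg0b : ∀ (α β : Fin (d + 1)) (k : ℕ), ∃ C : ℝ, ∀ x,
      ‖iteratedFDeriv ℝ k (fun y => g0 y α β) x‖ ≤ C)
    (hg0ib : ∀ (α β : Fin (d + 1)) (k : ℕ), ∃ C : ℝ, ∀ x,
      ‖iteratedFDeriv ℝ k (fun y => ginv g0 y α β) x‖ ≤ C)
    (hg0n : ∀ x, ∀ α β : Fin (d + 1), |g0 x α β - mink d α β| ≤ ((10 : ℝ) ^ (100 : ℕ))⁻¹ ∧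
      |ginv g0 x α β - mink d α β| ≤ ((10 : ℝ) ^ (100 : ℕ))⁻¹)
    -- the sequences
    (φ ψ : ℕ → Vec d → ℝ)
    (hφs : ∀ n, ContDiff ℝ (⊤ : ℕ∞) (φ n)) (hψs : ∀ n, ContDiff ℝ (⊤ : ℕ∞) (ψ n))
    (hsupp : ∃ K : Set (Vec d), IsCompact K ∧ ∀ n, tsupport (φ n) ⊆ K ∧ tsupport (ψ n) ⊆ K)
    (hbdd : ∃ C : ℝ, ∀ n,
      (eLpNorm (φ n) 2 volume).toReal + (∑ α, (eLpNorm (pd α (φ n)) 2 volume).toReal) +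
      (eLpNorm (ψ n) 2 volume).toReal + (∑ α, (eLpNorm (pd α (ψ n)) 2 volume).toReal) +
      (eLpNorm (BoxOp g0 (φ n)) 2 volume).toReal +
      (eLpNorm (BoxOp g0 (ψ n)) 2 volume).toReal ≤ C)
    (hφ0 : Tendsto (fun n => eLpNorm (φ n) 2 volume) atTop (𝓝 0))
    (hψ0 : Tendsto (fun n => eLpNorm (ψ n) 2 volume) atTop (𝓝 0))
    -- the cross microlocal defect measure
    (ν : MeasureTheory.SignedMeasure (Phase d))
    (hν : ∀ s : Set (Phase d), MeasurableSet s →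
      s ∩ {p : Phase d | p.2 ∈ usphere d} = ∅ → ν s = 0)
    (hconv : ∀ f : Vec d → ℝ, ContDiff ℝ (⊤ : ℕ∞) f → HasCompactSupport f →
      ∀ m : Vec d → ℝ, Homog0 m → ∀ α β : Fin (d + 1),
      Tendsto (fun n => pairG g0 (fun x => ((pd α (φ n) x : ℝ) : ℂ))
          (fun x => ((f x : ℝ) : ℂ) * Tm m (fun y => ((pd β (ψ n) y : ℝ) : ℂ)) x))
        atTop (𝓝 ((sInt ν (fun p => f p.1 * m p.2 * p.2 α * p.2 β) : ℝ) : ℂ))) :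
    ∀ m : Vec d → ℝ, Homog0 m →
    ∀ Xv : Fin (d + 1) → Vec d → ℝ, (∀ ρ, ContDiff ℝ (⊤ : ℕ∞) (Xv ρ)) →
    Tendsto (fun n => (1 / 2 : ℂ) *
        (pairG g0 (fun x => ((BoxOp g0 (φ n) x : ℝ) : ℂ))
            (fun x => ∑ ρ, ((Xv ρ x : ℝ) : ℂ) *
              pd ρ (Tm m (fun y => ((ψ n y : ℝ) : ℂ))) x) +
         pairG g0 (fun x => ((∑ ρ, Xv ρ x * pd ρ (φ n) x : ℝ) : ℂ))
            (Tm m (fun y => ((BoxOp g0 (ψ n) y : ℝ) : ℂ)))))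
      atTop
      (𝓝 ((-(1 / 2) *
        sInt ν (pbracket (Gq g0) (fun p => (∑ ρ, Xv ρ p.1 * p.2 ρ) * m p.2)) : ℝ) : ℂ)) := by
  intro m hm X hX
  obtain ⟨K, hK, hsupp⟩ := hsupp
  obtain ⟨C, hC⟩ := hbdd
  have hφK : ∀ n, ∀ x ∉ K, φ n x = 0 := fun n x hx =>
    image_eq_zero_of_notMem_tsupport fun h => hx ((hsupp n).1 h)
  have hψK : ∀ n, ∀ x ∉ K, ψ n x = 0 := fun n x hx =>
    image_eq_zero_of_notMem_tsupport fun h => hx ((hsupp n).2 h)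
  have hφ : ∀ n, IsTest (φ n) := fun n =>
    ⟨hφs n, hK.of_isClosed_subset (isClosed_tsupport _) (hsupp n).1⟩
  have hψ : ∀ n, IsTest (ψ n) := fun n =>
    ⟨hψs n, hK.of_isClosed_subset (isClosed_tsupport _) (hsupp n).2⟩
  have hle : ∀ n, (∀ α, (eLpNorm (pd α (φ n)) 2 volume).toReal ≤ C) ∧
      (eLpNorm (BoxOp g0 (φ n)) 2 volume).toReal ≤ C := by
    intro n
    have h0 : ∀ f : Vec d → ℝ, 0 ≤ (eLpNorm f 2 volume).toReal := fun f => ENNReal.toReal_nonneg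
    have h1 : ∀ u : Vec d → ℝ, 0 ≤ ∑ α, (eLpNorm (pd α u) 2 volume).toReal := fun u =>
      Finset.sum_nonneg fun α _ => h0 _
    have h2 := hC n
    refine ⟨fun α => ?_, ?_⟩
    · have h3 := Finset.single_le_sum (f := fun α => (eLpNorm (pd α (φ n)) 2 volume).toReal)
        (fun β _ => h0 _) (Finset.mem_univ α)
      linarith [h0 (φ n), h0 (ψ n), h1 (ψ n), h0 (BoxOp g0 (φ n)), h0 (BoxOp g0 (ψ n))]
    · linarith [h0 (φ n), h0 (ψ n), h1 (ψ n), h1 (φ n), h0 (BoxOp g0 (ψ n))]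
  have hdφ : ∀ α, L2Bounded K (fun n => pd α (φ n)) := fun α =>
    ⟨fun n => (hφ n).pd α, fun n x hx => pd_eq_zero_of_notMem hK.isClosed (hφK n) hx α, C ^ 2,
      fun n => by
        rw [((hφ n).pd α).integral_sq_eq]
        exact pow_le_pow_left₀ ENNReal.toReal_nonneg ((hle n).1 α) 2⟩
  have hPφ : L2Bounded K (fun n => BoxOp g0 (φ n)) :=
    ⟨fun n => (hφ n).boxOp hg0, fun n x hx => boxOp_eq_zero_of_notMem hK.isClosed (hφK n) hx,
      C ^ 2, fun n => by
        rw [((hφ n).boxOp hg0).integral_sq_eq]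
        exact pow_le_pow_left₀ ENNReal.toReal_nonneg (hle n).2 2⟩
  have hψ2 : L2Null K ψ := by
    refine ⟨hψ, hψK, ?_⟩
    simp only [fun n => (hψ n).integral_sq_eq]
    simpa using ((ENNReal.tendsto_toReal ENNReal.zero_ne_top).comp hψ0).pow 2
  have hν1 := concentratedOn_of_null measurableSet_usphere hν
  have hν2 := concentratedOn_of_tendsto hν1 hK.isClosed hφK hconv
  have hl := fun F (hF : ContDiff ℝ (⊤ : ℕ∞) F) m hm α β =>
    tendsto_derivForm (m := m) hg0 hK hν2 hφ hφK hψ hconv hF hm α β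
  have hsum := tendsto_finsetSum Finset.univ fun ρ _ =>
    tendsto_mulForm_boxOp hg0 hK (hX ρ) hm hφ hdφ hPφ hψ2
      (l := fun F m α β => ((sInt ν (fun p => F p.1 * m p.2 * p.2 α * p.2 β) : ℝ) : ℂ)) hl ρ
  have hval := congrArg (fun r : ℝ => (1 / 2 : ℂ) * (r : ℂ))
    (neg_sInt_pbracket hg0 hK (hν1.inter hν2) hX hm)
  convert hsum.const_mul (1 / 2 : ℂ) using 1
  · ext n
    have hT : ∀ ρ, IsTest (fun x => X ρ x * pd ρ (φ n) x) := fun ρ =>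
      ((hφ n).pd ρ).mul_left (hX ρ)
    have hT' : ∀ ρ, IsTest (fun x => volDen g0 x * (X ρ x * pd ρ (φ n) x)) := fun ρ =>
      (hT ρ).mul_left (contDiff_volDen hg0)
    rw [pairG_sum_mul_pd_Tm hg0 hX ((hφ n).boxOp hg0) hm.isSym (hψ n),
      pairG_eq_mulForm hg0 (isTest_sum _ fun ρ _ => hT ρ) hm.isSym ((hψ n).boxOp hg0),
      Finset.sum_add_distrib]
    simp only [Finset.mul_sum Finset.univ _ (volDen g0 _)]
    rw [mulForm_sum_left _ hT' hm.isSym ((hψ n).boxOp hg0)]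
    simp only [mul_assoc]
  · congr 1
    push_cast at hval ⊢
    rw [← hval]
    ring

end
end

section
/- Linear structure of the quadratic form B: let d ≥ 1, λ ∈ (0,1], V ⊆ ℝ^(d+1) open, and let g_0, g_λ be metrics on V with h := g_λ − g_0. Suppose C1 ≥ 1 and that, pointwise on V: |(g_0)_αβ|, |g_0^αβ|, |∂g_0|, |∂²g_0| ≤ C1; |(g_λ)_αβ|, |g_λ^αβ|, |∂g_λ| ≤ C1; and |h_αβ| ≤ C1 λ for all indices. Then there exists C2 depending only on C1 and d such that pointwise on V, for all μ, ν: |B_μν(g_λ)(∂g_λ, ∂g_λ) − B_μν(g_0)(∂g_0, ∂g_0) − L_μν(g_0)(∂h) − B_μν(g_0)(∂h, ∂h)| ≤ C2 λ. -/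
noncomputable section

open MeasureTheory Filter Topology
open scoped ENNReal NNReal

/-- The double contraction `G^{αβ} G^{σρ} f_{αβσρ}`. -/
def contract₂ {n : ℕ} (G : Matrix (Fin n) (Fin n) ℝ)
    (f : Fin n → Fin n → Fin n → Fin n → ℝ) : ℝ :=
  ∑ α, ∑ β, ∑ σ, ∑ ρ, G α β * G σ ρ * f α β σ ρ

lemma sum_swap_pairs {ι : Type*} [Fintype ι] (F : ι → ι → ι → ι → ℝ) :
    ∑ α, ∑ β, ∑ σ, ∑ ρ, F α β σ ρ = ∑ σ, ∑ ρ, ∑ α, ∑ β, F α β σ ρ := by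
  calc ∑ α, ∑ β, ∑ σ, ∑ ρ, F α β σ ρ
      = ∑ p : ι × ι, ∑ q : ι × ι, F p.1 p.2 q.1 q.2 := by simp only [Fintype.sum_prod_type]
    _ = ∑ q : ι × ι, ∑ p : ι × ι, F p.1 p.2 q.1 q.2 := Finset.sum_comm
    _ = ∑ σ, ∑ ρ, ∑ α, ∑ β, F α β σ ρ := by simp only [Fintype.sum_prod_type]

lemma abs_sum_fin_le {n : ℕ} {u : Fin n → ℝ} {M : ℝ} (hu : ∀ i, |u i| ≤ M) :
    |∑ i, u i| ≤ n * M := by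
  simpa using (Finset.abs_sum_le_sum_abs u Finset.univ).trans
    (Finset.sum_le_card_nsmul _ _ M fun i _ => hu i)

section Contraction

variable {n : ℕ} (G : Matrix (Fin n) (Fin n) ℝ) (f g : Fin n → Fin n → Fin n → Fin n → ℝ)

lemma contract₂_add :
    contract₂ G (fun α β σ ρ => f α β σ ρ + g α β σ ρ) = contract₂ G f + contract₂ G g := by
  simp only [contract₂, mul_add, Finset.sum_add_distrib]

lemma contract₂_sub :
    contract₂ G (fun α β σ ρ => f α β σ ρ - g α β σ ρ) = contract₂ G f - contract₂ G g := by
  simp only [contract₂, mul_sub, Finset.sum_sub_distrib]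

lemma contract₂_const_mul (c : ℝ) :
    contract₂ G (fun α β σ ρ => c * f α β σ ρ) = c * contract₂ G f := by
  simp only [contract₂, mul_left_comm _ c, ← Finset.mul_sum]

lemma contract₂_swap_pairs :
    contract₂ G (fun α β σ ρ => f σ ρ α β) = contract₂ G f := by
  simp only [contract₂]
  rw [sum_swap_pairs]
  refine Finset.sum_congr rfl fun σ _ => Finset.sum_congr rfl fun ρ _ =>
    Finset.sum_congr rfl fun α _ => Finset.sum_congr rfl fun β _ => ?_
  rw [mul_comm (G α β)]

variable {G} in
lemma contract₂_transpose (hG : G.IsSymm) :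
    contract₂ G (fun α β σ ρ => f β α ρ σ) = contract₂ G f := by
  unfold contract₂
  rw [Finset.sum_comm]
  refine Finset.sum_congr rfl fun β _ => Finset.sum_congr rfl fun α _ => ?_
  rw [Finset.sum_comm]
  refine Finset.sum_congr rfl fun σ _ => Finset.sum_congr rfl fun ρ _ => ?_
  rw [hG.apply β α, hG.apply σ ρ]

end Contraction

/-- The integrand of `B_{μν}` as a bilinear expression in two arrays `P_{γαβ}`, `Q_{γαβ}`. -/
def bilinB {n : ℕ} (P Q : Fin n → Fin n → Fin n → ℝ) (μ ν α β σ ρ : Fin n) : ℝ :=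
  (P μ β ρ * Q σ ν α + P ν β ρ * Q σ μ α) -
    (1 / 4) * (P μ β ρ * Q ν α σ + P ν β ρ * Q μ α σ) +
    P σ ν α * Q ρ μ β - P α ν σ * Q ρ μ β

/-- The integrand of `L_{μν}` as a bilinear expression in two arrays. -/
def bilinL {n : ℕ} (P Q : Fin n → Fin n → Fin n → ℝ) (μ ν α β σ ρ : Fin n) : ℝ :=
  ((P ρ μ β + P μ ρ β - P β ρ μ) * Q σ ν α + (P ρ ν β + P ν ρ β - P β ρ ν) * Q σ μ α) +
    (1 / 2) * ((2 * P ρ β μ - P μ β ρ) * Q ν α σ + (2 * P ρ β ν - P ν β ρ) * Q μ α σ)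

lemma contract₂_bilinB_cross {n : ℕ} {G : Matrix (Fin n) (Fin n) ℝ} (hG : G.IsSymm)
    {P : Fin n → Fin n → Fin n → ℝ} (hP : ∀ γ α β, P γ α β = P γ β α)
    (Q : Fin n → Fin n → Fin n → ℝ) (μ ν : Fin n) :
    contract₂ G (bilinB P Q μ ν) + contract₂ G (bilinB Q P μ ν) =
      contract₂ G (bilinL P Q μ ν) := by
  have key : ∀ α β σ ρ, bilinB P Q μ ν α β σ ρ + bilinB Q P μ ν α β σ ρ -
      bilinL P Q μ ν α β σ ρ =
      (Q μ β ρ * P σ ν α - Q μ α σ * P ρ ν β) + (Q ν β ρ * P σ μ α - Q ν α σ * P ρ μ β)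
      - (1 / 4) * ((Q μ β ρ * P ν α σ - Q μ α σ * P ν β ρ) +
          (Q ν β ρ * P μ α σ - Q ν α σ * P μ β ρ))
      + (P σ ν α * Q ρ μ β - P ρ ν β * Q σ μ α)
      - (P α ν σ * Q ρ μ β - P β ν ρ * Q σ μ α)
      - (Q α ν σ * P ρ μ β - Q σ ν α * P β μ ρ) := by
    intro α β σ ρ
    simp only [bilinB, bilinL]
    rw [hP μ ρ β, hP ν ρ β, hP ρ β μ, hP ρ β ν, hP β ρ μ, hP β ρ ν]
    ring
  rw [← sub_eq_zero, ← contract₂_add, ← contract₂_sub]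
  simp only [key, contract₂_add, contract₂_sub, contract₂_const_mul]
  have t1 := contract₂_transpose (fun α β σ ρ => Q μ α σ * P ρ ν β) hG
  have t2 := contract₂_transpose (fun α β σ ρ => Q ν α σ * P ρ μ β) hG
  have t3 := contract₂_transpose (fun α β σ ρ => Q μ α σ * P ν β ρ) hG
  have t4 := contract₂_transpose (fun α β σ ρ => Q ν α σ * P μ β ρ) hG
  have t5 := contract₂_transpose (fun α β σ ρ => P ρ ν β * Q σ μ α) hG
  have t6 := contract₂_transpose (fun α β σ ρ => P β ν ρ * Q σ μ α) hG
  have t7 := contract₂_swap_pairs G (fun α β σ ρ => Q σ ν α * P β μ ρ)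
  linarith

lemma bilinB_add_add {n : ℕ} (P Q : Fin n → Fin n → Fin n → ℝ) (μ ν α β σ ρ : Fin n) :
    bilinB (P + Q) (P + Q) μ ν α β σ ρ = bilinB P P μ ν α β σ ρ +
      (bilinB P Q μ ν α β σ ρ + bilinB Q P μ ν α β σ ρ) + bilinB Q Q μ ν α β σ ρ := by
  simp only [bilinB, Pi.add_apply]
  ring

lemma abs_bilinB_self_le {n : ℕ} {P : Fin n → Fin n → Fin n → ℝ} {C : ℝ}
    (hP : ∀ γ α β, |P γ α β| ≤ C) (μ ν α β σ ρ : Fin n) :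
    |bilinB P P μ ν α β σ ρ| ≤ 5 * C ^ 2 := by
  have hmul : ∀ a b c a' b' c', |P a b c * P a' b' c'| ≤ C ^ 2 := fun a b c a' b' c' => by
    rw [abs_mul, sq]
    exact mul_le_mul (hP a b c) (hP a' b' c') (abs_nonneg _) ((abs_nonneg _).trans (hP a b c))
  have h1 := abs_le.1 (hmul μ β ρ σ ν α)
  have h2 := abs_le.1 (hmul ν β ρ σ μ α)
  have h3 := abs_le.1 (hmul μ β ρ ν α σ)
  have h4 := abs_le.1 (hmul ν β ρ μ α σ)
  have h5 := abs_le.1 (hmul σ ν α ρ μ β)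
  have h6 := abs_le.1 (hmul α ν σ ρ μ β)
  have := sq_nonneg C
  unfold bilinB
  rw [abs_le]
  constructor <;> linarith [h1.1, h1.2]

lemma abs_contract₂_sub_le {n : ℕ} {G G' : Matrix (Fin n) (Fin n) ℝ}
    {f : Fin n → Fin n → Fin n → Fin n → ℝ} {C δ K : ℝ}
    (hG : ∀ α β, |G α β| ≤ C) (hG' : ∀ α β, |G' α β| ≤ C) (hδ : ∀ α β, |G α β - G' α β| ≤ δ)
    (hf : ∀ α β σ ρ, |f α β σ ρ| ≤ K) :
    |contract₂ G f - contract₂ G' f| ≤ (n : ℝ) ^ 4 * (2 * C * δ * K) := by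
  have hterm : ∀ α β σ ρ, |G α β * G σ ρ * f α β σ ρ - G' α β * G' σ ρ * f α β σ ρ| ≤
      2 * C * δ * K := by
    intro α β σ ρ
    have hC := (abs_nonneg _).trans (hG α β)
    have hδ0 := (abs_nonneg _).trans (hδ α β)
    have hprod : |G α β * G σ ρ - G' α β * G' σ ρ| ≤ 2 * C * δ := by
      calc |G α β * G σ ρ - G' α β * G' σ ρ|
          = |G α β * (G σ ρ - G' σ ρ) + (G α β - G' α β) * G' σ ρ| := by ring_nf
        _ ≤ |G α β| * |G σ ρ - G' σ ρ| + |G α β - G' α β| * |G' σ ρ| := by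
            rw [← abs_mul, ← abs_mul]; exact abs_add_le _ _
        _ ≤ C * δ + δ * C := by
            gcongr
            exacts [hG _ _, hδ _ _, hδ _ _, hG' _ _]
        _ = 2 * C * δ := by ring
    rw [← sub_mul, abs_mul]
    exact mul_le_mul hprod (hf α β σ ρ) (abs_nonneg _) (by positivity)
  simp only [contract₂, ← Finset.sum_sub_distrib]
  have := abs_sum_fin_le fun α => abs_sum_fin_le fun β => abs_sum_fin_le fun σ => abs_sum_fin_le fun ρ => hterm α β σ ρ
  refine this.trans_eq ?_
  ring

lemma abs_inv_sub_inv_le {n : ℕ} {A B : Matrix (Fin n) (Fin n) ℝ} {C δ : ℝ}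
    (hA : IsUnit A.det) (hB : IsUnit B.det) (hAC : ∀ i j, |A⁻¹ i j| ≤ C)
    (hBC : ∀ i j, |B⁻¹ i j| ≤ C) (hδ : ∀ i j, |A i j - B i j| ≤ δ) (i j : Fin n) :
    |A⁻¹ i j - B⁻¹ i j| ≤ (n : ℝ) ^ 2 * (C * δ * C) := by
  have hC := (abs_nonneg _).trans (hAC i j)
  have hδ0 := (abs_nonneg _).trans (hδ i j)
  have hres : A⁻¹ - B⁻¹ = A⁻¹ * (B - A) * B⁻¹ := by
    rw [Matrix.mul_sub, Matrix.sub_mul, Matrix.mul_assoc, Matrix.mul_nonsing_inv _ hB,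
      Matrix.nonsing_inv_mul _ hA, Matrix.mul_one, Matrix.one_mul]
  rw [← Matrix.sub_apply, hres, Matrix.mul_apply]
  simp only [Matrix.mul_apply, Finset.sum_mul]
  refine (abs_sum_fin_le fun k => abs_sum_fin_le fun l => (?_ : _ ≤ C * δ * C)).trans_eq (by ring)
  rw [abs_mul, abs_mul, Matrix.sub_apply, abs_sub_comm]
  gcongr
  exacts [hAC _ _, hδ _ _, hBC _ _]

/-- The array of first coordinate derivatives `∂_γ p_{αβ}` at a point. -/
def pdArray {d : ℕ} (p : SymMat d) (x : Vec d) (γ α β : Fin (d + 1)) : ℝ :=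
  pd γ (fun y => p y α β) x

lemma Bq_eq_contract₂ {d : ℕ} (g p : SymMat d) (μ ν : Fin (d + 1)) (x : Vec d) :
    Bq g p p μ ν x = contract₂ (ginv g x) (bilinB (pdArray p x) (pdArray p x) μ ν) := rfl

lemma Lq_eq_contract₂ {d : ℕ} (g h : SymMat d) (μ ν : Fin (d + 1)) (x : Vec d) :
    Lq g h μ ν x = contract₂ (ginv g x) (bilinL (pdArray g x) (pdArray h x) μ ν) := by
  have hΓ : 2 * (∑ σ, ∑ ρ, ∑ α, ginv g x σ ρ *
        (GammaMix g ρ α μ x * pd σ (fun y => h y ν α) x +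
         GammaMix g ρ α ν x * pd σ (fun y => h y μ α) x)) =
      ∑ α, ∑ β, ∑ σ, ∑ ρ, ginv g x α β * ginv g x σ ρ *
        (2 * (Christoffel g ρ β μ x * pd σ (fun y => h y ν α) x +
          Christoffel g ρ β ν x * pd σ (fun y => h y μ α) x)) := by
    rw [sum_swap_pairs]
    simp only [GammaMix, Finset.mul_sum, Finset.sum_mul, ← Finset.sum_add_distrib]
    refine Finset.sum_congr rfl fun σ _ => Finset.sum_congr rfl fun ρ _ =>
      Finset.sum_congr rfl fun α _ => Finset.sum_congr rfl fun β _ => ?_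
    ring
  have hD : (1 / 2) * (∑ α, ∑ σ, (Dcoef g μ α σ x * pd ν (fun y => h y α σ) x +
                        Dcoef g ν α σ x * pd μ (fun y => h y α σ) x)) =
      ∑ α, ∑ β, ∑ σ, ∑ ρ, ginv g x α β * ginv g x σ ρ * ((1 / 2) *
        ((2 * pd ρ (fun y => g y β μ) x - pd μ (fun y => g y β ρ) x) *
            pd ν (fun y => h y α σ) x +
          (2 * pd ρ (fun y => g y β ν) x - pd ν (fun y => g y β ρ) x) *
            pd μ (fun y => h y α σ) x)) := by
    simp only [Dcoef, Finset.mul_sum, Finset.sum_mul, ← Finset.sum_add_distrib]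
    refine Finset.sum_congr rfl fun α _ => ?_
    rw [Finset.sum_comm]
    refine Finset.sum_congr rfl fun β _ => Finset.sum_congr rfl fun σ _ =>
      Finset.sum_congr rfl fun ρ _ => ?_
    ring
  rw [Lq, hΓ, hD]
  simp only [contract₂, ← Finset.sum_add_distrib]
  refine Finset.sum_congr rfl fun α _ => Finset.sum_congr rfl fun β _ =>
    Finset.sum_congr rfl fun σ _ => Finset.sum_congr rfl fun ρ _ => ?_
  simp only [bilinL, pdArray, Christoffel]
  ring

lemma IsMetricOn.differentiableAt {d : ℕ} {g : Met d} {V : Set (Vec d)} (hg : IsMetricOn g V)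
    (hV : IsOpen V) {x : Vec d} (hx : x ∈ V) (α β : Fin (d + 1)) :
    DifferentiableAt ℝ (fun y => g y α β) x :=
  ((hg.1 α β).contDiffAt (hV.mem_nhds hx)).differentiableAt (by simp)

lemma IsMetricOn.pdArray_symm {d : ℕ} {g : Met d} {V : Set (Vec d)} (hg : IsMetricOn g V)
    (hV : IsOpen V) {x : Vec d} (hx : x ∈ V) (γ α β : Fin (d + 1)) :
    pdArray g x γ α β = pdArray g x γ β α := by
  have hev : (fun y => g y α β) =ᶠ[𝓝 x] fun y => g y β α := by
    filter_upwards [hV.mem_nhds hx] with y hy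
    exact (hg.2.1 y hy).apply β α
  rw [pdArray, pdArray, pd, pd, hev.fderiv_eq]

lemma pdArray_eq_add_sub {d : ℕ} {p q : SymMat d} {x : Vec d}
    (hp : ∀ α β, DifferentiableAt ℝ (fun y => p y α β) x)
    (hq : ∀ α β, DifferentiableAt ℝ (fun y => q y α β) x) :
    pdArray p x = pdArray q x + pdArray (fun y => p y - q y) x := by
  funext γ α β
  have hsub : pdArray (fun y => p y - q y) x γ α β = pdArray p x γ α β - pdArray q x γ α β := by
    simp only [pdArray, pd, Matrix.sub_apply]
    rw [fderiv_fun_sub (hp α β) (hq α β)]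
    rfl
  simp only [Pi.add_apply, hsub]
  ring

/-- Linear structure of the quadratic form `B`. -/
theorem stmt13
    (d : ℕ) (hd : 1 ≤ d) (C1 : ℝ) (hC1 : 1 ≤ C1) :
    ∃ C2 : ℝ, ∀ lam : ℝ, lam ∈ Set.Ioc (0 : ℝ) 1 →
      ∀ V : Set (Vec d), IsOpen V →
      ∀ g0 gl : Met d, IsMetricOn g0 V → IsMetricOn gl V →
      (∀ x ∈ V, ∀ α β : Fin (d + 1), |g0 x α β| ≤ C1 ∧ |ginv g0 x α β| ≤ C1) →
      (∀ x ∈ V, ∀ γ α β : Fin (d + 1), |pd γ (fun y => g0 y α β) x| ≤ C1) →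
      (∀ x ∈ V, ∀ γ δ α β : Fin (d + 1), |pd δ (pd γ (fun y => g0 y α β)) x| ≤ C1) →
      (∀ x ∈ V, ∀ α β : Fin (d + 1), |gl x α β| ≤ C1 ∧ |ginv gl x α β| ≤ C1) →
      (∀ x ∈ V, ∀ γ α β : Fin (d + 1), |pd γ (fun y => gl y α β) x| ≤ C1) →
      (∀ x ∈ V, ∀ α β : Fin (d + 1), |gl x α β - g0 x α β| ≤ C1 * lam) →
      ∀ x ∈ V, ∀ μ ν : Fin (d + 1),
        |Bq gl gl gl μ ν x - Bq g0 g0 g0 μ ν x -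
          Lq g0 (fun y => gl y - g0 y) μ ν x -
          Bq g0 (fun y => gl y - g0 y) (fun y => gl y - g0 y) μ ν x| ≤ C2 * lam := by
  refine ⟨((d + 1 : ℕ) : ℝ) ^ 4 *
    (2 * C1 * (((d + 1 : ℕ) : ℝ) ^ 2 * (C1 * C1 * C1)) * (5 * C1 ^ 2)), ?_⟩
  intro lam _ V hV g0 gl hg0 hgl hb0 _ _ hbl hdl hh x hx μ ν
  have hsymm : (ginv g0 x).IsSymm := by
    rw [Matrix.IsSymm, ginv, Matrix.transpose_nonsing_inv, (hg0.2.1 x hx).eq]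
  have hadd := pdArray_eq_add_sub (hgl.differentiableAt hV hx) (hg0.differentiableAt hV hx)
  have hexp : contract₂ (ginv g0 x) (bilinB (pdArray gl x) (pdArray gl x) μ ν) =
      Bq g0 g0 g0 μ ν x + Lq g0 (fun y => gl y - g0 y) μ ν x +
        Bq g0 (fun y => gl y - g0 y) (fun y => gl y - g0 y) μ ν x := by
    rw [Bq_eq_contract₂, Bq_eq_contract₂, Lq_eq_contract₂,
      ← contract₂_bilinB_cross hsymm (hg0.pdArray_symm hV hx), hadd]
    simp only [← contract₂_add, ← bilinB_add_add]
  have hinv := abs_inv_sub_inv_le (hgl.2.2 x hx) (hg0.2.2 x hx) (fun α β => (hbl x hx α β).2)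
    (fun α β => (hb0 x hx α β).2) (hh x hx)
  have hbound := abs_contract₂_sub_le (fun α β => (hbl x hx α β).2) (fun α β => (hb0 x hx α β).2)
    hinv (abs_bilinB_self_le (P := pdArray gl x) (hdl x hx) μ ν)
  rw [hexp, ← Bq_eq_contract₂] at hbound
  calc _ = _ := by congr 1; ring
    _ ≤ _ := hbound
    _ = _ := by ring

end
end
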